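/- For all k ≥ 2, all d, μ > 0 and every strictly 1-balanced k-graph F belonging to the family F(til), there exist C, ε > 0 with the following property. Let G be a uniformly (ε,d)-dense n-vertex k-graph with δ_1(G) ≥ μ·n^{k−1}, suppose p ≥ C·(log n)^{1/e(F)}·n^{−1/d_1(F)} and v(F) divides n. Then the random sparsification G_p contains a perfect F-tiling with high probability. -/

import Mathlib

/-- `G` is a `k`-uniform hypergraph on vertex set `Fin n`. -/
def IsHG (k n : ℕ) (G : Finset (Finset (Fin n))) : Prop := ∀ e ∈ G, e.card = k

/-- Minimum `d`-degree of `G` is at least `m` (as a real number). -/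
def MinDegGE {n : ℕ} (G : Finset (Finset (Fin n))) (d : ℕ) (m : ℝ) : Prop :=
  ∀ S : Finset (Fin n), S.card = d → m ≤ ((G.filter (fun e => S ⊆ e)).card : ℝ)

open Classical in
/-- Probability that the random sparsification of `G` (each edge kept
independently with probability `p`) satisfies `Q`. -/
noncomputable def sparsProb {α : Type*} [DecidableEq α] (G : Finset α) (p : ℝ)
    (Q : Finset α → Prop) : ℝ :=
  ∑ E ∈ G.powerset, if Q E then p ^ E.card * (1 - p) ^ (G.card - E.card) else 0

/-- The edge set `E` on `Fin n` contains a perfect `F`-tiling. -/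
def HasPerfectTiling (m n : ℕ) (F : Finset (Finset (Fin m)))
    (E : Finset (Finset (Fin n))) : Prop :=
  ∃ T : Finset (Fin m → Fin n),
    (∀ φ ∈ T, Function.Injective φ ∧ ∀ e ∈ F, e.image φ ∈ E) ∧
    (∀ v : Fin n, ∃ φ ∈ T, v ∈ Finset.image φ Finset.univ) ∧
    (∀ φ ∈ T, ∀ ψ ∈ T, φ ≠ ψ →
      Disjoint (Finset.image φ Finset.univ) (Finset.image ψ Finset.univ))

/-- The 1-density `d₁(F) = e(F)/(v(F)-1)`. -/
noncomputable def oneDensity (m : ℕ) (F : Finset (Finset (Fin m))) : ℝ :=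
  (F.card : ℝ) / ((m : ℝ) - 1)

/-- `F` is strictly 1-balanced. -/
def StrictlyOneBalanced (m : ℕ) (F : Finset (Finset (Fin m))) : Prop :=
  ∀ (V' : Finset (Fin m)) (E' : Finset (Finset (Fin m))),
    E' ⊆ F → (∀ e ∈ E', e ⊆ V') → E'.Nonempty →
    ¬(V' = Finset.univ ∧ E' = F) →
    (E'.card : ℝ) / ((V'.card : ℝ) - 1) < oneDensity m F

/-- The number of `k`-tuples `(v₁,…,v_k)` with `v_i ∈ X i` forming an edge. -/
noncomputable def eCount (k n : ℕ) (G : Finset (Finset (Fin n)))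
    (X : Fin k → Finset (Fin n)) : ℕ :=
  (Finset.univ.filter (fun f : Fin k → Fin n =>
    (∀ i, f i ∈ X i) ∧ Finset.image f Finset.univ ∈ G)).card

/-- `G` is uniformly `(ε,d)`-dense. -/
def UniformlyDense (k n : ℕ) (ε d : ℝ) (G : Finset (Finset (Fin n))) : Prop :=
  ∀ X : Fin k → Finset (Fin n),
    d * (∏ i, ((X i).card : ℝ)) - ε * (n : ℝ) ^ k ≤ (eCount k n G X : ℝ)

/-- `F` belongs to the family `𝓕(til)`: for all `d, μ > 0` there is `ε > 0`
such that every large enough uniformly `(ε,d)`-dense `n`-vertex `k`-graph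
with `δ₁(G) ≥ μ·C(n-1, k-1)` and `v(F) ∣ n` has a perfect `F`-tiling. -/
def InFtil (k m : ℕ) (F : Finset (Finset (Fin m))) : Prop :=
  ∀ d μ : ℝ, 0 < d → 0 < μ → ∃ ε : ℝ, 0 < ε ∧ ∃ n₀ : ℕ, ∀ n, n₀ ≤ n → m ∣ n →
    ∀ G : Finset (Finset (Fin n)), IsHG k n G → UniformlyDense k n ε d G →
      MinDegGE G 1 (μ * (((n - 1).choose (k - 1) : ℕ) : ℝ)) →
      HasPerfectTiling m n F G

section
variable {α : Type*} [Fintype α] [DecidableEq α]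

/-- Weight of `S` under the product measure with marginals `p`. -/
noncomputable def wt (p : α → ℝ) (S : Finset α) : ℝ :=
  ∏ i, if i ∈ S then p i else 1 - p i

/-- Expectation of `f` under the random subset with independent marginals `p`. -/
noncomputable def ev (p : α → ℝ) (f : Finset α → ℝ) : ℝ := ∑ S, wt p S * f S

lemma wt_nonneg {p : α → ℝ} (h0 : ∀ i, 0 ≤ p i) (h1 : ∀ i, p i ≤ 1) (S : Finset α) :
    0 ≤ wt p S := by
  refine Finset.prod_nonneg fun i _ => ?_
  split_ifs
  · exact h0 i
  · linarith [h1 i]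

lemma sum_wt (p : α → ℝ) : ∑ S, wt p S = 1 := by
  have h := Finset.prod_add p (fun i => 1 - p i) Finset.univ
  simp only [add_sub_cancel, Finset.prod_const_one, Finset.powerset_univ] at h
  rw [h]
  refine Finset.sum_congr rfl fun S _ => ?_
  rw [wt, Finset.prod_ite]
  congr 1
  · simp
  · refine Finset.prod_congr ?_ fun _ _ => rfl
    ext; simp

lemma ev_const (p : α → ℝ) (c : ℝ) : ev p (fun _ => c) = c := by
  rw [ev, ← Finset.sum_mul, sum_wt, one_mul]

lemma ev_mono {p : α → ℝ} (h0 : ∀ i, 0 ≤ p i) (h1 : ∀ i, p i ≤ 1) {f g : Finset α → ℝ}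
    (h : ∀ S, f S ≤ g S) : ev p f ≤ ev p g :=
  Finset.sum_le_sum fun S _ => mul_le_mul_of_nonneg_left (h S) (wt_nonneg h0 h1 S)

lemma ev_nonneg {p : α → ℝ} (h0 : ∀ i, 0 ≤ p i) (h1 : ∀ i, p i ≤ 1) {f : Finset α → ℝ}
    (h : ∀ S, 0 ≤ f S) : 0 ≤ ev p f :=
  Finset.sum_nonneg fun S _ => mul_nonneg (wt_nonneg h0 h1 S) (h S)

lemma ev_add (p : α → ℝ) (f g : Finset α → ℝ) :
    ev p (fun S => f S + g S) = ev p f + ev p g := by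
  simp only [ev, mul_add, Finset.sum_add_distrib]

lemma ev_sub (p : α → ℝ) (f g : Finset α → ℝ) :
    ev p (fun S => f S - g S) = ev p f - ev p g := by
  simp only [ev, mul_sub, Finset.sum_sub_distrib]

lemma ev_mul_left (p : α → ℝ) (c : ℝ) (f : Finset α → ℝ) :
    ev p (fun S => c * f S) = c * ev p f := by
  simp only [ev, Finset.mul_sum]
  exact Finset.sum_congr rfl fun _ _ => by ring

lemma ev_sum {ι : Type*} (p : α → ℝ) (s : Finset ι) (f : ι → Finset α → ℝ) :
    ev p (fun S => ∑ j ∈ s, f j S) = ∑ j ∈ s, ev p (f j) := by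
  simp only [ev, Finset.mul_sum]
  exact Finset.sum_comm

/-- The weight of all coordinates but `i`. -/
noncomputable def wtErase (p : α → ℝ) (i : α) (S : Finset α) : ℝ :=
  ∏ j ∈ Finset.univ.erase i, if j ∈ S then p j else 1 - p j

lemma wt_eq (p : α → ℝ) (i : α) (S : Finset α) :
    wt p S = (if i ∈ S then p i else 1 - p i) * wtErase p i S := by
  exact (Finset.mul_prod_erase Finset.univ (fun j => if j ∈ S then p j else 1 - p j)
    (Finset.mem_univ i)).symm

lemma wtErase_insert (p : α → ℝ) (i : α) (S : Finset α) :
    wtErase p i (insert i S) = wtErase p i S := by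
  refine Finset.prod_congr rfl fun j hj => ?_
  simp [Finset.ne_of_mem_erase hj]

lemma sum_split (i : α) (f : Finset α → ℝ) :
    ∑ S, f S = ∑ S : Finset α with i ∉ S, (f (insert i S) + f S) := by
  rw [← Finset.sum_filter_not_add_sum_filter Finset.univ (fun S : Finset α => i ∉ S),
    Finset.sum_add_distrib]
  congr 1
  refine Finset.sum_bij' (fun S _ => S.erase i) (fun S _ => insert i S) ?_ ?_ ?_ ?_ ?_ <;>
    simp +contextual [Finset.insert_erase]

lemma ev_eq_sum (p : α → ℝ) (i : α) (f : Finset α → ℝ) :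
    ev p f = ∑ S : Finset α with i ∉ S,
      wtErase p i S * (p i * f (insert i S) + (1 - p i) * f S) := by
  rw [ev, sum_split i]
  refine Finset.sum_congr rfl fun S hS => ?_
  have hS' : i ∉ S := by simpa using hS
  rw [wt_eq p i, wt_eq p i S, wtErase_insert]
  simp [hS']
  ring

lemma ev_split (p : α → ℝ) (i : α) (f : Finset α → ℝ) :
    ev p f = p i * ev p (fun S => f (insert i S)) + (1 - p i) * ev p (fun S => f (S.erase i)) := by
  rw [ev_eq_sum p i f, ev_eq_sum p i (fun S => f (insert i S)),
    ev_eq_sum p i (fun S => f (S.erase i)), Finset.mul_sum, Finset.mul_sum,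
    ← Finset.sum_add_distrib]
  refine Finset.sum_congr rfl fun S hS => ?_
  have hS' : i ∉ S := by simpa using hS
  simp [Finset.erase_insert hS', Finset.erase_eq_of_notMem hS']
  ring

lemma ev_subset (p : α → ℝ) (A : Finset α) (f : Finset α → ℝ) :
    ev p (fun S => if A ⊆ S then f S else 0) = (∏ i ∈ A, p i) * ev p (fun S => f (S ∪ A)) := by
  induction A using Finset.induction_on generalizing f with
  | empty => simp
  | insert a A ha ih =>
    have h1 : (fun S => if insert a A ⊆ S then f S else 0) =
        fun S => if A ⊆ S then (if a ∈ S then f S else 0) else 0 := by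
      ext S
      by_cases h : a ∈ S <;> by_cases h' : A ⊆ S <;> simp [Finset.insert_subset_iff, h, h']
    rw [h1, ih, Finset.prod_insert ha, ev_split p a]
    have h2 : (fun S : Finset α => if a ∈ S.erase a ∪ A then f (S.erase a ∪ A) else 0) = fun _ => 0 := by
      ext S; simp [ha]
    rw [h2, ev_const]
    have h3 : (fun S => if a ∈ insert a S ∪ A then f (insert a S ∪ A) else 0) =
        fun S => f (S ∪ insert a A) := by
      ext S
      simp [Finset.insert_union, Finset.union_insert]
    rw [h3]; ring

lemma ev_ind_subset (p : α → ℝ) (A : Finset α) :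
    ev p (fun S => if A ⊆ S then 1 else 0) = ∏ i ∈ A, p i := by
  rw [ev_subset p A (fun _ => 1), ev_const, mul_one]

lemma ev_eq_pi (p : α → ℝ) (f : Finset α → ℝ) :
    ev p f = ∑ x : α → Bool,
      (∏ i, if x i then p i else 1 - p i) * f (Finset.univ.filter fun i => x i = true) := by
  refine Finset.sum_bij' (fun S _ => fun i => decide (i ∈ S))
    (fun x _ => Finset.univ.filter fun i => x i = true) ?_ ?_ ?_ ?_ ?_ <;> simp [wt]

lemma ev_union (p r : α → ℝ) (f : Finset α → ℝ) :
    ev p (fun S => ev r (fun T => f (S ∪ T))) = ev (fun i => 1 - (1 - p i) * (1 - r i)) f := by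
  rw [ev_eq_pi p, ev_eq_pi _ f]
  have h : ∀ z : α → Bool, (∏ i, if z i then 1 - (1 - p i) * (1 - r i) else
      1 - (1 - (1 - p i) * (1 - r i))) = ∑ xy : α → Bool × Bool with
        (fun i => (xy i).1 || (xy i).2) = z,
        ∏ i, ((if (xy i).1 then p i else 1 - p i) * (if (xy i).2 then r i else 1 - r i)) := by
    intro z
    have h1 : ∀ i, (if z i then 1 - (1 - p i) * (1 - r i) else
      1 - (1 - (1 - p i) * (1 - r i))) = ∑ b ∈ Finset.univ.filter
        (fun b : Bool × Bool => (b.1 || b.2) = z i),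
        ((if b.1 then p i else 1 - p i) * (if b.2 then r i else 1 - r i)) := by
      intro i
      rw [Finset.sum_filter, Fintype.sum_prod_type]
      cases z i <;> simp <;> ring
    rw [Finset.prod_congr rfl fun i _ => h1 i, Finset.prod_univ_sum]
    refine Finset.sum_congr ?_ fun _ _ => rfl
    ext xy
    simp [funext_iff]
  simp only [h, Finset.sum_mul]
  rw [Finset.sum_comm' (s' := fun xy : α → Bool × Bool =>
    {fun i => (xy i).1 || (xy i).2}) (t' := Finset.univ) (by
      intro a b
      simp only [Finset.mem_univ, Finset.mem_filter, true_and, Finset.mem_singleton, and_true]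
      exact eq_comm)]
  simp only [Finset.sum_singleton]
  simp only [ev_eq_pi r, Finset.mul_sum]
  rw [← Finset.sum_product', Finset.univ_product_univ]
  refine Fintype.sum_equiv (Equiv.arrowProdEquivProdArrow α (fun _ => Bool) (fun _ => Bool)).symm _ _ fun xy => ?_
  rw [← mul_assoc, ← Finset.prod_mul_distrib]
  congr 2
  ext i
  simp [Equiv.arrowProdEquivProdArrow]

/-- Monotonicity of the expectation of a monotone function in the marginals. -/
lemma ev_le_ev {p r : α → ℝ} (h0 : ∀ i, 0 ≤ p i) (hpr : ∀ i, p i ≤ r i) (h1 : ∀ i, r i ≤ 1)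
    {f : Finset α → ℝ} (hf : Monotone f) : ev p f ≤ ev r f := by
  have h : ∀ i, ∃ s, 0 ≤ s ∧ s ≤ 1 ∧ 1 - (1 - p i) * (1 - s) = r i := by
    intro i
    by_cases hp : p i = 1
    · refine ⟨0, le_rfl, zero_le_one, ?_⟩
      have := hpr i; have := h1 i
      nlinarith
    · have hp' : 0 < 1 - p i := by
        have := (hpr i).trans (h1 i)
        have := lt_of_le_of_ne this hp
        linarith
      refine ⟨1 - (1 - r i) / (1 - p i), ?_, ?_, ?_⟩
      · rw [sub_nonneg, div_le_one hp']; linarith [hpr i]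
      · linarith [div_nonneg (sub_nonneg.2 (h1 i)) hp'.le]
      · field_simp; ring
  choose s hs0 hs1 hs using h
  have := ev_union p s f
  simp only [hs] at this
  rw [← this]
  refine ev_mono h0 (fun i => (hpr i).trans (h1 i)) fun S => ?_
  calc f S = ev s (fun _ => f S) := (ev_const s _).symm
    _ ≤ _ := ev_mono hs0 hs1 fun T => hf Finset.subset_union_left

end

section
variable {Φ ι : Type*} [Fintype Φ] [DecidableEq Φ]

/-- The sets `T ω`, `ω ∈ O`, are `q`-spread relative to total mass `N`. -/
def Spread (O : Finset ι) (T : ι → Finset Φ) (q N : ℝ) : Prop :=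
  ∀ A : Finset Φ, ((O.filter fun ω => A ⊆ T ω).card : ℝ) ≤ q ^ A.card * N

lemma Spread.card_le {O : Finset ι} {T : ι → Finset Φ} {q N : ℝ} (h : Spread O T q N) :
    (O.card : ℝ) ≤ N := by
  simpa using h ∅

/-- Those `ω` for which `W ∪ T ω` contains no `T ω'` with a small remainder outside `W`. -/
def stuck (O : Finset ι) (T : ι → Finset Φ) (s : ℕ) (W : Finset Φ) : Finset ι :=
  O.filter fun ω => ∀ ω' ∈ O, T ω' ⊆ W ∪ T ω → s < (T ω' \ W).card

/-- Weighted number of the sets `T ω'` inside `Y`. -/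
noncomputable def partition (O : Finset ι) (T : ι → Finset Φ) (ρ : ℝ) (Y : Finset Φ) : ℝ :=
  ∑ ω ∈ O, if T ω ⊆ Y then (ρ⁻¹) ^ (T ω).card else 0

lemma ev_partition_lt {O : Finset ι} {T : ι → Finset Φ} {ρ B : ℝ} (hρ : 0 < ρ) (hρ1 : ρ ≤ 1)
    (hB : 0 ≤ B) :
    ev (fun _ => ρ) (fun W => ∑ ω ∈ O, if partition O T ρ (W ∪ T ω) < B then (1 : ℝ) else 0)
      ≤ B := by
  have h : ∀ ω, ev (fun _ => ρ) (fun W => if partition O T ρ (W ∪ T ω) < B then (1 : ℝ) else 0) =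
      ev (fun _ => ρ) (fun W => if T ω ⊆ W then
        (ρ⁻¹) ^ (T ω).card * (if partition O T ρ W < B then (1 : ℝ) else 0) else 0) := by
    intro ω
    rw [ev_subset (fun _ => ρ) (T ω)
      (fun W => (ρ⁻¹) ^ (T ω).card * (if partition O T ρ W < B then (1 : ℝ) else 0)),
      ev_mul_left, ← mul_assoc, Finset.prod_const, ← mul_pow, mul_inv_cancel₀ hρ.ne', one_pow,
      one_mul]
  rw [ev_sum, Finset.sum_congr rfl fun ω _ => h ω, ← ev_sum]
  calc _ ≤ ev (fun _ : Φ => ρ) (fun _ => B) := by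
        refine ev_mono (fun _ => hρ.le) (fun _ => hρ1) fun W => ?_
        by_cases hW : partition O T ρ W < B
        · simp only [hW, if_true, mul_one]
          exact hW.le
        · simp [hW, hB]
    _ = B := ev_const _ _

lemma ev_sum_inter {O : Finset ι} {T : ι → Finset Φ} {q N ρ κ : ℝ} {s : ℕ} (hρ : 0 < ρ)
    (hspread : Spread O T q N) (hN : 0 ≤ N) (ω : ι)
    (hκ : ∑ A ∈ (T ω).powerset with s < A.card, (q / ρ) ^ A.card ≤ κ) :
    ev (fun _ => ρ) (fun W => ∑ ω' ∈ O with s < (T ω' ∩ T ω).card,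
      if T ω' ⊆ W ∪ T ω then (ρ⁻¹) ^ (T ω').card else 0) ≤ κ * N := by
  have h : ∀ ω', ev (fun _ => ρ) (fun W => if T ω' ⊆ W ∪ T ω then (ρ⁻¹) ^ (T ω').card else 0) =
      (ρ⁻¹) ^ (T ω' ∩ T ω).card := by
    intro ω'
    have h1 : (fun W => if T ω' ⊆ W ∪ T ω then (ρ⁻¹) ^ (T ω').card else 0) =
        fun W => (ρ⁻¹) ^ (T ω').card * (if T ω' \ T ω ⊆ W then 1 else 0) := by
      ext W
      have h2 : T ω' ⊆ W ∪ T ω ↔ T ω' \ T ω ⊆ W := by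
        rw [Finset.union_comm]; exact sdiff_le_iff.symm
      simp only [h2, mul_ite, mul_one, mul_zero]
    rw [h1, ev_mul_left, ev_ind_subset, Finset.prod_const,
      ← Finset.card_sdiff_add_card_inter (T ω') (T ω), pow_add]
    rw [mul_right_comm, ← mul_pow, inv_mul_cancel₀ hρ.ne', one_pow, one_mul]
  rw [ev_sum, Finset.sum_congr rfl fun ω' _ => h ω']
  calc ∑ ω' ∈ O with s < (T ω' ∩ T ω).card, (ρ⁻¹) ^ (T ω' ∩ T ω).card
      = ∑ A ∈ (T ω).powerset with s < A.card, ∑ ω' ∈ O with T ω' ∩ T ω = A, (ρ⁻¹) ^ A.card := by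
        rw [Finset.sum_comm' (s' := fun ω' => {T ω' ∩ T ω})
          (t' := O.filter fun ω' => s < (T ω' ∩ T ω).card)]
        · simp
        · intro A ω'
          simp only [Finset.mem_filter, Finset.mem_powerset, Finset.mem_singleton]
          constructor
          · rintro ⟨⟨h1, h2⟩, h3, rfl⟩
            exact ⟨rfl, h3, h2⟩
          · rintro ⟨rfl, h1, h2⟩
            exact ⟨⟨Finset.inter_subset_right, h2⟩, h1, rfl⟩
    _ ≤ ∑ A ∈ (T ω).powerset with s < A.card, (q / ρ) ^ A.card * N := by
        refine Finset.sum_le_sum fun A _ => ?_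
        rw [Finset.sum_const, nsmul_eq_mul]
        calc _ ≤ (q ^ A.card * N) * (ρ⁻¹) ^ A.card := by
              refine mul_le_mul_of_nonneg_right (le_trans ?_ (hspread A)) (by positivity)
              refine Nat.cast_le.2 (Finset.card_le_card fun x hx => ?_)
              simp only [Finset.mem_filter] at hx ⊢
              exact ⟨hx.1, hx.2 ▸ Finset.inter_subset_left⟩
          _ = _ := by rw [div_eq_mul_inv, mul_pow]; ring
    _ ≤ κ * N := by
        rw [← Finset.sum_mul]
        exact mul_le_mul_of_nonneg_right hκ hN

lemma ev_card_stuck_le {O : Finset ι} {T : ι → Finset Φ} {q N ρ κ θ : ℝ} {s : ℕ} (hρ : 0 < ρ)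
    (hρ1 : ρ ≤ 1) (hspread : Spread O T q N) (hN : 0 < N) (hθ : 0 < θ) (hκ0 : 0 ≤ κ)
    (hκ : ∀ ω ∈ O, ∑ A ∈ (T ω).powerset with s < A.card, (q / ρ) ^ A.card ≤ κ) :
    ev (fun _ => ρ) (fun W => ((stuck O T s W).card : ℝ)) ≤ (θ + κ / θ) * N := by
  have hθN : 0 < θ * N := mul_pos hθ hN
  have hρi : 0 ≤ ρ⁻¹ := inv_nonneg.2 hρ.le
  calc _ ≤ ev (fun _ => ρ) (fun W =>
        (∑ ω ∈ O, if partition O T ρ (W ∪ T ω) < θ * N then (1 : ℝ) else 0) +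
        (θ * N)⁻¹ * ∑ ω ∈ O, ∑ ω' ∈ O with s < (T ω' ∩ T ω).card,
          if T ω' ⊆ W ∪ T ω then (ρ⁻¹) ^ (T ω').card else 0) := by
        refine ev_mono (fun _ => hρ.le) (fun _ => hρ1) fun W => ?_
        rw [stuck, Finset.mul_sum, ← Finset.sum_add_distrib, Finset.card_filter, Nat.cast_sum]
        refine Finset.sum_le_sum fun ω _ => ?_
        have h0 : 0 ≤ ∑ ω' ∈ O with s < (T ω' ∩ T ω).card,
            (if T ω' ⊆ W ∪ T ω then (ρ⁻¹) ^ (T ω').card else 0) :=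
          Finset.sum_nonneg fun ω' _ => by split_ifs <;> positivity
        split_ifs with h1 h2 h2
        · have := mul_nonneg (inv_nonneg.2 hθN.le) h0
          push_cast; linarith
        · push_cast
          rw [zero_add, ← div_eq_inv_mul, le_div_iff₀ hθN, one_mul]
          refine (not_lt.1 h2).trans (le_of_eq ?_)
          rw [partition, Finset.sum_filter]
          refine Finset.sum_congr rfl fun ω' hω' => ?_
          by_cases h3 : T ω' ⊆ W ∪ T ω
          · have h4 : s < (T ω' ∩ T ω).card := by
              refine (h1 ω' hω' h3).trans_le (Finset.card_le_card fun x hx => ?_)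
              rw [Finset.mem_sdiff] at hx
              have := h3 hx.1
              simp only [Finset.mem_union] at this
              exact Finset.mem_inter.2 ⟨hx.1, this.resolve_left hx.2⟩
            simp [h3, h4]
          · simp [h3]
        · have := mul_nonneg (inv_nonneg.2 hθN.le) h0
          push_cast; linarith
        · have := mul_nonneg (inv_nonneg.2 hθN.le) h0
          push_cast; linarith
    _ ≤ θ * N + (θ * N)⁻¹ * (N * (κ * N)) := by
        rw [ev_add, ev_mul_left]
        refine add_le_add (ev_partition_lt hρ hρ1 hθN.le)
          (mul_le_mul_of_nonneg_left ?_ (inv_nonneg.2 hθN.le))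
        rw [ev_sum]
        refine (Finset.sum_le_sum fun ω hω =>
          ev_sum_inter hρ hspread hN.le ω (hκ ω hω)).trans ?_
        rw [Finset.sum_const, nsmul_eq_mul]
        exact mul_le_mul_of_nonneg_right hspread.card_le (by positivity)
    _ = _ := by field_simp

lemma sum_powerset_pow_le {T : Finset Φ} {t : ℕ} (hT : T.card ≤ t) {x : ℝ} (hx0 : 0 ≤ x)
    (hx1 : x ≤ 1) (s : ℕ) :
    ∑ A ∈ T.powerset with s < A.card, x ^ A.card ≤ 2 ^ t * x ^ (s + 1) := by
  calc _ ≤ ∑ A ∈ T.powerset with s < A.card, x ^ (s + 1) := by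
        refine Finset.sum_le_sum fun A hA => ?_
        exact pow_le_pow_of_le_one hx0 hx1 (Finset.mem_filter.1 hA).2
    _ ≤ _ := by
        rw [Finset.sum_const, nsmul_eq_mul]
        refine mul_le_mul_of_nonneg_right ?_ (by positivity)
        have h1 : (T.powerset.filter fun A => s < A.card).card ≤ 2 ^ t :=
          (Finset.card_filter_le _ _).trans
            (by rw [Finset.card_powerset]; exact Nat.pow_le_pow_right (by norm_num) hT)
        exact_mod_cast h1

lemma sum_powerset_pow_pos_le {T : Finset Φ} {t : ℕ} (hT : T.card ≤ t) {x : ℝ} (hx0 : 0 ≤ x) :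
    ∑ A ∈ T.powerset with 0 < A.card, x ^ A.card ≤ (1 + x) ^ t - 1 := by
  have h : ∑ A ∈ T.powerset, x ^ A.card = (1 + x) ^ T.card := by
    rw [← Finset.prod_const, Finset.prod_one_add]
    simp
  have h2 : ∑ A ∈ T.powerset with 0 < A.card, x ^ A.card = ∑ A ∈ T.powerset, x ^ A.card - 1 := by
    rw [← Finset.sum_filter_add_sum_filter_not T.powerset (fun A => 0 < A.card)]
    have : T.powerset.filter (fun A => ¬ 0 < A.card) = {∅} := by
      ext A
      simp only [Finset.mem_filter, Finset.mem_powerset, Finset.mem_singleton, not_lt,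
        nonpos_iff_eq_zero, Finset.card_eq_zero]
      exact ⟨fun h => h.2, fun h => by simp [h]⟩
    rw [this]; simp
  rw [h2, h]
  exact sub_le_sub_right (pow_le_pow_right₀ (by linarith) hT) _

open Classical in
/-- Indicator of the event that `W` contains some `T ω`. -/
noncomputable def hit (O : Finset ι) (T : ι → Finset Φ) (W : Finset Φ) : ℝ :=
  if ∃ ω ∈ O, T ω ⊆ W then 1 else 0

lemma hit_mono (O : Finset ι) (T : ι → Finset Φ) : Monotone (hit O T) := by
  intro W W' h
  unfold hit
  split_ifs with h1 h2
  · exact le_rfl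
  · obtain ⟨ω, hω, hT⟩ := h1
    exact absurd ⟨ω, hω, hT.trans h⟩ h2
  · exact zero_le_one
  · exact le_rfl

lemma card_stuck_le (O : Finset ι) (T : ι → Finset Φ) (s : ℕ) (W : Finset Φ) :
    (stuck O T s W).card ≤ O.card := Finset.card_filter_le _ _

/-- A sample of density `ρ` shrinks the spread family to remainders of size at most `s`. -/
lemma exists_remainder (O : Finset ι) (T : ι → Finset Φ) {q N : ℝ} (hspread : Spread O T q N)
    (s : ℕ) (W : Finset Φ) :
    ∃ (O' : Finset ι) (T' : ι → Finset Φ), Spread O' T' q N ∧ (∀ ω ∈ O', (T' ω).card ≤ s) ∧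
      (O'.card : ℝ) = O.card - (stuck O T s W).card ∧
      ∀ W', hit O' T' W' ≤ hit O T (W ∪ W') := by
  classical
  have h : ∀ ω, ∃ ω', ω ∈ O \ stuck O T s W →
      ω' ∈ O ∧ T ω' ⊆ W ∪ T ω ∧ (T ω' \ W).card ≤ s := by
    intro ω
    by_cases hω : ω ∈ O \ stuck O T s W
    · rw [Finset.mem_sdiff, stuck, Finset.mem_filter] at hω
      have h2 : ¬ ∀ ω' ∈ O, T ω' ⊆ W ∪ T ω → s < (T ω' \ W).card := fun h3 => hω.2 ⟨hω.1, h3⟩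
      push Not at h2
      obtain ⟨ω', h3, h4, h5⟩ := h2
      exact ⟨ω', fun _ => ⟨h3, h4, h5⟩⟩
    · exact ⟨ω, fun h => absurd h hω⟩
  choose g hg using h
  refine ⟨O \ stuck O T s W, fun ω => T (g ω) \ W, ?_, ?_, ?_, ?_⟩
  · intro A
    refine le_trans (Nat.cast_le.2 (Finset.card_le_card ?_)) (hspread A)
    intro ω hω
    rw [Finset.mem_filter] at hω ⊢
    refine ⟨(Finset.mem_sdiff.1 hω.1).1, hω.2.trans ?_⟩
    exact sdiff_le_iff.2 (hg ω hω.1).2.1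
  · exact fun ω hω => (hg ω hω).2.2
  · rw [Finset.card_sdiff_of_subset (by exact Finset.filter_subset _ _ : stuck O T s W ⊆ O), Nat.cast_sub (card_stuck_le _ _ _ _)]
  · intro W'
    unfold hit
    split_ifs with h1 h2
    · exact le_rfl
    · obtain ⟨ω, hω, hT⟩ := h1
      exact absurd ⟨g ω, (hg ω hω).1, sdiff_le_iff.1 hT⟩ h2
    · exact zero_le_one
    · exact le_rfl

/-- Iterated sampling hits a member of a spread family. -/
lemma le_ev_hit {q N ρ' θ' : ℝ} {t₀ : ℕ} (hq : 0 < q) (hN : 0 < N) (hρ' : 0 < ρ')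
    (hθ' : 0 < θ') (ht₀ : 2 ≤ t₀) (hfin : (1 + q / ρ') ^ t₀ - 1 ≤ θ' ^ 2) (t : ℕ) :
    ∀ (O : Finset ι) (T : ι → Finset Φ), Spread O T q N → (∀ ω ∈ O, (T ω).card ≤ t) →
      ∀ π : ℝ, ρ' + 64 * q * (Nat.log 2 t + 1) ≤ π → π ≤ 1 →
        O.card / N - 2 * θ' - (Nat.log 2 t + 1) * (2 * (1 / 2) ^ t₀) ≤
          ev (fun _ => π) (hit O T) := by
  induction t using Nat.strong_induction_on with
  | _ t ih =>
  intro O T hspread hT π hπ hπ1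
  have hlog : (0 : ℝ) ≤ Nat.log 2 t := Nat.cast_nonneg _
  have hρπ : ρ' ≤ π := by nlinarith
  have hπ0 : 0 < π := hρ'.trans_le hρπ
  rcases lt_or_ge t t₀ with ht | ht
  · have hκ : ∀ ω ∈ O, ∑ A ∈ (T ω).powerset with 0 < A.card, (q / π) ^ A.card ≤ θ' ^ 2 := by
      intro ω hω
      refine (sum_powerset_pow_pos_le ((hT ω hω).trans ht.le) (by positivity)).trans ?_
      refine le_trans (sub_le_sub_right ?_ _) hfin
      gcongr
    have h1 := ev_card_stuck_le hπ0 hπ1 hspread hN hθ' (sq_nonneg θ') hκ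
    have h2 : ∀ W, (O.card / N : ℝ) - N⁻¹ * (stuck O T 0 W).card ≤ hit O T W := by
      intro W
      obtain ⟨O', T', -, hs, hc, hh⟩ := exists_remainder O T hspread 0 W
      have hh := hh ∅
      rw [Finset.union_empty] at hh
      refine le_trans ?_ hh
      rw [← div_eq_inv_mul, ← sub_div, ← hc]
      unfold hit
      split_ifs with h3
      · rw [div_le_one hN, hc]
        have := hspread.card_le
        have : (0 : ℝ) ≤ (stuck O T 0 W).card := Nat.cast_nonneg _
        linarith
      · have : O' = ∅ := by
          by_contra h4
          obtain ⟨ω, hω⟩ := Finset.nonempty_iff_ne_empty.2 h4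
          refine h3 ⟨ω, hω, ?_⟩
          have := hs ω hω
          rw [nonpos_iff_eq_zero, Finset.card_eq_zero] at this
          rw [this]
        simp [this]
    have h3 := ev_mono (fun _ : Φ => hπ0.le) (fun _ => hπ1) h2
    rw [ev_sub, ev_const, ev_mul_left] at h3
    have h4 : N⁻¹ * ev (fun _ => π) (fun W => ((stuck O T 0 W).card : ℝ)) ≤ 2 * θ' := by
      rw [← div_eq_inv_mul, div_le_iff₀ hN]
      refine h1.trans (le_of_eq ?_)
      field_simp; ring
    have h5 : (0 : ℝ) ≤ (Nat.log 2 t + 1) * (2 * (1 / 2) ^ t₀) := by positivity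
    linarith
  · have ht2 : 2 ≤ t := ht₀.trans ht
    have hlogt : Nat.log 2 t = Nat.log 2 (t / 2) + 1 :=
      Nat.log_of_one_lt_of_le (by norm_num) ht2
    set ρ := 64 * q with hρ
    have hρ0 : 0 < ρ := by positivity
    have hl2 : (Nat.log 2 t : ℝ) = Nat.log 2 (t / 2) + 1 := by exact_mod_cast hlogt
    have hl3 : (0 : ℝ) ≤ Nat.log 2 (t / 2) := Nat.cast_nonneg _
    have hρ1 : ρ ≤ 1 := by nlinarith
    have hκ : ∀ ω ∈ O, ∑ A ∈ (T ω).powerset with t / 2 < A.card, (q / ρ) ^ A.card ≤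
        ((1 / 2 : ℝ) ^ t) ^ 2 := by
      intro ω hω
      have hx : q / ρ = 1 / 64 := by rw [hρ]; field_simp
      rw [hx]
      refine (sum_powerset_pow_le (hT ω hω) (by norm_num) (by norm_num) _).trans ?_
      have h64 : (1 / 64 : ℝ) ^ (t / 2 + 1) ≤ (1 / 8) ^ t := by
        have : (1 / 64 : ℝ) = (1 / 8) ^ 2 := by norm_num
        rw [this, ← pow_mul]
        exact pow_le_pow_of_le_one (by norm_num) (by norm_num) (by omega)
      calc (2 : ℝ) ^ t * (1 / 64) ^ (t / 2 + 1) ≤ 2 ^ t * (1 / 8) ^ t := by gcongr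
        _ = _ := by rw [← mul_pow, ← pow_mul, mul_comm t 2, pow_mul]; norm_num
    have h1 := ev_card_stuck_le hρ0 hρ1 hspread hN (by positivity : (0 : ℝ) < (1 / 2) ^ t)
      (by positivity) hκ
    have h2 : ∀ W, (O.card / N : ℝ) - 2 * θ' - (Nat.log 2 (t / 2) + 1) * (2 * (1 / 2) ^ t₀) -
        N⁻¹ * (stuck O T (t / 2) W).card ≤
        ev (fun _ => π - ρ) (fun W' => hit O T (W ∪ W')) := by
      intro W
      obtain ⟨O', T', hs, hc', hc, hh⟩ := exists_remainder O T hspread (t / 2) W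
      have hπρ : 0 ≤ π - ρ := by nlinarith
      refine le_trans ?_ (ev_mono (fun _ => hπρ) (fun _ => by linarith) hh)
      refine le_trans (le_of_eq ?_) (ih (t / 2) (by omega) O' T' hs hc' (π - ρ) ?_ (by linarith))
      · rw [hc, sub_div, div_eq_inv_mul _ N, div_eq_inv_mul _ N]; ring
      · rw [hl2] at hπ
        linarith
    have h3 := ev_mono (fun _ : Φ => hρ0.le) (fun _ => hρ1) h2
    rw [ev_sub, ev_const, ev_mul_left, ev_union] at h3
    have h4 : N⁻¹ * ev (fun _ => ρ) (fun W => ((stuck O T (t / 2) W).card : ℝ)) ≤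
        2 * (1 / 2) ^ t₀ := by
      rw [← div_eq_inv_mul, div_le_iff₀ hN]
      refine h1.trans ?_
      have : ((1 / 2 : ℝ) ^ t) ≤ (1 / 2) ^ t₀ :=
        pow_le_pow_of_le_one (by norm_num) (by norm_num) ht
      have h6 : ((1 / 2 : ℝ) ^ t) ^ 2 / (1 / 2) ^ t = (1 / 2) ^ t := by
        field_simp
      rw [h6]
      nlinarith
    have hπρ : 0 ≤ π - ρ := by nlinarith
    have h5 : ev (fun _ => 1 - (1 - ρ) * (1 - (π - ρ))) (hit O T) ≤ ev (fun _ => π) (hit O T) := by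
      refine ev_le_ev (fun _ => ?_) (fun _ => ?_) (fun _ => hπ1) (hit_mono O T)
      · nlinarith
      · nlinarith
    rw [hl2]
    linarith
end

section
variable {α : Type*} [Fintype α] [DecidableEq α]

/-- `σ` extends the partial map `h`. -/
def Extends (σ : Equiv.Perm α) (h : Finset (α × α)) : Prop := ∀ p ∈ h, σ p.1 = p.2

/-- Two positions of a partial map conflict when they share a source or a target. -/
def Touches (g : Finset (α × α)) (p : α × α) : Prop := ∃ r ∈ g, r.1 = p.1 ∨ r.2 = p.2

open Classical in
/-- Permutations extending `h` and extending no member of `𝒩`. -/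
noncomputable def avoiders (h : Finset (α × α)) (𝒩 : Finset (Finset (α × α))) :
    Finset (Equiv.Perm α) :=
  Finset.univ.filter fun σ => Extends σ h ∧ ∀ g ∈ 𝒩, ¬ Extends σ g

lemma mem_avoiders {h : Finset (α × α)} {𝒩 : Finset (Finset (α × α))} {σ : Equiv.Perm α} :
    σ ∈ avoiders h 𝒩 ↔ Extends σ h ∧ ∀ g ∈ 𝒩, ¬ Extends σ g := by
  simp [avoiders]

lemma avoiders_anti (h : Finset (α × α)) {𝒩 𝒩' : Finset (Finset (α × α))} (hs : 𝒩' ⊆ 𝒩) :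
    avoiders h 𝒩 ⊆ avoiders h 𝒩' := fun σ hσ => by
  rw [mem_avoiders] at *
  exact ⟨hσ.1, fun g hg => hσ.2 g (hs hg)⟩

lemma card_avoiders_insert_mul_le {h : Finset (α × α)} {𝒩 : Finset (Finset (α × α))} {p : α × α}
    (hp : ¬ Touches h p) (hN : ∀ g ∈ 𝒩, ¬ Touches g p) :
    (avoiders (insert p h) 𝒩).card * (Fintype.card α - h.card) ≤ (avoiders h 𝒩).card := by
  have hT : Fintype.card α - h.card ≤ (Finset.univ \ h.image Prod.snd).card := by
    rw [← Finset.compl_eq_univ_sdiff, Finset.card_compl]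
    exact Nat.sub_le_sub_left Finset.card_image_le _
  refine (Nat.mul_le_mul_left _ hT).trans ?_
  rw [← Finset.card_product]
  refine Finset.card_le_card_of_injOn (fun a => a.1.trans (Equiv.swap p.2 a.2)) ?_ ?_
  · rintro ⟨σ, v⟩ ha
    simp only [Finset.coe_product, Set.mem_prod, Finset.mem_coe, Finset.mem_sdiff,
      Finset.mem_univ, true_and, Finset.mem_image, not_exists, not_and] at ha
    obtain ⟨h1, h2⟩ := ha
    rw [mem_avoiders] at h1
    have hσ : σ p.1 = p.2 := h1.1 p (Finset.mem_insert_self _ _)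
    rw [Finset.mem_coe, mem_avoiders]
    refine ⟨fun r hr => ?_, fun g hg hext => h1.2 g hg fun r hr => ?_⟩
    · have h3 := h1.1 r (Finset.mem_insert_of_mem hr)
      simp only [Equiv.trans_apply, h3]
      exact Equiv.swap_apply_of_ne_of_ne (fun h4 => hp ⟨r, hr, Or.inr h4⟩) (fun h4 => h2 r hr h4)
    · have h3 := hext r hr
      have h4 : r.1 ≠ p.1 := fun h5 => hN g hg ⟨r, hr, Or.inl h5⟩
      have h5 : r.2 ≠ p.2 := fun h5 => hN g hg ⟨r, hr, Or.inr h5⟩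
      simp only [Equiv.trans_apply] at h3
      have h6 : σ r.1 ≠ p.2 := fun h7 => h4 (σ.injective (h7.trans hσ.symm))
      have h7 : σ r.1 ≠ v := fun h8 => by
        rw [h8, Equiv.swap_apply_right] at h3
        exact h5 h3.symm
      rwa [Equiv.swap_apply_of_ne_of_ne h6 h7] at h3
  · rintro ⟨σ, v⟩ ha ⟨τ, w⟩ hb hab
    simp only [Finset.coe_product, Set.mem_prod, Finset.mem_coe] at ha hb
    have hσ : σ p.1 = p.2 := (mem_avoiders.1 ha.1).1 p (Finset.mem_insert_self _ _)
    have hτ : τ p.1 = p.2 := (mem_avoiders.1 hb.1).1 p (Finset.mem_insert_self _ _)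
    simp only at hab
    have hvw : v = w := by
      have := Equiv.congr_fun hab p.1
      simpa [hσ, hτ] using this
    subst hvw
    have : σ = τ := by
      ext x
      have := Equiv.congr_fun hab x
      simpa using this
    rw [this]

lemma avoiders_insert_eq_empty {h : Finset (α × α)} {𝒩 : Finset (Finset (α × α))} {p : α × α}
    (hp : p ∉ h) (ht : Touches h p) : avoiders (insert p h) 𝒩 = ∅ := by
  obtain ⟨r, hr, hrp⟩ := ht
  refine Finset.eq_empty_of_forall_notMem fun σ hσ => hp ?_
  have h1 := (mem_avoiders.1 hσ).1 p (Finset.mem_insert_self _ _)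
  have h2 := (mem_avoiders.1 hσ).1 r (Finset.mem_insert_of_mem hr)
  have : r = p := by
    rcases hrp with h3 | h3
    · exact Prod.ext h3 (by rw [← h1, ← h2, h3])
    · exact Prod.ext (σ.injective (by rw [h1, h2, h3])) h3
  exact this ▸ hr

lemma card_avoiders_mul_descFactorial_le {h : Finset (α × α)} {𝒩 : Finset (Finset (α × α))}
    (hN : ∀ p ∈ h, ∀ g ∈ 𝒩, ¬ Touches g p) :
    (avoiders h 𝒩).card * (Fintype.card α).descFactorial h.card ≤ (avoiders ∅ 𝒩).card := by
  induction h using Finset.induction_on with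
  | empty => simp
  | insert p h hp ih =>
    by_cases ht : Touches h p
    · simp [avoiders_insert_eq_empty hp ht]
    · rw [Finset.card_insert_of_notMem hp, Nat.descFactorial_succ, ← mul_assoc]
      refine le_trans (Nat.mul_le_mul_right _ ?_)
        (ih fun r hr => hN r (Finset.mem_insert_of_mem hr))
      exact card_avoiders_insert_mul_le ht (hN p (Finset.mem_insert_self _ _))

/-- Union bound for the permutations lost when enlarging the set of forbidden patterns. -/
lemma card_avoiders_le_add_sum (𝒩 𝒩' : Finset (Finset (α × α))) :
    (avoiders ∅ 𝒩').card ≤ (avoiders ∅ (𝒩 ∪ 𝒩')).card + ∑ g ∈ 𝒩, (avoiders g 𝒩').card := by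
  refine le_trans ?_ (Nat.add_le_add_left Finset.card_biUnion_le _)
  refine le_trans (Finset.card_le_card ?_) (Finset.card_union_le _ _)
  intro σ hσ
  rw [mem_avoiders] at hσ
  rw [Finset.mem_union, Finset.mem_biUnion]
  by_cases h : ∃ g ∈ 𝒩, Extends σ g
  · obtain ⟨g, hg, hσg⟩ := h
    exact Or.inr ⟨g, hg, mem_avoiders.2 ⟨hσg, hσ.2⟩⟩
  · push Not at h
    refine Or.inl (mem_avoiders.2 ⟨hσ.1, fun g hg => ?_⟩)
    rcases Finset.mem_union.1 hg with hg | hg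
    · exact h g hg
    · exact hσ.2 g hg

lemma sum_biUnion_le_sum {ι β : Type*} [DecidableEq β] (s : Finset ι) (t : ι → Finset β)
    (f : β → ℝ) (hf : ∀ b, 0 ≤ f b) :
    ∑ b ∈ s.biUnion t, f b ≤ ∑ i ∈ s, ∑ b ∈ t i, f b := by
  classical
  induction s using Finset.induction_on with
  | empty => simp
  | insert i s hi ih =>
    rw [Finset.biUnion_insert, Finset.sum_insert hi]
    have h1 := Finset.sum_union_inter (s₁ := t i) (s₂ := s.biUnion t) (f := f)
    have h2 : 0 ≤ ∑ b ∈ t i ∩ s.biUnion t, f b := Finset.sum_nonneg fun b _ => hf b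
    linarith

open Classical in
/-- Local lemma bound for a pattern `g` with at most `M` positions. -/
lemma card_avoiders_mul_le {𝓑 : Finset (Finset (α × α))} {M : ℕ}
    (hM : ∀ g ∈ 𝓑, g.card ≤ M)
    (hsum : ∀ p, ∑ g ∈ 𝓑 with Touches g p,
      2 / ((Fintype.card α).descFactorial g.card : ℝ) ≤ 1 / (2 * M))
    (hpos : ∀ g ∈ 𝓑, 0 < (Fintype.card α).descFactorial g.card) :
    ∀ 𝒩 ⊆ 𝓑, ∀ g : Finset (α × α), g.card ≤ M →
      ((avoiders g 𝒩).card : ℝ) * (Fintype.card α).descFactorial g.card ≤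
        2 * (avoiders ∅ 𝒩).card := by
  intro 𝒩
  induction 𝒩 using Finset.strongInduction with
  | H 𝒩 ih =>
  intro hN g hg
  set 𝒩₁ := 𝒩.filter fun g' => ∃ p ∈ g, Touches g' p with h1
  set 𝒩₂ := 𝒩.filter fun g' => ¬ ∃ p ∈ g, Touches g' p with h2
  have hunion : 𝒩₁ ∪ 𝒩₂ = 𝒩 := Finset.filter_union_filter_not_eq _ _
  have h3 : ((avoiders g 𝒩).card : ℝ) * (Fintype.card α).descFactorial g.card ≤
      (avoiders ∅ 𝒩₂).card := by
    have h4 : (avoiders g 𝒩₂).card * (Fintype.card α).descFactorial g.card ≤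
        (avoiders ∅ 𝒩₂).card := by
      refine card_avoiders_mul_descFactorial_le fun p hp g' hg' ht => ?_
      exact (Finset.mem_filter.1 hg').2 ⟨p, hp, ht⟩
    have h5 := Finset.card_le_card (avoiders_anti g (Finset.filter_subset _ _ : 𝒩₂ ⊆ 𝒩))
    exact_mod_cast (Nat.mul_le_mul_right _ h5).trans h4
  refine h3.trans ?_
  rcases Finset.eq_empty_or_nonempty 𝒩₁ with he | ⟨g₀, hg₀⟩
  · have : 𝒩₂ = 𝒩 := by rw [← hunion, he, Finset.empty_union]
    rw [this]
    have : (0 : ℝ) ≤ (avoiders ∅ 𝒩).card := Nat.cast_nonneg _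
    linarith
  have hss : 𝒩₂ ⊂ 𝒩 := by
    refine Finset.ssubset_iff_subset_ne.2 ⟨Finset.filter_subset _ _, fun h => ?_⟩
    have h4 := (Finset.mem_filter.1 hg₀)
    rw [← h] at h4
    exact (Finset.mem_filter.1 h4.1).2 h4.2
  have h4 : ((avoiders ∅ 𝒩₂).card : ℝ) ≤ (avoiders ∅ 𝒩).card +
      ∑ g' ∈ 𝒩₁, ((avoiders g' 𝒩₂).card : ℝ) := by
    have := card_avoiders_le_add_sum 𝒩₁ 𝒩₂
    rw [hunion] at this
    exact_mod_cast this
  have hM0 : 0 < M := by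
    obtain ⟨p, hp, -⟩ := (Finset.mem_filter.1 hg₀).2
    exact (Finset.card_pos.2 ⟨p, hp⟩).trans_le hg
  have hM' : (0 : ℝ) < M := Nat.cast_pos.2 hM0
  have h5 : ∑ g' ∈ 𝒩₁, ((avoiders g' 𝒩₂).card : ℝ) ≤ (1 / 2) * (avoiders ∅ 𝒩₂).card := by
    calc _ ≤ ∑ g' ∈ 𝒩₁, (2 / ((Fintype.card α).descFactorial g'.card : ℝ)) *
          (avoiders ∅ 𝒩₂).card := by
          refine Finset.sum_le_sum fun g' hg' => ?_
          have hB : g' ∈ 𝓑 := hN (Finset.mem_filter.1 hg').1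
          have h6 := ih 𝒩₂ hss ((Finset.filter_subset _ _).trans hN) g' (hM g' hB)
          have h7 : (0 : ℝ) < (Fintype.card α).descFactorial g'.card := by exact_mod_cast hpos g' hB
          rw [div_mul_eq_mul_div, le_div_iff₀ h7]
          exact h6
      _ ≤ _ := by
          rw [← Finset.sum_mul]
          refine mul_le_mul_of_nonneg_right ?_ (Nat.cast_nonneg _)
          calc _ ≤ ∑ g' ∈ g.biUnion (fun p => 𝓑.filter fun g' => Touches g' p),
                2 / ((Fintype.card α).descFactorial g'.card : ℝ) := by
                refine Finset.sum_le_sum_of_subset_of_nonneg (fun g' hg' => ?_)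
                  fun _ _ _ => by positivity
                obtain ⟨h6, p, hp, h7⟩ := Finset.mem_filter.1 hg'
                exact Finset.mem_biUnion.2 ⟨p, hp, Finset.mem_filter.2 ⟨hN h6, h7⟩⟩
            _ ≤ ∑ p ∈ g, ∑ g' ∈ 𝓑 with Touches g' p,
                2 / ((Fintype.card α).descFactorial g'.card : ℝ) := by
                exact sum_biUnion_le_sum _ _ _ fun _ => by positivity
            _ ≤ ∑ p ∈ g, (1 / (2 * M) : ℝ) := Finset.sum_le_sum fun p _ => hsum p
            _ ≤ 1 / 2 := by
                rw [Finset.sum_const, nsmul_eq_mul, mul_one_div, div_le_iff₀ (by positivity)]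
                have : (g.card : ℝ) ≤ M := Nat.cast_le.2 hg
                linarith
  linarith

open Classical in
lemma card_avoiders_le_two_mul {𝓑 : Finset (Finset (α × α))} {M : ℕ}
    (hM1 : 1 ≤ M) (hM : ∀ g ∈ 𝓑, g.card ≤ M)
    (hpos : ∀ g ∈ 𝓑, 0 < (Fintype.card α).descFactorial g.card)
    (hsum : ∀ p, ∑ g ∈ 𝓑 with Touches g p,
      2 / ((Fintype.card α).descFactorial g.card : ℝ) ≤ 1 / (2 * M))
    {𝒩 : Finset (Finset (α × α))} (hN : 𝒩 ⊆ 𝓑) (p : α × α) :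
    (((avoiders ∅ (𝒩.filter fun g => ¬ Touches g p)).card : ℝ) ≤ 2 * (avoiders ∅ 𝒩).card) := by
  set 𝒩₁ := 𝒩.filter fun g => Touches g p
  set 𝒩₂ := 𝒩.filter fun g => ¬ Touches g p
  have hunion : 𝒩₁ ∪ 𝒩₂ = 𝒩 := Finset.filter_union_filter_not_eq _ _
  have h4 : ((avoiders ∅ 𝒩₂).card : ℝ) ≤ (avoiders ∅ 𝒩).card +
      ∑ g' ∈ 𝒩₁, ((avoiders g' 𝒩₂).card : ℝ) := by
    have := card_avoiders_le_add_sum 𝒩₁ 𝒩₂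
    rw [hunion] at this
    exact_mod_cast this
  have h5 : ∑ g' ∈ 𝒩₁, ((avoiders g' 𝒩₂).card : ℝ) ≤ (1 / 2) * (avoiders ∅ 𝒩₂).card := by
    calc _ ≤ ∑ g' ∈ 𝒩₁, (2 / ((Fintype.card α).descFactorial g'.card : ℝ)) *
          (avoiders ∅ 𝒩₂).card := by
          refine Finset.sum_le_sum fun g' hg' => ?_
          have hB : g' ∈ 𝓑 := hN (Finset.mem_filter.1 hg').1
          have h6 := card_avoiders_mul_le hM hsum hpos 𝒩₂ ((Finset.filter_subset _ _).trans hN)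
            g' (hM g' hB)
          have h7 : (0 : ℝ) < (Fintype.card α).descFactorial g'.card := by exact_mod_cast hpos g' hB
          rw [div_mul_eq_mul_div, le_div_iff₀ h7]
          exact h6
      _ ≤ _ := by
          rw [← Finset.sum_mul]
          refine mul_le_mul_of_nonneg_right ?_ (Nat.cast_nonneg _)
          refine le_trans ?_ ((hsum p).trans ?_)
          · exact Finset.sum_le_sum_of_subset_of_nonneg (Finset.filter_subset_filter _ hN)
              fun _ _ _ => by positivity
          · have : (1 : ℝ) ≤ M := by exact_mod_cast hM1
            exact one_div_le_one_div_of_le (by norm_num) (by linarith)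
  linarith

open Classical in
lemma card_avoiders_pos {𝓑 : Finset (Finset (α × α))} {M : ℕ}
    (hM1 : 1 ≤ M) (hM : ∀ g ∈ 𝓑, g.card ≤ M)
    (hpos : ∀ g ∈ 𝓑, 0 < (Fintype.card α).descFactorial g.card)
    (hsum : ∀ p, ∑ g ∈ 𝓑 with Touches g p,
      2 / ((Fintype.card α).descFactorial g.card : ℝ) ≤ 1 / (2 * M))
    (hne : ∀ g ∈ 𝓑, g.Nonempty) : 0 < (avoiders ∅ 𝓑).card := by
  suffices h : ∀ 𝒩 ⊆ 𝓑, 0 < (avoiders ∅ 𝒩).card from h 𝓑 (Finset.Subset.refl _)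
  intro 𝒩
  induction 𝒩 using Finset.strongInduction with
  | H 𝒩 ih =>
  intro hN
  rcases Finset.eq_empty_or_nonempty 𝒩 with rfl | ⟨g, hg⟩
  · exact Finset.card_pos.2 ⟨1, mem_avoiders.2 ⟨by simp [Extends], by simp⟩⟩
  · obtain ⟨p, hp⟩ := hne g (hN hg)
    have h1 := card_avoiders_le_two_mul hM1 hM hpos hsum hN p
    have h2 : 0 < (avoiders ∅ (𝒩.filter fun g => ¬ Touches g p)).card := by
      refine ih _ ?_ ((Finset.filter_subset _ _).trans hN)
      refine Finset.filter_ssubset.2 ⟨g, hg, not_not.2 ⟨p, hp, Or.inl rfl⟩⟩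
    have h3 : (0 : ℝ) < (avoiders ∅ (𝒩.filter fun g => ¬ Touches g p)).card := by exact_mod_cast h2
    have h4 : (0 : ℝ) < (avoiders ∅ 𝒩).card := by linarith
    exact_mod_cast h4

open Classical in
/-- The uniform distribution on permutations avoiding `𝓑` is spread. -/
lemma card_avoiders_mul_le_pow {𝓑 : Finset (Finset (α × α))} {M : ℕ}
    (hM1 : 1 ≤ M) (hM : ∀ g ∈ 𝓑, g.card ≤ M)
    (hpos : ∀ g ∈ 𝓑, 0 < (Fintype.card α).descFactorial g.card)
    (hsum : ∀ p, ∑ g ∈ 𝓑 with Touches g p,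
      2 / ((Fintype.card α).descFactorial g.card : ℝ) ≤ 1 / (2 * M)) (h : Finset (α × α)) :
    ((avoiders h 𝓑).card : ℝ) * (Fintype.card α).descFactorial h.card ≤
      2 ^ h.card * (avoiders ∅ 𝓑).card := by
  have key : ∀ h : Finset (α × α), ((avoiders ∅ (𝓑.filter fun g => ∀ p ∈ h, ¬ Touches g p)).card : ℝ)
      ≤ 2 ^ h.card * (avoiders ∅ 𝓑).card := by
    intro h
    induction h using Finset.induction_on with
    | empty => simp
    | insert p h hp ih =>
      have h1 : (𝓑.filter fun g => ∀ r ∈ insert p h, ¬ Touches g r) =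
          (𝓑.filter fun g => ∀ r ∈ h, ¬ Touches g r).filter fun g => ¬ Touches g p := by
        ext g
        simp only [Finset.mem_filter, Finset.forall_mem_insert]
        tauto
      rw [h1, Finset.card_insert_of_notMem hp, pow_succ]
      have := card_avoiders_le_two_mul hM1 hM hpos hsum (Finset.filter_subset
        (fun g => ∀ r ∈ h, ¬ Touches g r) 𝓑) p
      linarith
  refine le_trans ?_ (key h)
  have h4 : (avoiders h (𝓑.filter fun g => ∀ p ∈ h, ¬ Touches g p)).card *
      (Fintype.card α).descFactorial h.card ≤
      (avoiders ∅ (𝓑.filter fun g => ∀ p ∈ h, ¬ Touches g p)).card :=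
    card_avoiders_mul_descFactorial_le fun p hp g' hg' => (Finset.mem_filter.1 hg').2 p hp
  have h5 := Finset.card_le_card (avoiders_anti h
    (Finset.filter_subset (fun g => ∀ p ∈ h, ¬ Touches g p) 𝓑))
  exact_mod_cast (Nat.mul_le_mul_right _ h5).trans h4

lemma pow_le_three_pow_mul_descFactorial (n : ℕ) :
    ∀ s ≤ n, (n : ℝ) ^ s ≤ 3 ^ s * (n.descFactorial s : ℝ) := by
  induction n with
  | zero => intro s hs; simp [Nat.le_zero.1 hs]
  | succ n ih =>
    intro s hs
    cases s with
    | zero => simp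
    | succ s =>
      have hsn : s ≤ n := Nat.le_of_succ_le_succ hs
      rw [Nat.succ_descFactorial_succ]
      have h1 : ((n + 1 : ℕ) : ℝ) ^ s ≤ 3 * (n : ℝ) ^ s := by
        rcases Nat.eq_zero_or_pos n with rfl | hn
        · simp [Nat.le_zero.1 hsn]
        have hn' : (0 : ℝ) < n := Nat.cast_pos.2 hn
        have h2 : ((n + 1 : ℕ) : ℝ) = (1 + 1 / n) * n := by
          push_cast; field_simp
        rw [h2, mul_pow]
        refine mul_le_mul_of_nonneg_right ?_ (by positivity)
        have h3 : (1 + 1 / (n : ℝ)) ^ s ≤ Real.exp 1 := by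
          have h4 : (1 + 1 / (n : ℝ)) ≤ Real.exp (1 / n) := by
            rw [add_comm]; exact Real.add_one_le_exp _
          calc _ ≤ (Real.exp (1 / n)) ^ s := by gcongr
            _ = Real.exp (s * (1 / n)) := (Real.exp_nat_mul _ _).symm
            _ ≤ Real.exp 1 := by
              refine Real.exp_le_exp.2 ?_
              rw [mul_one_div, div_le_one hn']
              exact_mod_cast hsn
        exact h3.trans (by linarith [Real.exp_one_lt_d9])
      have h2 := ih s hsn
      push_cast at h1 ⊢
      calc ((n : ℝ) + 1) ^ (s + 1) = (n + 1) * (n + 1) ^ s := by ring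
        _ ≤ (n + 1) * (3 * (3 ^ s * n.descFactorial s)) := by
            gcongr
            linarith
        _ = _ := by ring
end

section
variable {ι V : Type*} [Fintype ι] [DecidableEq ι] [Fintype V] [DecidableEq V]

/-- Boxes contain the expected proportion of tuples spanning a member of `𝒢`; all boxes when
`NL` holds, otherwise only the full box. -/
def BoxDense (s : ℕ) (d ε : ℝ) (𝒢 : Finset (Finset V)) (NL : Prop) : Prop :=
  ∀ X : Fin s → Finset V, (NL ∨ ∀ i, X i = Finset.univ) →
    d * ∏ i, ((X i).card : ℝ) - ε * (Fintype.card V : ℝ) ^ s ≤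
      ((Finset.univ.filter fun x : Fin s → V =>
        (∀ i, x i ∈ X i) ∧ Finset.univ.image x ∈ 𝒢).card : ℝ)

lemma BoxDense.subtype {s : ℕ} {d ε : ℝ} {𝒢 : Finset (Finset V)} {NL : Prop}
    (h : BoxDense s d ε 𝒢 NL) {e : Finset ι} (he : e.card = s) (X : {i // i ∈ e} → Finset V)
    (hX : NL ∨ ∀ i, X i = Finset.univ) :
    d * ∏ i, ((X i).card : ℝ) - ε * (Fintype.card V : ℝ) ^ s ≤
      ((Finset.univ.filter fun x : {i // i ∈ e} → V =>
        (∀ i, x i ∈ X i) ∧ Finset.univ.image x ∈ 𝒢).card : ℝ) := by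
  let q : {i // i ∈ e} ≃ Fin s := e.equivFinOfCardEq he
  have h1 := h (fun j => X (q.symm j)) (hX.imp_right fun h j => h _)
  have h2 : ∏ j, ((X (q.symm j)).card : ℝ) = ∏ i, ((X i).card : ℝ) :=
    Fintype.prod_equiv q.symm _ _ fun _ => rfl
  rw [h2] at h1
  refine h1.trans (Nat.cast_le.2 ?_)
  refine Finset.card_le_card_of_injOn (fun x i => x (q i)) ?_ ?_
  · intro x hx
    simp only [Finset.coe_filter, Finset.mem_univ, true_and, Set.mem_ofPred_eq] at hx ⊢
    refine ⟨fun i => by simpa using hx.1 (q i), ?_⟩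
    convert hx.2 using 1
    ext v
    simp only [Finset.mem_image, Finset.mem_univ, true_and]
    exact ⟨fun ⟨i, hi⟩ => ⟨q i, hi⟩, fun ⟨j, hj⟩ => ⟨q.symm j, by simpa using hj⟩⟩
  · intro x _ y _ hxy
    ext j
    simpa using congrFun hxy (q.symm j)

/-- Maps under which no member of `J` is present. -/
def absentMaps (𝒢 : Finset (Finset V)) (J : Finset (Finset ι)) : Finset (ι → V) :=
  Finset.univ.filter fun w => ∀ e ∈ J, e.image w ∉ 𝒢

lemma card_absentMaps_insert_le {s : ℕ} {d ε : ℝ} {𝒢 : Finset (Finset V)} {NL : Prop}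
    (h : BoxDense s d ε 𝒢 NL) (hε : 0 ≤ ε) {e : Finset ι} (he : e.card = s)
    {J : Finset (Finset ι)} (hJ : ∀ e' ∈ J, (e ∩ e').card ≤ 1)
    (hNL : NL ∨ ∀ e' ∈ J, Disjoint e e') :
    ((absentMaps 𝒢 (insert e J)).card : ℝ) ≤
      (1 - d) * (absentMaps 𝒢 J).card + ε * (Fintype.card V : ℝ) ^ Fintype.card ι := by
  let E := Equiv.piEquivPiSubtypeProd (fun i => i ∈ e) (fun _ => V)
  have hsplit : ∀ J' : Finset (Finset ι), ((absentMaps 𝒢 J').card : ℝ) =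
      ∑ z : {i // i ∉ e} → V, ((Finset.univ.filter fun y : {i // i ∈ e} → V =>
        E.symm (y, z) ∈ absentMaps 𝒢 J').card : ℝ) := by
    intro J'
    have h1 : (absentMaps 𝒢 J').card =
        ∑ w : ι → V, if w ∈ absentMaps 𝒢 J' then 1 else 0 := by
      rw [← Finset.card_filter]; congr 1; ext; simp
    rw [h1, Fintype.sum_equiv E _ (fun yz => if E.symm yz ∈ absentMaps 𝒢 J' then 1 else 0)
      (fun w => by simp), Fintype.sum_prod_type_right]
    push_cast
    simp only [Finset.card_filter, Nat.cast_sum, Nat.cast_ite, Nat.cast_one, Nat.cast_zero]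
  have hin : ∀ y z i (hi : i ∈ e), E.symm (y, z) i = y ⟨i, hi⟩ := fun y z i hi => by
    simp [E, Equiv.piEquivPiSubtypeProd, hi]
  have hout : ∀ y z i (hi : i ∉ e), E.symm (y, z) i = z ⟨i, hi⟩ := fun y z i hi => by
    simp [E, Equiv.piEquivPiSubtypeProd, hi]
  have himg : ∀ y z, e.image (E.symm (y, z)) = Finset.univ.image y := by
    intro y z
    ext v
    simp only [Finset.mem_image, Finset.mem_univ, true_and, Subtype.exists]
    exact ⟨fun ⟨i, hi, hv⟩ => ⟨i, hi, by rw [← hv, hin y z i hi]⟩,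
      fun ⟨i, hi, hv⟩ => ⟨i, hi, by rw [← hv, hin y z i hi]⟩⟩
  have hz : ∀ z : {i // i ∉ e} → V,
      ((Finset.univ.filter fun y => E.symm (y, z) ∈ absentMaps 𝒢 (insert e J)).card : ℝ) ≤
      (1 - d) * (Finset.univ.filter fun y => E.symm (y, z) ∈ absentMaps 𝒢 J).card +
        ε * (Fintype.card V : ℝ) ^ s := by
    intro z
    set Y := Finset.univ.filter fun y => E.symm (y, z) ∈ absentMaps 𝒢 J with hY
    have h1 : (Finset.univ.filter fun y => E.symm (y, z) ∈ absentMaps 𝒢 (insert e J)) =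
        Y.filter fun y => ¬ Finset.univ.image y ∈ 𝒢 := by
      ext y
      simp only [hY, absentMaps, Finset.mem_filter, Finset.mem_univ, true_and,
        Finset.forall_mem_insert, himg]
      tauto
    have h2 := Finset.card_filter_add_card_filter_not (s := Y) (fun y => Finset.univ.image y ∈ 𝒢)
    have h2' : (((Y.filter fun y => Finset.univ.image y ∈ 𝒢).card : ℕ) : ℝ) +
      ((Y.filter fun y => ¬ Finset.univ.image y ∈ 𝒢).card : ℕ) = (Y.card : ℕ) := by exact_mod_cast h2
    rw [h1]
    suffices h3 : d * Y.card - ε * (Fintype.card V : ℝ) ^ s ≤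
        (Y.filter fun y => Finset.univ.image y ∈ 𝒢).card by linarith
    rcases Finset.eq_empty_or_nonempty Y with h4 | ⟨y₀, hy₀⟩
    · rw [h4]
      have : 0 ≤ ε * (Fintype.card V : ℝ) ^ s := by positivity
      rw [Finset.filter_empty, Finset.card_empty, Nat.cast_zero, mul_zero]
      linarith
    have hy₀' : ∀ e' ∈ J, e'.image (E.symm (y₀, z)) ∉ 𝒢 := by
      simpa [hY, absentMaps] using hy₀
    let X : {i // i ∈ e} → Finset V := fun i => Finset.univ.filter fun v =>
      ∀ e' ∈ J, i.1 ∈ e' → e'.image (Function.update (E.symm (y₀, z)) i.1 v) ∉ 𝒢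
    have hagree : ∀ y, ∀ e' ∈ J, ∀ i : {i // i ∈ e}, i.1 ∈ e' →
        e'.image (E.symm (y, z)) = e'.image (Function.update (E.symm (y₀, z)) i.1 (y i)) := by
      intro y e' he' i hi
      refine Finset.image_congr fun j hj => ?_
      by_cases hji : j = i.1
      · subst hji
        rw [Function.update_self, hin y z _ i.2]
      · rw [Function.update_of_ne hji]
        have hje : j ∉ e := fun hje => hji <| Finset.card_le_one.1 (hJ e' he') j
          (Finset.mem_inter.2 ⟨hje, hj⟩) i.1 (Finset.mem_inter.2 ⟨i.2, hi⟩)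
        rw [hout y z j hje, hout y₀ z j hje]
    have hYX : ∀ y, y ∈ Y ↔ ∀ i, y i ∈ X i := by
      intro y
      simp only [hY, absentMaps, X, Finset.mem_filter, Finset.mem_univ, true_and]
      constructor
      · intro h5 i e' he' hi
        rw [← hagree y e' he' i hi]
        exact h5 e' he'
      · intro h5 e' he'
        by_cases h6 : ∃ i : {i // i ∈ e}, i.1 ∈ e'
        · obtain ⟨i, hi⟩ := h6
          rw [hagree y e' he' i hi]
          exact h5 i e' he' hi
        · have : e'.image (E.symm (y, z)) = e'.image (E.symm (y₀, z)) := by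
            refine Finset.image_congr fun j hj => ?_
            have hje : j ∉ e := fun hje => h6 ⟨⟨j, hje⟩, hj⟩
            rw [hout y z j hje, hout y₀ z j hje]
          rw [this]
          exact hy₀' e' he'
    have hcard : (Y.card : ℝ) = ∏ i, ((X i).card : ℝ) := by
      have : Y = Fintype.piFinset X := by ext y; rw [hYX, Fintype.mem_piFinset]
      rw [this, Fintype.card_piFinset]; push_cast; rfl
    have h6 := h.subtype he X (hNL.imp_right fun hd i => by
      ext v
      simp only [X, Finset.mem_filter, Finset.mem_univ, true_and, iff_true]
      intro e' he' hi
      exact absurd hi (Finset.disjoint_left.1 (hd e' he') i.2))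
    rw [hcard]
    refine h6.trans (le_of_eq ?_)
    congr 2
    ext y
    rw [Finset.mem_filter, Finset.mem_filter, hYX]
    simp only [Finset.mem_univ, true_and]
  rw [hsplit, hsplit J, Finset.mul_sum]
  refine (Finset.sum_le_sum fun z _ => hz z).trans ?_
  rw [Finset.sum_add_distrib, Finset.sum_const, nsmul_eq_mul]
  refine add_le_add le_rfl (le_of_eq ?_)
  rw [Finset.card_univ, Fintype.card_fun, Fintype.card_subtype_compl, Fintype.card_coe, he]
  have : Fintype.card ι = (Fintype.card ι - s) + s := by
    have : s ≤ Fintype.card ι := he ▸ Finset.card_le_univ e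
    omega
  conv_rhs => rw [this, pow_add]
  push_cast; ring

/-- Sets of positions pairwise meeting in at most one point behave almost independently. -/
lemma card_absentMaps_le {s : ℕ} {d ε : ℝ} {𝒢 : Finset (Finset V)} {NL : Prop}
    (h : BoxDense s d ε 𝒢 NL) (hε : 0 ≤ ε) (hd : d ≤ 1) (hd0 : 0 ≤ d)
    {J : Finset (Finset ι)} (hs : ∀ e ∈ J, e.card = s)
    (hJ : ∀ e ∈ J, ∀ e' ∈ J, e ≠ e' → (e ∩ e').card ≤ 1)
    (hNL : NL ∨ ∀ e ∈ J, ∀ e' ∈ J, e ≠ e' → Disjoint e e') :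
    ((absentMaps 𝒢 J).card : ℝ) ≤
      ((1 - d) ^ J.card + J.card * ε) * (Fintype.card V : ℝ) ^ Fintype.card ι := by
  induction J using Finset.induction_on with
  | empty =>
    have : absentMaps 𝒢 (∅ : Finset (Finset ι)) = Finset.univ := by
      ext w; simp [absentMaps]
    simp [this]
  | insert e J he ih =>
    have hne : ∀ e' ∈ J, e ≠ e' := fun e' he' h1 => he (h1 ▸ he')
    have h1 := card_absentMaps_insert_le h hε (hs e (Finset.mem_insert_self _ _)) (J := J)
      (fun e' he' => hJ e (Finset.mem_insert_self _ _) e' (Finset.mem_insert_of_mem he')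
        (hne e' he'))
      (hNL.imp_right fun h2 e' he' => h2 e (Finset.mem_insert_self _ _) e'
        (Finset.mem_insert_of_mem he') (hne e' he'))
    have h2 := ih (fun e he => hs e (Finset.mem_insert_of_mem he))
      (fun e he e' he' => hJ e (Finset.mem_insert_of_mem he) e' (Finset.mem_insert_of_mem he'))
      (hNL.imp_right fun h2 e he e' he' =>
        h2 e (Finset.mem_insert_of_mem he) e' (Finset.mem_insert_of_mem he'))
    rw [Finset.card_insert_of_notMem he]
    have hd' : 0 ≤ 1 - d := by linarith
    refine h1.trans ?_
    have h3 := mul_le_mul_of_nonneg_left h2 hd'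
    have h4 : (0 : ℝ) ≤ d * (J.card * ε * (Fintype.card V : ℝ) ^ Fintype.card ι) := by positivity
    push_cast
    rw [pow_succ]
    linarith
end

section
variable {ι V : Type*} [Fintype ι] [DecidableEq ι] [Fintype V] [DecidableEq V]

/-- Total weight of the members of `M` present under `w`. -/
noncomputable def presentWeight (𝒢 : Finset (Finset V)) (M : Finset (Finset ι))
    (c : Finset ι → ℝ) (w : ι → V) : ℝ :=
  ∑ e ∈ M, if e.image w ∈ 𝒢 then c e else 0

lemma sum_prod_one_sub_le {s : ℕ} {d ε : ℝ} {𝒢 : Finset (Finset V)} {NL : Prop}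
    (h : BoxDense s d ε 𝒢 NL) (hε : 0 ≤ ε) (hd : d ≤ 1) (hd0 : 0 ≤ d)
    {M : Finset (Finset ι)} (hs : ∀ e ∈ M, e.card = s)
    (hM : ∀ e ∈ M, ∀ e' ∈ M, e ≠ e' → (e ∩ e').card ≤ 1)
    (hNL : NL ∨ ∀ e ∈ M, ∀ e' ∈ M, e ≠ e' → Disjoint e e')
    {c : Finset ι → ℝ} (hc0 : ∀ e, 0 ≤ c e) (hc1 : ∀ e, c e ≤ 1) :
    ∑ w : ι → V, ∏ e ∈ M, (1 - if e.image w ∈ 𝒢 then c e else 0) ≤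
      (∏ e ∈ M, (1 - c e * d) + M.card * ε) * (Fintype.card V : ℝ) ^ Fintype.card ι := by
  have h1 : ∀ w : ι → V, ∏ e ∈ M, (1 - if e.image w ∈ 𝒢 then c e else 0) =
      ∑ J ∈ M.powerset, ((∏ e ∈ J, c e) * ∏ e ∈ M \ J, (1 - c e)) *
        if w ∈ absentMaps 𝒢 J then 1 else 0 := by
    intro w
    have : ∀ e ∈ M, (1 - if e.image w ∈ 𝒢 then c e else 0) =
        c e * (if e.image w ∈ 𝒢 then 0 else 1) + (1 - c e) := fun e _ => by split_ifs <;> ring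
    rw [Finset.prod_congr rfl this, Finset.prod_add]
    refine Finset.sum_congr rfl fun J _ => ?_
    rw [Finset.prod_mul_distrib]
    have h2 : (∏ e ∈ J, if e.image w ∈ 𝒢 then (0 : ℝ) else 1) =
        if w ∈ absentMaps 𝒢 J then 1 else 0 := by
      simp only [absentMaps, Finset.mem_filter, Finset.mem_univ, true_and]
      split_ifs with h3
      · exact Finset.prod_eq_one fun e he => if_neg (h3 e he)
      · push Not at h3
        obtain ⟨e, he, h4⟩ := h3
        exact Finset.prod_eq_zero he (if_pos h4)
    rw [h2]; ring
  simp only [h1]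
  rw [Finset.sum_comm]
  set P := (Fintype.card V : ℝ) ^ Fintype.card ι with hP
  have hP0 : 0 ≤ P := by positivity
  have hw0 : ∀ J, 0 ≤ (∏ e ∈ J, c e) * ∏ e ∈ M \ J, (1 - c e) := fun J =>
    mul_nonneg (Finset.prod_nonneg fun e _ => hc0 e)
      (Finset.prod_nonneg fun e _ => sub_nonneg.2 (hc1 e))
  calc _ ≤ ∑ J ∈ M.powerset, ((∏ e ∈ J, c e) * ∏ e ∈ M \ J, (1 - c e)) *
        (((1 - d) ^ J.card + M.card * ε) * P) := by
        refine Finset.sum_le_sum fun J hJ => ?_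
        have hJM := Finset.mem_powerset.1 hJ
        rw [← Finset.mul_sum]
        refine mul_le_mul_of_nonneg_left ?_ (hw0 J)
        have h2 := card_absentMaps_le h hε hd hd0 (J := J) (fun e he => hs e (hJM he))
          (fun e he e' he' => hM e (hJM he) e' (hJM he'))
          (hNL.imp_right fun h2 e he e' he' => h2 e (hJM he) e' (hJM he'))
        have h3 : ∑ w : ι → V, (if w ∈ absentMaps 𝒢 J then (1 : ℝ) else 0) =
            (absentMaps 𝒢 J).card := by simp
        rw [h3]
        refine h2.trans ?_
        have : (J.card : ℝ) ≤ M.card := Nat.cast_le.2 (Finset.card_le_card hJM)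
        gcongr
    _ = _ := by
        have h2 : ∏ e ∈ M, (1 - c e * d) = ∑ J ∈ M.powerset,
            ((∏ e ∈ J, c e) * ∏ e ∈ M \ J, (1 - c e)) * (1 - d) ^ J.card := by
          have : ∀ e ∈ M, 1 - c e * d = c e * (1 - d) + (1 - c e) := fun e _ => by ring
          rw [Finset.prod_congr rfl this, Finset.prod_add]
          refine Finset.sum_congr rfl fun J _ => ?_
          rw [Finset.prod_mul_distrib, Finset.prod_const]; ring
        have h3 : (1 : ℝ) = ∑ J ∈ M.powerset, (∏ e ∈ J, c e) * ∏ e ∈ M \ J, (1 - c e) := by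
          rw [← Finset.prod_add]; simp
        have h4 : (M.card * ε : ℝ) = ∑ J ∈ M.powerset,
            ((∏ e ∈ J, c e) * ∏ e ∈ M \ J, (1 - c e)) * (M.card * ε) := by
          rw [← Finset.sum_mul, ← h3, one_mul]
        rw [h2, h4, ← Finset.sum_add_distrib, Finset.sum_mul]
        refine Finset.sum_congr rfl fun J _ => ?_
        rw [← h4]; ring

lemma exp_neg_sub_sq_le {y : ℝ} (h0 : 0 ≤ y) (h1 : y ≤ 1 / 2) :
    Real.exp (-y - y ^ 2) ≤ 1 - y := by
  have h2 : 0 < 1 - y := by linarith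
  have h3 : 1 / (1 - y) ≤ Real.exp (y + y ^ 2) := by
    have := Real.quadratic_le_exp_of_nonneg (x := y + y ^ 2) (by positivity)
    refine le_trans ?_ this
    rw [div_le_iff₀ h2]
    nlinarith [pow_nonneg h0 3, pow_nonneg h0 4, mul_nonneg (pow_nonneg h0 2) (sub_nonneg.2 h1), mul_nonneg (pow_nonneg h0 3) (sub_nonneg.2 h1), mul_nonneg (pow_nonneg h0 4) (sub_nonneg.2 h1)]
  have h4 : Real.exp (-y - y ^ 2) = (Real.exp (y + y ^ 2))⁻¹ := by
    rw [← Real.exp_neg]; ring_nf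
  rw [h4]
  rw [inv_le_comm₀ (Real.exp_pos _) h2]
  simpa using h3

open Classical in
/-- Lower tail bound for the weight of present sets within a near-independent class. -/
lemma card_light_le {s : ℕ} {d ε : ℝ} {𝒢 : Finset (Finset V)} {NL : Prop}
    (h : BoxDense s d ε 𝒢 NL) (hε : 0 ≤ ε) (hd : d ≤ 1) (hd0 : 0 ≤ d)
    {M : Finset (Finset ι)} (hs : ∀ e ∈ M, e.card = s)
    (hM : ∀ e ∈ M, ∀ e' ∈ M, e ≠ e' → (e ∩ e').card ≤ 1)
    (hNL : NL ∨ ∀ e ∈ M, ∀ e' ∈ M, e ≠ e' → Disjoint e e')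
    {c : Finset ι → ℝ} (hc0 : ∀ e, 0 ≤ c e) (hc1 : ∀ e, c e ≤ 1)
    {l : ℝ} (hl0 : 0 ≤ l) (hl : l ≤ 1 / 2) {a : ℝ} (ha : 0 ≤ a) :
    ((Finset.univ.filter fun w : ι → V =>
        presentWeight 𝒢 M c w ≤ d * ∑ e ∈ M, c e - a).card : ℝ) ≤
      (Real.exp (-(l * a) + l ^ 2 * M.card) + M.card * ε * Real.exp (2 * l * M.card)) *
        (Fintype.card V : ℝ) ^ Fintype.card ι := by
  set P := (Fintype.card V : ℝ) ^ Fintype.card ι with hP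
  have hP0 : 0 ≤ P := by positivity
  set B := Finset.univ.filter fun w : ι → V => presentWeight 𝒢 M c w ≤ d * ∑ e ∈ M, c e - a with hB
  set S := ∑ e ∈ M, c e with hS
  have hS0 : 0 ≤ S := Finset.sum_nonneg fun e _ => hc0 e
  have hSM : S ≤ M.card := by
    refine (Finset.sum_le_sum fun e _ => hc1 e).trans ?_
    simp
  have h1 := sum_prod_one_sub_le h hε hd hd0 hs hM hNL (c := fun e => l * c e)
    (fun e => mul_nonneg hl0 (hc0 e)) (fun e => by nlinarith [hc0 e, hc1 e])
  have hnn : ∀ w : ι → V, 0 ≤ ∏ e ∈ M, (1 - if e.image w ∈ 𝒢 then l * c e else 0) := fun w =>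
    Finset.prod_nonneg fun e _ => by
      split_ifs
      · nlinarith [hc0 e, hc1 e]
      · norm_num
  set t := Real.exp (-l * (d * S - a) - l ^ 2 * M.card) with ht
  have h2 : ∀ w ∈ B, t ≤ ∏ e ∈ M, (1 - if e.image w ∈ 𝒢 then l * c e else 0) := by
    intro w hw
    have hw' : presentWeight 𝒢 M c w ≤ d * S - a := (Finset.mem_filter.1 hw).2
    calc t ≤ Real.exp (∑ e ∈ M, (-(if e.image w ∈ 𝒢 then l * c e else 0) - l ^ 2)) := by
          refine Real.exp_le_exp.2 ?_
          rw [Finset.sum_sub_distrib, Finset.sum_const, nsmul_eq_mul, Finset.sum_neg_distrib]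
          have : ∑ e ∈ M, (if e.image w ∈ 𝒢 then l * c e else 0) = l * presentWeight 𝒢 M c w := by
            rw [presentWeight, Finset.mul_sum]
            exact Finset.sum_congr rfl fun e _ => by split_ifs <;> simp
          rw [this]
          nlinarith [mul_le_mul_of_nonneg_left hw' hl0]
      _ = ∏ e ∈ M, Real.exp (-(if e.image w ∈ 𝒢 then l * c e else 0) - l ^ 2) := Real.exp_sum _ _
      _ ≤ _ := by
          refine Finset.prod_le_prod (fun e _ => (Real.exp_pos _).le) fun e _ => ?_
          have hy0 : 0 ≤ l * c e := mul_nonneg hl0 (hc0 e)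
          have hy1 : l * c e ≤ l := by nlinarith [hc1 e]
          split_ifs
          · refine le_trans (Real.exp_le_exp.2 ?_) (exp_neg_sub_sq_le hy0 (hy1.trans hl))
            nlinarith
          · rw [sub_zero, Real.exp_le_one_iff]
            nlinarith [sq_nonneg l]
  have h3 : (B.card : ℝ) * t ≤ (∏ e ∈ M, (1 - l * c e * d) + M.card * ε) * P := by
    refine le_trans ?_ h1
    rw [← nsmul_eq_mul]
    refine (Finset.card_nsmul_le_sum B _ _ h2).trans ?_
    exact Finset.sum_le_sum_of_subset_of_nonneg (Finset.subset_univ _) fun w _ _ => hnn w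
  have h4 : ∏ e ∈ M, (1 - l * c e * d) ≤ Real.exp (-l * d * S) := by
    calc _ ≤ ∏ e ∈ M, Real.exp (-(l * c e * d)) := by
          refine Finset.prod_le_prod (fun e _ => ?_) fun e _ => ?_
          · have : l * c e ≤ 1 := by nlinarith [hc0 e, hc1 e]
            have : 0 ≤ l * c e := mul_nonneg hl0 (hc0 e)
            nlinarith
          · have := Real.add_one_le_exp (-(l * c e * d)); linarith
      _ = _ := by
          rw [← Real.exp_sum]
          congr 1
          rw [hS, Finset.mul_sum]
          exact Finset.sum_congr rfl fun e _ => by ring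
  have h5 : (B.card : ℝ) = (B.card : ℝ) * t * Real.exp (l * (d * S - a) + l ^ 2 * M.card) := by
    rw [mul_assoc, ht, ← Real.exp_add]
    ring_nf
    simp
  rw [h5]
  calc _ ≤ ((Real.exp (-l * d * S) + M.card * ε) * P) *
        Real.exp (l * (d * S - a) + l ^ 2 * M.card) :=
        mul_le_mul_of_nonneg_right (h3.trans (mul_le_mul_of_nonneg_right (by linarith) hP0))
          (Real.exp_pos _).le
    _ = (Real.exp (-(l * a) + l ^ 2 * M.card) +
          M.card * ε * Real.exp (l * (d * S - a) + l ^ 2 * M.card)) * P := by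
        have : Real.exp (-(l * a) + l ^ 2 * M.card) =
            Real.exp (-l * d * S) * Real.exp (l * (d * S - a) + l ^ 2 * M.card) := by
          rw [← Real.exp_add]; ring_nf
        rw [this]; ring
    _ ≤ _ := by
        refine mul_le_mul_of_nonneg_right ?_ hP0
        refine add_le_add le_rfl (mul_le_mul_of_nonneg_left (Real.exp_le_exp.2 ?_)
          (mul_nonneg (Nat.cast_nonneg _) hε))
        have h6 : d * S ≤ M.card := by nlinarith
        have h7 : l * (d * S - a) ≤ l * M.card := mul_le_mul_of_nonneg_left (by linarith) hl0
        have h8 : l * (l * M.card) ≤ 1 * (l * M.card) :=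
          mul_le_mul_of_nonneg_right (by linarith) (mul_nonneg hl0 (Nat.cast_nonneg _))
        nlinarith
end

section
variable {ι V : Type*} [Fintype ι] [DecidableEq ι] [Fintype V] [DecidableEq V]

lemma exists_greedy_coloring {β : Type*} (S : Finset β) {R : β → β → Prop} [DecidableRel R]
    (hR : ∀ a b, R a b → R b a) (D : ℕ)
    (h : ∀ a ∈ S, (S.filter fun b => R a b).card ≤ D) :
    ∃ col : β → Fin (D + 1), ∀ a ∈ S, ∀ b ∈ S, a ≠ b → R a b → col a ≠ col b := by
  classical
  suffices h' : ∀ T ⊆ S, ∃ col : β → Fin (D + 1),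
      ∀ a ∈ T, ∀ b ∈ T, a ≠ b → R a b → col a ≠ col b from h' S (Finset.Subset.refl _)
  intro T
  induction T using Finset.induction_on with
  | empty => exact fun _ => ⟨fun _ => 0, by simp⟩
  | insert a T ha ih =>
    intro hT
    obtain ⟨col, hcol⟩ := ih ((Finset.subset_insert _ _).trans hT)
    have h1 : (((S.filter fun b => R a b).image col)).card < Fintype.card (Fin (D + 1)) := by
      rw [Fintype.card_fin]
      exact Nat.lt_succ_of_le (Finset.card_image_le.trans (h a (hT (Finset.mem_insert_self _ _))))
    obtain ⟨x, hx⟩ : ∃ x, x ∉ (S.filter fun b => R a b).image col := by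
      by_contra h2
      push Not at h2
      rw [Finset.eq_univ_of_forall h2, Finset.card_univ] at h1
      exact lt_irrefl _ h1
    have hxb : ∀ b ∈ T, R a b → x ≠ col b := fun b hb hab h2 => hx <|
      Finset.mem_image.2 ⟨b, Finset.mem_filter.2 ⟨hT (Finset.mem_insert_of_mem hb), hab⟩, h2.symm⟩
    have hne : ∀ b ∈ T, b ≠ a := fun b hb h2 => ha (h2 ▸ hb)
    refine ⟨Function.update col a x, fun b hb c hc hbc hr => ?_⟩
    rcases Finset.mem_insert.1 hb with rfl | hb'
    · rcases Finset.mem_insert.1 hc with rfl | hc'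
      · exact absurd rfl hbc
      · rw [Function.update_self, Function.update_of_ne (hne c hc')]
        exact hxb c hc' hr
    · rw [Function.update_of_ne (hne b hb')]
      rcases Finset.mem_insert.1 hc with rfl | hc'
      · rw [Function.update_self]
        exact (hxb b hb' (hR _ _ hr)).symm
      · rw [Function.update_of_ne (hne c hc')]
        exact hcol b hb' c hc' hbc hr

lemma card_powersetCard_inter_le {s r : ℕ} {e : Finset ι} (he : e.card = s) :
    ((Finset.powersetCard s (Finset.univ : Finset ι)).filter fun e' => r ≤ (e ∩ e').card).card ≤
      2 ^ s * Fintype.card ι ^ (s - r) := by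
  have h1 : ((Finset.powersetCard s (Finset.univ : Finset ι)).filter
      fun e' => r ≤ (e ∩ e').card) ⊆
      (e.powersetCard r ×ˢ (Finset.powersetCard (s - r) (Finset.univ : Finset ι))).image
        fun AB => AB.1 ∪ AB.2 := by
    intro e' he'
    simp only [Finset.mem_filter, Finset.mem_powersetCard, Finset.subset_univ, true_and] at he'
    obtain ⟨A, hA, hAc⟩ := Finset.exists_subset_card_eq he'.2
    refine Finset.mem_image.2 ⟨(A, e' \ A), ?_, ?_⟩
    · simp only [Finset.mem_product, Finset.mem_powersetCard, Finset.subset_univ, true_and]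
      refine ⟨⟨hA.trans Finset.inter_subset_left, hAc⟩, ?_⟩
      rw [Finset.card_sdiff_of_subset (hA.trans Finset.inter_subset_right), he'.1, hAc]
    · exact Finset.union_sdiff_of_subset (hA.trans Finset.inter_subset_right)
  refine (Finset.card_le_card h1).trans (Finset.card_image_le.trans ?_)
  rw [Finset.card_product, Finset.card_powersetCard, Finset.card_powersetCard, he,
    Finset.card_univ]
  exact Nat.mul_le_mul (Nat.choose_le_two_pow _ _) (Nat.choose_le_pow _ _)

lemma card_le_pow_of_inter_lt {s r : ℕ} (hrs : r ≤ s) {M : Finset (Finset ι)}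
    (hs : ∀ e ∈ M, e.card = s)
    (hM : ∀ e ∈ M, ∀ e' ∈ M, e ≠ e' → (e ∩ e').card < r) :
    M.card ≤ Fintype.card ι ^ r := by
  have h : ∀ e, ∃ A : Finset ι, e ∈ M → A ⊆ e ∧ A.card = r := by
    intro e
    by_cases he : e ∈ M
    · obtain ⟨A, hA⟩ := Finset.exists_subset_card_eq (hrs.trans (hs e he).ge)
      exact ⟨A, fun _ => hA⟩
    · exact ⟨∅, fun h => absurd h he⟩
  choose A hA using h
  refine le_trans ?_ (Nat.choose_le_pow (Fintype.card ι) r)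
  rw [← Finset.card_univ, ← Finset.card_powersetCard]
  refine Finset.card_le_card_of_injOn A ?_ ?_
  · intro e he
    simpa using (hA e he).2
  · intro e he e' he' hee
    by_contra hne
    have h1 := hM e he e' he' hne
    have h2 : A e ⊆ e ∩ e' := Finset.subset_inter (hA e he).1 (hee ▸ (hA e' he').1)
    have h3 := Finset.card_le_card h2
    rw [(hA e he).2] at h3
    omega

/-- Lower tail bound for the total weight of present `s`-sets. -/
lemma card_light_total_le {s r : ℕ} {d ε γ : ℝ} {𝒢 : Finset (Finset V)} {NL : Prop}
    (h : BoxDense s d ε 𝒢 NL) (hε : 0 ≤ ε) (hd : d ≤ 1) (hd0 : 0 ≤ d)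
    (hr : r = 1 ∨ r = 2 ∧ NL) (hrs : r ≤ s) (hι : 0 < Fintype.card ι)
    {S : Finset (Finset ι)} (hs : ∀ e ∈ S, e.card = s)
    {c : Finset ι → ℝ} (hc0 : ∀ e, 0 ≤ c e) (hc1 : ∀ e, c e ≤ 1)
    (hγ0 : 0 ≤ γ) (hγ : γ ≤ 1) :
    ((Finset.univ.filter fun w : ι → V => presentWeight 𝒢 S c w <
        d * ∑ e ∈ S, c e - 2 ^ (s + 1) * γ * (Fintype.card ι : ℝ) ^ s).card : ℝ) ≤
      2 ^ (s + 1) * (Fintype.card ι : ℝ) ^ (s - r) *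
        ((Real.exp (-(γ ^ 2 * (Fintype.card ι : ℝ) ^ r / 4)) + (Fintype.card ι : ℝ) ^ r * ε *
          Real.exp (γ * (Fintype.card ι : ℝ) ^ r)) * (Fintype.card V : ℝ) ^ Fintype.card ι) := by
  set L := Fintype.card ι with hL
  set P := (Fintype.card V : ℝ) ^ L with hP
  set D := 2 ^ s * L ^ (s - r) with hD
  obtain ⟨col, hcol⟩ := exists_greedy_coloring S (R := fun e e' : Finset ι => r ≤ (e ∩ e').card)
    (fun a b hab => by rwa [Finset.inter_comm]) D (fun e he => by
      refine le_trans (Finset.card_le_card ?_) (card_powersetCard_inter_le (hs e he))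
      intro e' he'
      rw [Finset.mem_filter] at he' ⊢
      exact ⟨by simpa using hs e' he'.1, he'.2⟩)
  have hD1 : ((D + 1 : ℕ) : ℝ) ≤ 2 ^ (s + 1) * (L : ℝ) ^ (s - r) := by
    have h1 : 1 ≤ D := Nat.mul_pos (by positivity) (Nat.pow_pos hι)
    have h2 : D + 1 ≤ 2 ^ (s + 1) * L ^ (s - r) := by
      have h3 : 2 ^ (s + 1) * L ^ (s - r) = D + D := by rw [hD]; ring
      omega
    exact_mod_cast h2
  set M : Fin (D + 1) → Finset (Finset ι) := fun x => S.filter fun e => col e = x with hM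
  have hMi : ∀ x, ∀ e ∈ M x, ∀ e' ∈ M x, e ≠ e' → (e ∩ e').card < r := by
    intro x e he e' he' hne
    rw [hM, Finset.mem_filter] at he he'
    by_contra h1
    exact hcol e he.1 e' he'.1 hne (not_lt.1 h1) (he.2.trans he'.2.symm)
  have hMs : ∀ x, ∀ e ∈ M x, e.card = s := fun x e he => hs e (Finset.mem_filter.1 he).1
  have hr2 : r ≤ 2 := by omega
  have hMr : ∀ x, ((M x).card : ℝ) ≤ (L : ℝ) ^ r := fun x => by
    exact_mod_cast card_le_pow_of_inter_lt hrs (hMs x) (hMi x)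
  set a := γ * (L : ℝ) ^ r with ha
  have hLr : (0 : ℝ) ≤ (L : ℝ) ^ r := by positivity
  have ha0 : 0 ≤ a := mul_nonneg hγ0 hLr
  have hclass : ∀ x, ((Finset.univ.filter fun w : ι → V =>
      presentWeight 𝒢 (M x) c w ≤ d * ∑ e ∈ M x, c e - a).card : ℝ) ≤
      (Real.exp (-(γ ^ 2 * (L : ℝ) ^ r / 4)) + (L : ℝ) ^ r * ε * Real.exp a) * P := by
    intro x
    have h1 := card_light_le h hε hd hd0 (hMs x)
      (fun e he e' he' hne => by have := hMi x e he e' he' hne; omega)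
      (by
        rcases hr with h1 | h1
        · right
          intro e he e' he' hne
          have := hMi x e he e' he' hne
          rw [Finset.disjoint_iff_inter_eq_empty, ← Finset.card_eq_zero]
          omega
        · exact Or.inl h1.2) hc0 hc1 (l := γ / 2) (by linarith) (by linarith) ha0
    refine h1.trans (mul_le_mul_of_nonneg_right ?_ (by positivity))
    refine add_le_add (Real.exp_le_exp.2 ?_) ?_
    · have := mul_le_mul_of_nonneg_left (hMr x) (by positivity : 0 ≤ (γ / 2) ^ 2)
      rw [ha]
      linarith
    · have h2 : 2 * (γ / 2) * ((M x).card : ℝ) ≤ a := by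
        rw [ha]
        have := mul_le_mul_of_nonneg_left (hMr x) hγ0
        linarith
      refine mul_le_mul (mul_le_mul_of_nonneg_right (hMr x) hε) (Real.exp_le_exp.2 h2)
        (Real.exp_pos _).le (mul_nonneg hLr hε)
  have hsum : ∀ f : Finset ι → ℝ, ∑ e ∈ S, f e = ∑ x, ∑ e ∈ M x, f e := fun f =>
    (Finset.sum_fiberwise S col f).symm
  have hsub : (Finset.univ.filter fun w : ι → V => presentWeight 𝒢 S c w <
        d * ∑ e ∈ S, c e - 2 ^ (s + 1) * γ * (L : ℝ) ^ s) ⊆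
      Finset.univ.biUnion fun x => Finset.univ.filter fun w : ι → V =>
        presentWeight 𝒢 (M x) c w ≤ d * ∑ e ∈ M x, c e - a := by
    intro w hw
    rw [Finset.mem_filter] at hw
    by_contra h1
    simp only [Finset.mem_biUnion, Finset.mem_univ, true_and, Finset.mem_filter, not_exists,
      not_le] at h1
    have h2 := Finset.sum_le_sum fun x (_ : x ∈ Finset.univ) => (h1 x).le
    rw [Finset.sum_sub_distrib, ← Finset.mul_sum, ← hsum, Finset.sum_const, nsmul_eq_mul,
      Finset.card_univ, Fintype.card_fin] at h2
    have h3 : ∑ x, presentWeight 𝒢 (M x) c w = presentWeight 𝒢 S c w := by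
      simp only [presentWeight]
      exact (hsum _).symm
    rw [h3] at h2
    have h4 : ((D + 1 : ℕ) : ℝ) * a ≤ 2 ^ (s + 1) * γ * (L : ℝ) ^ s := by
      calc _ ≤ 2 ^ (s + 1) * (L : ℝ) ^ (s - r) * a := mul_le_mul_of_nonneg_right hD1 ha0
        _ = 2 ^ (s + 1) * γ * ((L : ℝ) ^ (s - r) * (L : ℝ) ^ r) := by rw [ha]; ring
        _ = _ := by rw [← pow_add, Nat.sub_add_cancel hrs]
    linarith [hw.2]
  calc _ ≤ ((∑ x : Fin (D + 1), (Finset.univ.filter fun w : ι → V =>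
        presentWeight 𝒢 (M x) c w ≤ d * ∑ e ∈ M x, c e - a).card : ℕ) : ℝ) :=
        Nat.cast_le.2 ((Finset.card_le_card hsub).trans Finset.card_biUnion_le)
    _ ≤ ∑ x : Fin (D + 1),
        (Real.exp (-(γ ^ 2 * (L : ℝ) ^ r / 4)) + (L : ℝ) ^ r * ε * Real.exp a) * P := by
        rw [Nat.cast_sum]
        exact Finset.sum_le_sum fun x _ => hclass x
    _ ≤ _ := by
        rw [Finset.sum_const, nsmul_eq_mul, Finset.card_univ, Fintype.card_fin]
        exact mul_le_mul_of_nonneg_right hD1 (by positivity)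
end

section
variable {k L n : ℕ}

/-- The `k`-graph on positions induced by `w`. -/
def pullback (k : ℕ) (G : Finset (Finset (Fin n))) (w : Fin L → Fin n) :
    Finset (Finset (Fin L)) :=
  (Finset.powersetCard k Finset.univ).filter fun e => e.image w ∈ G

lemma isHG_pullback (G : Finset (Finset (Fin n))) (w : Fin L → Fin n) :
    IsHG k L (pullback k G w) := fun e he => by
  simpa using (Finset.mem_filter.1 he).1

lemma UniformlyDense.boxDense {ε d : ℝ} {G : Finset (Finset (Fin n))}
    (h : UniformlyDense k n ε d G) : BoxDense k d ε G True := fun X _ => by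
  simpa [eCount] using h X

/-- Sets completing `u` to a member of `G`. -/
def link (G : Finset (Finset (Fin n))) (u : Fin n) : Finset (Finset (Fin n)) :=
  (G.filter fun e => u ∈ e).image fun e => e.erase u

lemma insert_mem_of_mem_link {G : Finset (Finset (Fin n))} {u : Fin n} {A : Finset (Fin n)}
    (h : A ∈ link G u) : insert u A ∈ G := by
  obtain ⟨e, he, rfl⟩ := Finset.mem_image.1 h
  rw [Finset.insert_erase (Finset.mem_filter.1 he).2]
  exact (Finset.mem_filter.1 he).1

lemma boxDense_link {G : Finset (Finset (Fin n))} (hG : IsHG k n G) {μ : ℝ}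
    (hdeg : MinDegGE G 1 (μ * (n : ℝ) ^ (k - 1))) (u : Fin n) :
    BoxDense (k - 1) μ 0 (link G u) False := by
  intro X hX
  have hX' : ∀ i, X i = Finset.univ := hX.resolve_left id
  have h1 := hdeg {u} (Finset.card_singleton u)
  simp only [hX', Finset.card_univ, Fintype.card_fin, Finset.prod_const, zero_mul, sub_zero,
    Finset.mem_univ, implies_true, true_and]
  refine h1.trans (Nat.cast_le.2 ?_)
  have h2 : (G.filter fun e => {u} ⊆ e).card = (link G u).card := by
    rw [link, Finset.card_image_of_injOn]
    · simp only [Finset.singleton_subset_iff]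
    · intro e he e' he' hee
      simp only [Finset.coe_filter, Set.mem_ofPred_eq] at he he'
      have hee' : e.erase u = e'.erase u := hee
      rw [← Finset.insert_erase he.2, hee', Finset.insert_erase he'.2]
  rw [h2]
  have h3 : ∀ A, ∃ x : Fin (k - 1) → Fin n, A ∈ link G u → Finset.univ.image x = A := by
    intro A
    by_cases hA : A ∈ link G u
    · have hc : A.card = k - 1 := by
        obtain ⟨e, he, rfl⟩ := Finset.mem_image.1 hA
        rw [Finset.card_erase_of_mem (Finset.mem_filter.1 he).2, hG e (Finset.mem_filter.1 he).1]
      exact ⟨A.orderEmbOfFin hc, fun _ => Finset.image_orderEmbOfFin_univ A hc⟩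
    · by_cases hn : Nonempty (Fin (k - 1) → Fin n)
      · exact ⟨Classical.choice hn, fun h => absurd h hA⟩
      · exact absurd ⟨fun _ => u⟩ hn
  choose x hx using h3
  refine Finset.card_le_card_of_injOn x ?_ ?_
  · intro A hA
    simp only [Finset.coe_filter, Finset.mem_univ, true_and, Set.mem_ofPred_eq]
    rw [hx A hA]; exact hA
  · intro A hA B hB hAB
    rw [← hx A hA, ← hx B hB, hAB]

lemma card_filter_determined_le {s L : ℕ} (a : Fin s) (T : Finset (Fin s → Fin L))
    (hT : ∀ f ∈ T, ∀ g ∈ T, (∀ j, j ≠ a → f j = g j) → f = g) : T.card ≤ L ^ (s - 1) := by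
  calc T.card ≤ (Finset.univ : Finset ({j : Fin s // j ≠ a} → Fin L)).card := by
        refine Finset.card_le_card_of_injOn (fun f j => f j.1) (fun _ _ => Finset.mem_univ _) ?_
        intro f hf g hg hfg
        exact hT f hf g hg fun j hj => congrFun hfg ⟨j, hj⟩
    _ = L ^ (s - 1) := by
        rw [Finset.card_univ, Fintype.card_fun, Fintype.card_fin]
        simp

/-- Most tuples are injective and avoid a given position. -/
lemma card_bad_tuples_le (k L : ℕ) (i₀ : Fin L) :
    (Finset.univ.filter fun f : Fin k → Fin L =>
      ¬ (Function.Injective f ∧ i₀ ∉ Finset.univ.image f)).card ≤ (k ^ 2 + k) * L ^ (k - 1) := by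
  have hsub : (Finset.univ.filter fun f : Fin k → Fin L =>
      ¬ (Function.Injective f ∧ i₀ ∉ Finset.univ.image f)) ⊆
      ((Finset.univ.filter fun ab : Fin k × Fin k => ab.1 ≠ ab.2).biUnion fun ab =>
        Finset.univ.filter fun f => f ab.1 = f ab.2) ∪
      (Finset.univ.biUnion fun a => Finset.univ.filter fun f : Fin k → Fin L => f a = i₀) := by
    intro f hf
    rw [Finset.mem_filter] at hf
    by_cases h1 : Function.Injective f
    · have h2 : i₀ ∈ Finset.univ.image f := by
        by_contra h3; exact hf.2 ⟨h1, h3⟩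
      obtain ⟨a, -, ha⟩ := Finset.mem_image.1 h2
      refine Finset.mem_union_right _ (Finset.mem_biUnion.2 ⟨a, Finset.mem_univ _, ?_⟩)
      simpa using ha
    · rw [Function.Injective] at h1
      push Not at h1
      obtain ⟨a, b, hab, hne⟩ := h1
      refine Finset.mem_union_left _ (Finset.mem_biUnion.2 ⟨(a, b), ?_, ?_⟩)
      · simpa using hne
      · simpa using hab
  refine (Finset.card_le_card hsub).trans ((Finset.card_union_le _ _).trans ?_)
  rw [add_mul]
  refine add_le_add ?_ ?_
  · refine (Finset.card_biUnion_le_card_mul _ _ (L ^ (k - 1)) ?_).trans ?_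
    · rintro ⟨a, b⟩ hab
      have hne : a ≠ b := (Finset.mem_filter.1 hab).2
      refine card_filter_determined_le a _ fun f hf g hg hfg => ?_
      ext j
      by_cases hj : j = a
      · subst hj
        rw [(Finset.mem_filter.1 hf).2, (Finset.mem_filter.1 hg).2, hfg b hne.symm]
      · rw [hfg j hj]
    · refine Nat.mul_le_mul_right _ ((Finset.card_filter_le _ _).trans ?_)
      simp [sq]
  · refine (Finset.card_biUnion_le_card_mul _ _ (L ^ (k - 1)) ?_).trans ?_
    · intro a _
      refine card_filter_determined_le a _ fun f hf g hg hfg => ?_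
      ext j
      by_cases hj : j = a
      · subst hj
        rw [(Finset.mem_filter.1 hf).2, (Finset.mem_filter.1 hg).2]
      · rw [hfg j hj]
    · simp

/-- Normalised number of tuples from the box `X` enumerating `e`. -/
noncomputable def boxWeight (X : Fin k → Finset (Fin L)) (e : Finset (Fin L)) : ℝ :=
  ((Finset.univ.filter fun f : Fin k → Fin L =>
    (∀ i, f i ∈ X i) ∧ Finset.univ.image f = e).card : ℝ) / (k : ℝ) ^ k

lemma boxWeight_nonneg (X : Fin k → Finset (Fin L)) (e : Finset (Fin L)) : 0 ≤ boxWeight X e := by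
  unfold boxWeight; positivity

lemma boxWeight_le_one (hk : 0 < k) (X : Fin k → Finset (Fin L)) (e : Finset (Fin L)) :
    boxWeight X e ≤ 1 := by
  have hk' : (0 : ℝ) < (k : ℝ) ^ k := by positivity
  rw [boxWeight, div_le_one hk']
  set T := Finset.univ.filter fun f : Fin k → Fin L =>
    (∀ i, f i ∈ X i) ∧ Finset.univ.image f = e
  rcases Finset.eq_empty_or_nonempty T with h | ⟨f, hf⟩
  · rw [h]; simp [hk'.le]
  · have he : e.card ≤ k := by
      rw [← (Finset.mem_filter.1 hf).2.2]
      exact Finset.card_image_le.trans (by simp)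
    have h1 : T ⊆ Fintype.piFinset fun _ : Fin k => e := by
      intro g hg
      rw [Fintype.mem_piFinset]
      intro i
      rw [← (Finset.mem_filter.1 hg).2.2]
      exact Finset.mem_image_of_mem _ (Finset.mem_univ _)
    have h2 := Finset.card_le_card h1
    rw [Fintype.card_piFinset] at h2
    simp only [Finset.prod_const, Finset.card_univ, Fintype.card_fin] at h2
    exact_mod_cast h2.trans (Nat.pow_le_pow_left he k)

lemma sum_boxWeight_ge (hk : 0 < k) (X : Fin k → Finset (Fin L)) (i₀ : Fin L) :
    ∏ i, ((X i).card : ℝ) - ((k : ℝ) ^ 2 + k) * (L : ℝ) ^ (k - 1) ≤ (k : ℝ) ^ k *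
      ∑ e ∈ (Finset.powersetCard k Finset.univ).filter (fun e => i₀ ∉ e), boxWeight X e := by
  have hk' : (0 : ℝ) < (k : ℝ) ^ k := by positivity
  have h1 : (k : ℝ) ^ k *
      ∑ e ∈ (Finset.powersetCard k Finset.univ).filter (fun e => i₀ ∉ e), boxWeight X e =
      ((Finset.univ.filter fun f : Fin k → Fin L => (∀ i, f i ∈ X i) ∧
        (Function.Injective f ∧ i₀ ∉ Finset.univ.image f)).card : ℝ) := by
    rw [Finset.mul_sum]
    simp only [boxWeight]
    rw [Finset.sum_congr rfl fun e _ => mul_div_cancel₀ _ hk'.ne', ← Nat.cast_sum,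
      Finset.card_eq_sum_card_fiberwise (f := fun f : Fin k → Fin L => Finset.univ.image f)
        (t := (Finset.powersetCard k Finset.univ).filter (fun e => i₀ ∉ e))]
    · refine congrArg _ (Finset.sum_congr rfl fun e he => ?_)
      congr 1
      ext f
      simp only [Finset.mem_filter, Finset.mem_univ, true_and, Finset.mem_powersetCard,
        Finset.subset_univ] at he ⊢
      constructor
      · rintro ⟨h1, rfl⟩
        refine ⟨⟨h1, ?_, he.2⟩, rfl⟩
        have := he.1
        have hinj : Set.InjOn f ((Finset.univ : Finset (Fin k)) : Set (Fin k)) :=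
          Finset.card_image_iff.1 (by simpa using this)
        exact fun a b hab => hinj (by simp) (by simp) hab
      · rintro ⟨⟨h1, -⟩, h2⟩
        exact ⟨h1, h2⟩
    · intro f hf
      simp only [Finset.coe_filter, Finset.mem_univ, true_and, Set.mem_ofPred_eq,
        Finset.mem_powersetCard, Finset.subset_univ] at hf ⊢
      refine ⟨?_, hf.2.2⟩
      rw [Finset.card_image_of_injective _ hf.2.1]; simp
  rw [h1, sub_le_iff_le_add]
  have h2 : (∏ i, (X i).card) ≤ (Finset.univ.filter fun f : Fin k → Fin L => (∀ i, f i ∈ X i) ∧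
        (Function.Injective f ∧ i₀ ∉ Finset.univ.image f)).card +
      (Finset.univ.filter fun f : Fin k → Fin L =>
        ¬ (Function.Injective f ∧ i₀ ∉ Finset.univ.image f)).card := by
    rw [← Fintype.card_piFinset]
    refine le_trans (Finset.card_le_card fun f hf => ?_) (Finset.card_union_le _ _)
    rw [Fintype.mem_piFinset] at hf
    simp only [Finset.mem_union, Finset.mem_filter, Finset.mem_univ, true_and]
    tauto
  have h3 := h2.trans (Nat.add_le_add_left (card_bad_tuples_le k L i₀) _)
  exact_mod_cast h3

lemma presentWeight_boxWeight_le (hk : 0 < k) (G : Finset (Finset (Fin n)))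
    (X : Fin k → Finset (Fin L)) (i₀ : Fin L) (w : Fin L → Fin n) :
    (k : ℝ) ^ k * presentWeight G ((Finset.powersetCard k Finset.univ).filter (fun e => i₀ ∉ e))
      (boxWeight X) w ≤ eCount k L (pullback k G w) X := by
  have hk' : (0 : ℝ) < (k : ℝ) ^ k := by positivity
  rw [presentWeight, ← Finset.sum_filter, Finset.mul_sum]
  simp only [boxWeight]
  rw [Finset.sum_congr rfl fun e _ => mul_div_cancel₀ _ hk'.ne', ← Nat.cast_sum, eCount]
  refine Nat.cast_le.2 ?_
  rw [← Finset.card_biUnion]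
  · refine Finset.card_le_card fun f hf => ?_
    simp only [Finset.mem_biUnion, Finset.mem_filter, Finset.mem_univ, true_and] at hf ⊢
    obtain ⟨e, he, h1, rfl⟩ := hf
    exact ⟨h1, Finset.mem_filter.2 ⟨he.1.1, he.2⟩⟩
  · intro e _ e' _ hne
    refine Finset.disjoint_left.2 fun f hf hf' => hne ?_
    rw [← (Finset.mem_filter.1 hf).2.2, ← (Finset.mem_filter.1 hf').2.2]
end

section
variable {k L n : ℕ}

lemma card_fiber_mul_le {ι V : Type*} [Fintype ι] [DecidableEq ι] [Fintype V] [DecidableEq V]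
    (i₀ : ι) (v : V) (P : (ι → V) → Prop) [DecidablePred P]
    (hP : ∀ w x, P w → P (Function.update w i₀ x)) :
    (Finset.univ.filter fun w => w i₀ = v ∧ P w).card * Fintype.card V ≤
      (Finset.univ.filter P).card := by
  rw [← Finset.card_univ, ← Finset.card_product]
  refine Finset.card_le_card_of_injOn (fun a => Function.update a.1 i₀ a.2) ?_ ?_
  · rintro ⟨w, x⟩ h
    simp only [Finset.coe_product, Finset.coe_filter, Finset.mem_univ, true_and, Set.mem_prod,
      Set.mem_ofPred_eq] at h ⊢
    exact hP w x h.1.2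
  · rintro ⟨w, x⟩ h ⟨w', x'⟩ h' hw
    simp only [Finset.coe_product, Finset.coe_filter, Finset.mem_univ, true_and, Set.mem_prod,
      Set.mem_ofPred_eq] at h h' hw
    have hx : x = x' := by simpa using congrFun hw i₀
    have hww : w = w' := by
      ext j
      by_cases hj : j = i₀
      · rw [hj, h.1.1, h'.1.1]
      · simpa [hj] using congrFun hw j
    rw [hx, hww]

lemma presentWeight_update {ι V : Type*} [Fintype ι] [DecidableEq ι] [Fintype V] [DecidableEq V]
    {𝒢 : Finset (Finset V)} {S : Finset (Finset ι)} {c : Finset ι → ℝ} {i₀ : ι}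
    (hS : ∀ e ∈ S, i₀ ∉ e) (w : ι → V) (x : V) :
    presentWeight 𝒢 S c (Function.update w i₀ x) = presentWeight 𝒢 S c w := by
  refine Finset.sum_congr rfl fun e he => ?_
  have : e.image (Function.update w i₀ x) = e.image w := by
    refine Finset.image_congr fun j hj => ?_
    exact Function.update_of_ne (fun h : j = i₀ => hS e he (by rw [← h]; exact hj)) _ _
  rw [this]

lemma presentWeight_link_le (hk : 0 < k) (G : Finset (Finset (Fin n))) (i i₀ : Fin L)
    (w : Fin L → Fin n) :
    presentWeight (link G (w i)) (Finset.powersetCard (k - 1) (Finset.univ \ {i, i₀}))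
      (fun _ => 1) w ≤ (((pullback k G w).filter fun e => {i} ⊆ e).card : ℝ) := by
  rw [presentWeight, Finset.sum_boole]
  refine Nat.cast_le.2 (Finset.card_le_card_of_injOn (fun A => insert i A) ?_ ?_)
  · intro A hA
    simp only [Finset.coe_filter, Set.mem_ofPred_eq, Finset.mem_powersetCard] at hA
    have hi : i ∉ A := fun h => by simpa using hA.1.1 h
    simp only [Finset.coe_filter, Set.mem_ofPred_eq, pullback, Finset.mem_filter,
      Finset.mem_powersetCard, Finset.subset_univ, true_and, Finset.singleton_subset_iff,
      Finset.mem_insert_self, and_true, Finset.card_insert_of_notMem hi, hA.1.2]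
    refine ⟨by omega, ?_⟩
    rw [Finset.image_insert]
    exact insert_mem_of_mem_link hA.2
  · intro A hA B hB hAB
    simp only [Finset.coe_filter, Set.mem_ofPred_eq, Finset.mem_powersetCard] at hA hB
    have hiA : i ∉ A := fun h => by simpa using hA.1.1 h
    have hiB : i ∉ B := fun h => by simpa using hB.1.1 h
    rw [← Finset.erase_insert hiA, ← Finset.erase_insert hiB]
    exact congrArg (fun s => Finset.erase s i) hAB

open Classical in
/-- Few tuples with a prescribed entry induce a `k`-graph violating a property that is forced by
uniform density and minimum degree. -/
lemma card_bad_le (hk : 2 ≤ k) {G : Finset (Finset (Fin n))} (hG : IsHG k n G)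
    {ε d μ ε' μ' γ : ℝ} (hU : UniformlyDense k n ε d G)
    (hdeg : MinDegGE G 1 (μ * (n : ℝ) ^ (k - 1))) (hε : 0 ≤ ε) (hd0 : 0 ≤ d) (hd1 : d ≤ 1)
    (hμ0 : 0 ≤ μ) (hμ1 : μ ≤ 1) (hγ0 : 0 ≤ γ) (hγ1 : γ ≤ 1) {Q : Finset (Finset (Fin L)) → Prop}
    (hQ : ∀ H, IsHG k L H → UniformlyDense k L ε' d H →
      MinDegGE H 1 (μ' * (((L - 1).choose (k - 1) : ℕ) : ℝ)) → Q H)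
    (hL1 : (k : ℝ) ^ 2 + k + (k : ℝ) ^ k * 2 ^ (k + 1) * γ * L ≤ ε' * L)
    (hL2 : μ' * (((L - 1).choose (k - 1) : ℕ) : ℝ) + 2 ^ k * γ * (L : ℝ) ^ (k - 1) ≤
      μ * (((L - 2).choose (k - 1) : ℕ) : ℝ)) (i₀ : Fin L) (v : Fin n) :
    ((Finset.univ.filter fun w : Fin L → Fin n => w i₀ = v ∧ ¬ Q (pullback k G w)).card : ℝ) * n ≤
      (n : ℝ) ^ L * (2 ^ (k * L) * (2 ^ (k + 1) * (L : ℝ) ^ (k - 2) *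
        (Real.exp (-(γ ^ 2 * (L : ℝ) ^ 2 / 4)) + (L : ℝ) ^ 2 * ε * Real.exp (γ * (L : ℝ) ^ 2))) +
        L * (2 ^ k * (L : ℝ) ^ (k - 2) * Real.exp (-(γ ^ 2 * L / 4)))) := by
  have hk0 : 0 < k := by omega
  have hLpos : 0 < L := i₀.pos
  have hkk : (0 : ℝ) ≤ (k : ℝ) ^ k := by positivity
  set S := (Finset.powersetCard k (Finset.univ : Finset (Fin L))).filter (fun e => i₀ ∉ e) with hS
  set S' := fun i : Fin L => Finset.powersetCard (k - 1) (Finset.univ \ {i, i₀}) with hS'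
  set P₁ : (Fin k → Finset (Fin L)) → (Fin L → Fin n) → Prop := fun X w =>
    presentWeight G S (boxWeight X) w <
      d * ∑ e ∈ S, boxWeight X e - 2 ^ (k + 1) * γ * (L : ℝ) ^ k with hP₁
  set P₂ : Fin n → Fin L → (Fin L → Fin n) → Prop := fun u i w =>
    presentWeight (link G u) (S' i) (fun _ => 1) w <
      μ * ∑ e ∈ S' i, (1 : ℝ) - 2 ^ k * γ * (L : ℝ) ^ (k - 1) with hP₂
  set δ₁ : ℝ := 2 ^ (k + 1) * (L : ℝ) ^ (k - 2) *
        (Real.exp (-(γ ^ 2 * (L : ℝ) ^ 2 / 4)) + (L : ℝ) ^ 2 * ε * Real.exp (γ * (L : ℝ) ^ 2))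
    with hδ₁
  set δ₂ : ℝ := 2 ^ k * (L : ℝ) ^ (k - 2) * Real.exp (-(γ ^ 2 * L / 4)) with hδ₂
  -- a tuple avoiding all the events is good
  have good : ∀ w : Fin L → Fin n, (∀ X, ¬ P₁ X w) → (∀ i, ¬ P₂ (w i) i w) →
      Q (pullback k G w) := by
    intro w h1 h2
    refine hQ _ (isHG_pullback G w) ?_ ?_
    · intro X
      have h3 := not_lt.1 (h1 X)
      have h4 := presentWeight_boxWeight_le hk0 G X i₀ w
      have h5 := sum_boxWeight_ge hk0 X i₀
      have h6 : (L : ℝ) ^ k = L ^ (k - 1) * L := by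
        rw [← pow_succ]; congr 1; omega
      have h7 := mul_le_mul_of_nonneg_left h3 hkk
      have h8 := mul_le_mul_of_nonneg_left h5 hd0
      have h9 := mul_le_mul_of_nonneg_left hL1 (by positivity : (0 : ℝ) ≤ (L : ℝ) ^ (k - 1))
      have h10 : d * (((k : ℝ) ^ 2 + k) * (L : ℝ) ^ (k - 1)) ≤
          ((k : ℝ) ^ 2 + k) * (L : ℝ) ^ (k - 1) :=
        mul_le_of_le_one_left (by positivity) hd1
      rw [h6] at h7 ⊢
      refine le_trans ?_ (h7.trans h4)
      nlinarith
    · intro T hT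
      obtain ⟨i, rfl⟩ := Finset.card_eq_one.1 hT
      have h3 := not_lt.1 (h2 i)
      refine le_trans ?_ (h3.trans (presentWeight_link_le hk0 G i i₀ w))
      have h4 : (((L - 2).choose (k - 1) : ℕ) : ℝ) ≤ ∑ e ∈ S' i, (1 : ℝ) := by
        rw [Finset.sum_const, nsmul_eq_mul, mul_one, hS', Finset.card_powersetCard]
        refine Nat.cast_le.2 (Nat.choose_le_choose _ ?_)
        rw [Finset.card_sdiff_of_subset (Finset.subset_univ _)]
        simp only [Finset.card_univ, Fintype.card_fin]
        have := Finset.card_le_two (a := i) (b := i₀)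
        omega
      have h5 := mul_le_mul_of_nonneg_left h4 hμ0
      linarith
  have b1 : ∀ X, ((Finset.univ.filter fun w : Fin L → Fin n => w i₀ = v ∧ P₁ X w).card : ℝ) * n ≤
      (n : ℝ) ^ L * δ₁ := by
    intro X
    have h1 := card_fiber_mul_le i₀ v (P₁ X) (fun w x h => by
      simp only [hP₁] at h ⊢
      rwa [presentWeight_update (fun e he => (Finset.mem_filter.1 he).2)])
    have h2 := card_light_total_le (ι := Fin L) hU.boxDense hε hd1 hd0 (r := 2)
      (Or.inr ⟨rfl, trivial⟩) hk (by simpa using hLpos) (S := S)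
      (fun e he => (Finset.mem_powersetCard.1 (Finset.mem_filter.1 he).1).2)
      (boxWeight_nonneg X) (boxWeight_le_one hk0 X) hγ0 hγ1
    simp only [Fintype.card_fin] at h1 h2
    have h3 : ((Finset.univ.filter fun w : Fin L → Fin n => w i₀ = v ∧ P₁ X w).card : ℝ) * n ≤
        ((Finset.univ.filter (P₁ X)).card : ℝ) := by exact_mod_cast h1
    refine h3.trans (h2.trans (le_of_eq ?_))
    rw [hδ₁]; ring
  have b2' : ∀ u v i j, j = i ∨ j = i₀ →
      ((Finset.univ.filter fun w : Fin L → Fin n => w j = v ∧ P₂ u i w).card : ℝ) * n ≤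
      (n : ℝ) ^ L * δ₂ := by
    intro u v i j hj
    have h1 := card_fiber_mul_le j v (P₂ u i) (fun w x h => by
      simp only [hP₂] at h ⊢
      rwa [presentWeight_update (fun e he hj' => by
        have := (Finset.mem_powersetCard.1 he).1 hj'
        simp at this; tauto)])
    have h2 := card_light_total_le (ι := Fin L) (boxDense_link hG hdeg u) le_rfl hμ1 hμ0 (r := 1)
      (Or.inl rfl) (by omega) (by simpa using hLpos) (S := S' i)
      (fun e he => (Finset.mem_powersetCard.1 he).2)
      (c := fun _ => 1) (fun _ => zero_le_one) (fun _ => le_rfl) hγ0 hγ1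
    have hk1 : k - 1 + 1 = k := by omega
    have hk2 : k - 1 - 1 = k - 2 := by omega
    simp only [Fintype.card_fin, hk1, hk2] at h1 h2
    have h3 : ((Finset.univ.filter fun w : Fin L → Fin n => w j = v ∧ P₂ u i w).card : ℝ) * n ≤
        ((Finset.univ.filter (P₂ u i)).card : ℝ) := by exact_mod_cast h1
    refine h3.trans (h2.trans (le_of_eq ?_))
    rw [hδ₂]; ring_nf
  have hn : (0 : ℝ) < n := Nat.cast_pos.2 v.pos
  have b2 : ∀ i, ((Finset.univ.filter fun w : Fin L → Fin n =>
      w i₀ = v ∧ P₂ (w i) i w).card : ℝ) * n ≤ (n : ℝ) ^ L * δ₂ := by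
    intro i
    by_cases hi : i = i₀
    · subst hi
      have : (Finset.univ.filter fun w : Fin L → Fin n => w i = v ∧ P₂ (w i) i w) =
          Finset.univ.filter fun w : Fin L → Fin n => w i = v ∧ P₂ v i w := by
        refine Finset.filter_congr fun w _ => ?_
        constructor
        · rintro ⟨h1, h2⟩; exact ⟨h1, h1 ▸ h2⟩
        · rintro ⟨h1, h2⟩; exact ⟨h1, by rw [h1]; exact h2⟩
      rw [this]
      exact b2' v v i i (Or.inl rfl)
    · have h1 := card_fiber_mul_le i₀ v (fun w => P₂ (w i) i w) (fun w x h => by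
        simp only [hP₂] at h ⊢
        rw [Function.update_of_ne hi]
        rwa [presentWeight_update (fun e he hj' => by
          have := (Finset.mem_powersetCard.1 he).1 hj'
          simp at this)])
      simp only [Fintype.card_fin] at h1
      have h2 : ((Finset.univ.filter fun w : Fin L → Fin n => w i₀ = v ∧ P₂ (w i) i w).card : ℝ) * n
        ≤ ((Finset.univ.filter fun w : Fin L → Fin n => P₂ (w i) i w).card : ℝ) := by
        exact_mod_cast h1
      refine h2.trans ?_
      have h3 : (Finset.univ.filter fun w : Fin L → Fin n => P₂ (w i) i w).card ≤
          ∑ u : Fin n, (Finset.univ.filter fun w : Fin L → Fin n => w i = u ∧ P₂ u i w).card := by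
        refine le_trans (Finset.card_le_card fun w hw => ?_) Finset.card_biUnion_le
        exact Finset.mem_biUnion.2 ⟨w i, Finset.mem_univ _,
          Finset.mem_filter.2 ⟨Finset.mem_univ _, rfl, (Finset.mem_filter.1 hw).2⟩⟩
      have h4 : ∀ u : Fin n,
          ((Finset.univ.filter fun w : Fin L → Fin n => w i = u ∧ P₂ u i w).card : ℝ) ≤
          (n : ℝ) ^ L * δ₂ / n := fun u => by
        rw [le_div_iff₀ hn]; exact b2' u u i i (Or.inl rfl)
      refine (Nat.cast_le.2 h3).trans ?_
      rw [Nat.cast_sum]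
      refine (Finset.sum_le_sum fun u _ => h4 u).trans (le_of_eq ?_)
      rw [Finset.sum_const, Finset.card_univ, Fintype.card_fin, nsmul_eq_mul,
        mul_div_cancel₀ _ hn.ne']
  have hcov : (Finset.univ.filter fun w : Fin L → Fin n => w i₀ = v ∧ ¬ Q (pullback k G w)).card ≤
      ∑ X, (Finset.univ.filter fun w : Fin L → Fin n => w i₀ = v ∧ P₁ X w).card +
      ∑ i, (Finset.univ.filter fun w : Fin L → Fin n => w i₀ = v ∧ P₂ (w i) i w).card := by
    refine le_trans (Finset.card_le_card ?_) ((Finset.card_union_le _ _).trans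
      (add_le_add Finset.card_biUnion_le Finset.card_biUnion_le))
    intro w hw
    rw [Finset.mem_filter] at hw
    by_cases h1 : ∀ X, ¬ P₁ X w
    · by_cases h2 : ∀ i, ¬ P₂ (w i) i w
      · exact absurd (good w h1 h2) hw.2.2
      · push Not at h2
        obtain ⟨i, hi⟩ := h2
        exact Finset.mem_union_right _ (Finset.mem_biUnion.2 ⟨i, Finset.mem_univ _,
          Finset.mem_filter.2 ⟨Finset.mem_univ _, hw.2.1, hi⟩⟩)
    · push Not at h1
      obtain ⟨X, hX⟩ := h1
      exact Finset.mem_union_left _ (Finset.mem_biUnion.2 ⟨X, Finset.mem_univ _,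
          Finset.mem_filter.2 ⟨Finset.mem_univ _, hw.2.1, hX⟩⟩)
  have hcov' := mul_le_mul_of_nonneg_right ((Nat.cast_le (α := ℝ)).2 hcov) hn.le
  refine hcov'.trans ?_
  rw [Nat.cast_add, Nat.cast_sum, Nat.cast_sum, add_mul, Finset.sum_mul, Finset.sum_mul, mul_add]
  refine add_le_add ?_ ?_
  · refine (Finset.sum_le_sum fun X _ => b1 X).trans (le_of_eq ?_)
    rw [Finset.sum_const, Finset.card_univ, nsmul_eq_mul]
    have : Fintype.card (Fin k → Finset (Fin L)) = 2 ^ (k * L) := by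
      rw [Fintype.card_fun, Fintype.card_finset, Fintype.card_fin, Fintype.card_fin, ← pow_mul,
        mul_comm]
    rw [this]; push_cast; ring
  · refine (Finset.sum_le_sum fun i _ => b2 i).trans (le_of_eq ?_)
    rw [Finset.sum_const, Finset.card_univ, nsmul_eq_mul, Fintype.card_fin]
    ring
end

section
open Filter Topology

lemma half_pow_div_factorial_le_choose {k L : ℕ} (hk : 2 ≤ k) (hL : 2 * k ≤ L) :
    ((L : ℝ) / 2) ^ (k - 1) / ((k - 1).factorial : ℝ) ≤ (((L - 2).choose (k - 1) : ℕ) : ℝ) := by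
  refine le_trans ?_ (Nat.pow_le_choose (α := ℝ) (k - 1) (L - 2))
  gcongr
  have h : L - 2 + 1 - (k - 1) = L - k := by omega
  rw [h, Nat.cast_sub (by omega)]
  have : 2 * (k : ℝ) ≤ L := by exact_mod_cast hL
  linarith

lemma choose_pred_le_two_mul {k L : ℕ} (hk : 2 ≤ k) (hL : 2 * k ≤ L) :
    (L - 1).choose (k - 1) ≤ 2 * (L - 2).choose (k - 1) := by
  obtain ⟨a, rfl⟩ : ∃ a, L = a + 2 := ⟨L - 2, by omega⟩
  obtain ⟨b, rfl⟩ : ∃ b, k = b + 2 := ⟨k - 2, by omega⟩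
  have h1 : a + 2 - 1 = a + 1 := by omega
  have h2 : b + 2 - 1 = b + 1 := by omega
  rw [h1, h2, Nat.choose_succ_succ, Nat.add_sub_cancel]
  have := Nat.choose_le_succ_of_lt_half_left (r := b) (n := a) (by omega)
  simp only [Nat.succ_eq_add_one] at this ⊢
  omega

lemma tendsto_pow_mul_exp_neg_mul (a : ℕ) {c : ℝ} (hc : 0 < c) :
    Tendsto (fun L : ℕ => (L : ℝ) ^ a * Real.exp (-(c * L))) atTop (𝓝 0) := by
  have h1 := (Real.tendsto_pow_mul_exp_neg_atTop_nhds_zero a).comp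
    (tendsto_natCast_atTop_atTop.const_mul_atTop hc)
  have h2 := h1.const_mul ((c ^ a)⁻¹)
  rw [mul_zero] at h2
  refine h2.congr fun L => ?_
  simp only [Function.comp]
  rw [mul_pow]
  field_simp

lemma eventually_tail_le (k : ℕ) (hk : 2 ≤ k) {γ : ℝ} (hγ : 0 < γ) {η : ℝ} (hη : 0 < η) :
    ∀ᶠ L : ℕ in atTop, (L : ℝ) * (2 ^ (k * L) * (2 ^ (k + 1) * (L : ℝ) ^ (k - 2) *
        Real.exp (-(γ ^ 2 * (L : ℝ) ^ 2 / 4))) +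
        L * (2 ^ k * (L : ℝ) ^ (k - 2) * Real.exp (-(γ ^ 2 * L / 4)))) ≤ η := by
  have t1 := (tendsto_pow_mul_exp_neg_mul (k - 1) one_pos).const_mul ((2 : ℝ) ^ (k + 1))
  have t2 := (tendsto_pow_mul_exp_neg_mul k (c := γ ^ 2 / 4) (by positivity)).const_mul
    ((2 : ℝ) ^ k)
  have t := t1.add t2
  simp only [mul_zero, add_zero] at t
  have hbig : ∀ᶠ L : ℕ in atTop, (k + 1) * (4 / γ ^ 2) ≤ (L : ℝ) :=
    tendsto_natCast_atTop_atTop.eventually_ge_atTop _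
  filter_upwards [t.eventually (ge_mem_nhds hη), hbig] with L h1 h2
  refine le_trans ?_ h1
  have hx : (k : ℝ) + 1 ≤ γ ^ 2 * L / 4 := by
    have : 0 < γ ^ 2 := by positivity
    have h3 := mul_le_mul_of_nonneg_left h2 (by positivity : 0 ≤ γ ^ 2 / 4)
    have h4 : γ ^ 2 / 4 * ((k + 1) * (4 / γ ^ 2)) = k + 1 := by field_simp
    rw [h4] at h3
    linarith
  have h5 : (2 : ℝ) ^ (k * L) * Real.exp (-(γ ^ 2 * (L : ℝ) ^ 2 / 4)) ≤ Real.exp (-(1 * L)) := by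
    have h6 : (2 : ℝ) ^ (k * L) ≤ Real.exp ((k * L : ℕ)) := by
      rw [← Real.exp_one_pow]
      exact pow_le_pow_left₀ (by norm_num) (by linarith [Real.add_one_le_exp (1 : ℝ)]) _
    calc _ ≤ Real.exp ((k * L : ℕ)) * Real.exp (-(γ ^ 2 * (L : ℝ) ^ 2 / 4)) := by gcongr
      _ = Real.exp ((k * L : ℕ) + -(γ ^ 2 * (L : ℝ) ^ 2 / 4)) := (Real.exp_add _ _).symm
      _ ≤ _ := by
        rw [Real.exp_le_exp]
        push_cast
        have := mul_le_mul_of_nonneg_right hx (Nat.cast_nonneg (α := ℝ) L)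
        nlinarith
  have e1 : (L : ℝ) ^ (k - 1) = L * L ^ (k - 2) := by
    rw [← pow_succ']; congr 1; omega
  have e2 : (L : ℝ) ^ k = L * (L * L ^ (k - 2)) := by
    rw [← pow_succ', ← pow_succ']; congr 1; omega
  have e3 : γ ^ 2 / 4 * (L : ℝ) = γ ^ 2 * L / 4 := by ring
  rw [mul_add, e1, e2, e3]
  refine add_le_add ?_ (le_of_eq (by ring))
  have h7 := mul_le_mul_of_nonneg_left h5
    (by positivity : (0 : ℝ) ≤ 2 ^ (k + 1) * (L * L ^ (k - 2)))
  linarith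

open Classical in
/-- Blocks of bounded size are rarely bad, uniformly in a prescribed vertex. -/
lemma exists_block_size {k m : ℕ} (hk : 2 ≤ k) (hm : 0 < m) {F : Finset (Finset (Fin m))}
    (hF : InFtil k m F) {d μ : ℝ} (hd0 : 0 < d) (hd1 : d ≤ 1) (hμ0 : 0 < μ) (hμ1 : μ ≤ 1) :
    ∃ L₀ : ℕ, 0 < L₀ ∧ m ∣ L₀ ∧ ∃ ε : ℝ, 0 < ε ∧ ∀ n, ∀ G : Finset (Finset (Fin n)),
      IsHG k n G → UniformlyDense k n ε d G → MinDegGE G 1 (μ * (n : ℝ) ^ (k - 1)) →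
      ∀ ℓ, L₀ ≤ ℓ → ℓ < 2 * L₀ → m ∣ ℓ → ∀ (i₀ : Fin ℓ) (v : Fin n),
      ((Finset.univ.filter fun w : Fin ℓ → Fin n =>
        w i₀ = v ∧ ¬ HasPerfectTiling m ℓ F (pullback k G w)).card : ℝ) * n ≤
        (n : ℝ) ^ ℓ * (1 / (48 * L₀)) := by
  obtain ⟨ε', hε', n₁, hn₁⟩ := hF d (μ / 4) hd0 (by positivity)
  have hk0 : 0 < k := by omega
  have hkR : (0 : ℝ) < k := Nat.cast_pos.2 hk0
  set γ : ℝ := min 1 (min (ε' / (2 * k ^ k * 2 ^ (k + 1)))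
    (μ / (2 ^ (k + 1) * 2 ^ (k - 1) * (k - 1).factorial))) with hγ
  have hγ0 : 0 < γ := by
    have := Nat.factorial_pos (k - 1)
    refine lt_min one_pos (lt_min ?_ ?_) <;> positivity
  have hγ1 : γ ≤ 1 := min_le_left _ _
  have hγ2 : γ ≤ ε' / (2 * k ^ k * 2 ^ (k + 1)) := (min_le_right _ _).trans (min_le_left _ _)
  have hγ3 : γ ≤ μ / (2 ^ (k + 1) * 2 ^ (k - 1) * (k - 1).factorial) :=
    (min_le_right _ _).trans (min_le_right _ _)
  obtain ⟨L₁, hL₁⟩ := eventually_atTop.1 ((eventually_tail_le k hk hγ0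
    (η := 1 / 96) (by norm_num)).and
    (tendsto_natCast_atTop_atTop.eventually_ge_atTop (2 * ((k : ℝ) ^ 2 + k) / ε')))
  set L₀ := m * (L₁ + n₁ + 2 * k) with hL₀
  have hge : L₁ + n₁ + 2 * k ≤ L₀ := Nat.le_mul_of_pos_left _ hm
  have hL₀pos : 0 < L₀ := by omega
  have hL₀R : (0 : ℝ) < L₀ := Nat.cast_pos.2 hL₀pos
  set B : ℝ := 2 ^ (k * (2 * L₀)) * (2 ^ (k + 1) * (2 * L₀ : ℝ) ^ (k - 2) *
    ((2 * L₀ : ℝ) ^ 2 * Real.exp (1 * (2 * L₀ : ℝ) ^ 2))) with hB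
  have hBpos : 0 < B := by positivity
  refine ⟨L₀, hL₀pos, Dvd.intro _ rfl, 1 / (96 * L₀ * B), by positivity, ?_⟩
  intro n G hG hU hdeg ℓ hℓ hℓ2 hmℓ i₀ v
  have hℓpos : 0 < ℓ := by omega
  have hℓR : (0 : ℝ) < ℓ := Nat.cast_pos.2 hℓpos
  have hℓ2R : (ℓ : ℝ) ≤ 2 * L₀ := by exact_mod_cast hℓ2.le
  have hℓR' : (L₀ : ℝ) ≤ ℓ := by exact_mod_cast hℓ
  refine (card_bad_le hk hG hU hdeg (by positivity) hd0.le hd1 hμ0.le hμ1 hγ0.le hγ1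
    (ε' := ε') (μ' := μ / 4) (Q := HasPerfectTiling m ℓ F)
    (fun H h1 h2 h3 => hn₁ ℓ (by omega) hmℓ H h1 h2 h3) ?_ ?_ i₀ v).trans ?_
  · have h1 := (hL₁ ℓ (by omega)).2
    rw [div_le_iff₀ hε'] at h1
    rw [le_div_iff₀ (by positivity)] at hγ2
    have := mul_le_mul_of_nonneg_right hγ2 hℓR.le
    nlinarith
  · have h1 : (((ℓ - 1).choose (k - 1) : ℕ) : ℝ) ≤ 2 * (((ℓ - 2).choose (k - 1) : ℕ) : ℝ) := by
      exact_mod_cast choose_pred_le_two_mul hk (by omega)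
    have h2 := half_pow_div_factorial_le_choose hk (show 2 * k ≤ ℓ by omega)
    have hfac : (0 : ℝ) < (k - 1).factorial := Nat.cast_pos.2 (Nat.factorial_pos _)
    have h3 : 2 ^ k * γ * (ℓ : ℝ) ^ (k - 1) ≤ μ / 2 * (((ℓ - 2).choose (k - 1) : ℕ) : ℝ) := by
      refine le_trans ?_ (mul_le_mul_of_nonneg_left h2 (by positivity))
      have h4 := mul_le_mul_of_nonneg_left hγ3 (by positivity : (0 : ℝ) ≤ 2 ^ k * (ℓ : ℝ) ^ (k - 1))
      calc 2 ^ k * γ * (ℓ : ℝ) ^ (k - 1) = 2 ^ k * (ℓ : ℝ) ^ (k - 1) * γ := by ring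
        _ ≤ _ := h4
        _ = _ := by
          rw [div_pow]; field_simp; ring
    nlinarith
  · refine mul_le_mul_of_nonneg_left ?_ (by positivity)
    have h1 := (hL₁ ℓ (by omega)).1
    have h2 : 2 ^ (k * ℓ) * (2 ^ (k + 1) * (ℓ : ℝ) ^ (k - 2) *
        ((ℓ : ℝ) ^ 2 * (1 / (96 * L₀ * B)) * Real.exp (γ * (ℓ : ℝ) ^ 2))) ≤
        B * (1 / (96 * L₀ * B)) := by
      have : 2 ^ (k * ℓ) * (2 ^ (k + 1) * (ℓ : ℝ) ^ (k - 2) *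
        ((ℓ : ℝ) ^ 2 * Real.exp (γ * (ℓ : ℝ) ^ 2))) ≤ B := by
        rw [hB]
        gcongr
        norm_num
      refine le_trans (le_of_eq ?_) (mul_le_mul_of_nonneg_right this (by positivity))
      ring
    have h3 : B * (1 / (96 * L₀ * B)) = 1 / 96 / L₀ := by field_simp
    rw [h3] at h2
    rw [← le_div_iff₀' hℓR] at h1
    have h4 : (1 : ℝ) / 96 / ℓ ≤ 1 / 96 / L₀ := by gcongr
    have h5 : (1 : ℝ) / (48 * L₀) = 1 / 96 / L₀ + 1 / 96 / L₀ := by field_simp; norm_num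
    rw [h5]
    have h6 := add_le_add (h1.trans h4) h2
    refine le_trans (le_of_eq ?_) h6
    ring
end

section
variable {N n : ℕ} {ℓ : Fin N → ℕ}

/-- The graph of the tuple `w` placed on block `b`. -/
def blockGraph (e : (Σ b, Fin (ℓ b)) ≃ Fin n) (b : Fin N) (w : Fin (ℓ b) → Fin n) :
    Finset (Fin n × Fin n) :=
  Finset.univ.image fun i => (e ⟨b, i⟩, w i)

lemma card_blockGraph (e : (Σ b, Fin (ℓ b)) ≃ Fin n) (b : Fin N) (w : Fin (ℓ b) → Fin n) :
    (blockGraph e b w).card = ℓ b := by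
  rw [blockGraph, Finset.card_image_of_injective, Finset.card_univ, Fintype.card_fin]
  intro i j hij
  simpa using e.injective (Prod.ext_iff.1 hij).1

lemma extends_blockGraph (e : (Σ b, Fin (ℓ b)) ≃ Fin n) (b : Fin N) (w : Fin (ℓ b) → Fin n)
    (σ : Equiv.Perm (Fin n)) : Extends σ (blockGraph e b w) ↔ (fun i => σ (e ⟨b, i⟩)) = w := by
  simp [Extends, blockGraph, funext_iff]

/-- All graphs of tuples from `bad`. -/
def blockGraphs (e : (Σ b, Fin (ℓ b)) ≃ Fin n) (bad : ∀ b, Finset (Fin (ℓ b) → Fin n)) :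
    Finset (Finset (Fin n × Fin n)) :=
  (Finset.univ.sigma bad).biUnion fun x => {blockGraph e x.1 x.2}

lemma mem_blockGraphs {e : (Σ b, Fin (ℓ b)) ≃ Fin n} {bad : ∀ b, Finset (Fin (ℓ b) → Fin n)}
    {g : Finset (Fin n × Fin n)} :
    g ∈ blockGraphs e bad ↔ ∃ b, ∃ w ∈ bad b, g = blockGraph e b w := by
  simp [blockGraphs, Sigma.exists]

open Classical in
lemma sum_touching_le (e : (Σ b, Fin (ℓ b)) ≃ Fin n) (bad : ∀ b, Finset (Fin (ℓ b) → Fin n))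
    {η : ℝ} (hbad : ∀ b i v, (((bad b).filter fun w => w i = v).card : ℝ) * n ≤
      (n : ℝ) ^ ℓ b * η) (hℓ : ∀ b, 0 < ℓ b)
    (hdesc : ∀ b, (n : ℝ) ^ ℓ b ≤ 2 * (n.descFactorial (ℓ b) : ℝ)) (p : Fin n × Fin n) :
    ∑ g ∈ blockGraphs e bad with Touches g p,
      2 / ((Fintype.card (Fin n)).descFactorial g.card : ℝ) ≤ 8 * η := by
  have hn : (0 : ℝ) < n := Nat.cast_pos.2 p.1.pos
  have hη : ∀ b : Fin N, ((bad b).card : ℝ) ≤ (n : ℝ) ^ ℓ b * η := by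
    intro b
    let i₀ : Fin (ℓ b) := ⟨0, hℓ b⟩
    have h1 : (bad b).card = ∑ v : Fin n, ((bad b).filter fun w => w i₀ = v).card :=
      Finset.card_eq_sum_card_fiberwise fun _ _ => Finset.mem_univ _
    rw [h1, Nat.cast_sum]
    refine (Finset.sum_le_sum fun v _ => (le_div_iff₀ hn).2 (hbad b i₀ v)).trans (le_of_eq ?_)
    rw [Finset.sum_const, Finset.card_univ, Fintype.card_fin, nsmul_eq_mul,
      mul_div_cancel₀ _ hn.ne']
  rw [Finset.sum_filter, blockGraphs]
  refine (sum_biUnion_le_sum _ _ _ fun g => by positivity).trans ?_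
  simp only [Finset.sum_singleton, card_blockGraph, Fintype.card_fin]
  set b₀ := (e.symm p.1).1 with hb₀
  have h1 : ∀ x ∈ Finset.univ.sigma bad,
      (if Touches (blockGraph e x.1 x.2) p then 2 / (n.descFactorial (ℓ x.1) : ℝ) else 0) ≤
      (if x.1 = b₀ then 4 / (n : ℝ) ^ ℓ x.1 else 0) +
        ∑ i, if x.2 i = p.2 then 4 / (n : ℝ) ^ ℓ x.1 else 0 := by
    rintro ⟨b, w⟩ _
    have h2 : 2 / (n.descFactorial (ℓ b) : ℝ) ≤ 4 / (n : ℝ) ^ ℓ b := by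
      have h3 := hdesc b
      have h4 : 0 < (n : ℝ) ^ ℓ b := by positivity
      rw [div_le_div_iff₀ (by linarith) h4]
      linarith
    have h5 : ∀ i, (0 : ℝ) ≤ if w i = p.2 then 4 / (n : ℝ) ^ ℓ b else 0 := fun i => by positivity
    have h6 : (0 : ℝ) ≤ if b = b₀ then 4 / (n : ℝ) ^ ℓ b else 0 := by positivity
    simp only
    by_cases ht : Touches (blockGraph e b w) p
    · rw [if_pos ht]
      obtain ⟨r, hr, hrp⟩ := ht
      obtain ⟨i, -, rfl⟩ := Finset.mem_image.1 hr
      rcases hrp with h | h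
      · have : b = b₀ := by rw [hb₀, ← h]; simp
        rw [if_pos this]
        have := Finset.sum_nonneg fun i (_ : i ∈ Finset.univ) => h5 i
        linarith
      · have := Finset.single_le_sum (fun i _ => h5 i) (Finset.mem_univ i)
        simp only at h
        rw [if_pos h] at this
        linarith
    · rw [if_neg ht]
      exact add_nonneg h6 (Finset.sum_nonneg fun i _ => h5 i)
  refine (Finset.sum_le_sum h1).trans ?_
  rw [Finset.sum_add_distrib, Finset.sum_sigma, Finset.sum_sigma]
  have h2 : ∑ b : Fin N, ∑ w ∈ bad b, (if b = b₀ then 4 / (n : ℝ) ^ ℓ b else 0) ≤ 4 * η := by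
    simp only [Finset.sum_const, nsmul_eq_mul, mul_ite, mul_zero, Finset.sum_ite_eq',
      Finset.mem_univ, if_true]
    rw [mul_div_assoc', div_le_iff₀ (by positivity)]
    have := hη b₀
    linarith
  have h3 : ∑ b : Fin N, ∑ w ∈ bad b, ∑ i, (if w i = p.2 then 4 / (n : ℝ) ^ ℓ b else 0) ≤
      4 * η := by
    have h4 : ∀ b : Fin N, ∑ w ∈ bad b, ∑ i, (if w i = p.2 then 4 / (n : ℝ) ^ ℓ b else 0) ≤
        (ℓ b : ℝ) * (4 * η / n) := by
      intro b
      rw [Finset.sum_comm]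
      have h5 : ∀ i ∈ (Finset.univ : Finset (Fin (ℓ b))),
          ∑ w ∈ bad b, (if w i = p.2 then 4 / (n : ℝ) ^ ℓ b else 0) ≤ 4 * η / n := by
        intro i _
        rw [← Finset.sum_filter, Finset.sum_const, nsmul_eq_mul, le_div_iff₀ hn,
          mul_div_assoc', div_mul_eq_mul_div, div_le_iff₀ (by positivity)]
        have := hbad b i p.2
        linarith
      refine (Finset.sum_le_sum h5).trans (le_of_eq ?_)
      simp
    refine (Finset.sum_le_sum fun b _ => h4 b).trans (le_of_eq ?_)
    have h6 : ∑ b, ℓ b = n := by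
      have := Fintype.card_congr e
      simpa using this
    rw [← Finset.sum_mul, ← Nat.cast_sum, h6]
    field_simp
  linarith
end

section
variable {m n : ℕ}

/-- `T` is a perfect `F`-tiling of `E`. -/
def IsTiling (F : Finset (Finset (Fin m))) (E : Finset (Finset (Fin n)))
    (T : Finset (Fin m → Fin n)) : Prop :=
  (∀ φ ∈ T, Function.Injective φ ∧ ∀ e ∈ F, e.image φ ∈ E) ∧
    (∀ v : Fin n, ∃ φ ∈ T, v ∈ Finset.image φ Finset.univ) ∧
    (∀ φ ∈ T, ∀ ψ ∈ T, φ ≠ ψ →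
      Disjoint (Finset.image φ Finset.univ) (Finset.image ψ Finset.univ))

lemma exists_blocks {L₀ : ℕ} (hL : 0 < L₀) (hmL : m ∣ L₀) :
    ∀ n, m ∣ n → L₀ ≤ n → ∃ N, ∃ ℓ : Fin N → ℕ, ∑ b, ℓ b = n ∧
      ∀ b, L₀ ≤ ℓ b ∧ ℓ b < 2 * L₀ ∧ m ∣ ℓ b := by
  intro n
  induction n using Nat.strong_induction_on with
  | _ n ih =>
    intro hmn hLn
    by_cases h : n < 2 * L₀
    · exact ⟨1, fun _ => n, by simp, fun _ => ⟨hLn, h, hmn⟩⟩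
    · obtain ⟨N, ℓ, h1, h2⟩ := ih (n - L₀) (by omega) (Nat.dvd_sub hmn hmL) (by omega)
      refine ⟨N + 1, Fin.cons L₀ ℓ, ?_, ?_⟩
      · rw [Fin.sum_univ_succ]
        simp only [Fin.cons_zero, Fin.cons_succ, h1]
        omega
      · intro b
        refine Fin.cases ?_ (fun b => ?_) b
        · simpa using ⟨(by omega : L₀ < 2 * L₀), hmL⟩
        · simpa using h2 b

lemma pow_le_two_mul_descFactorial {s : ℕ} (h : 2 * s ^ 2 ≤ n) :
    (n : ℝ) ^ s ≤ 2 * (n.descFactorial s : ℝ) := by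
  rcases Nat.eq_zero_or_pos s with rfl | hs
  · simp
  have hsn : s ≤ n := by nlinarith
  have hn : (0 : ℝ) < n := Nat.cast_pos.2 (by omega)
  have h1 : ((n : ℝ) - s) ^ s ≤ (n.descFactorial s : ℝ) := by
    have h2 := Nat.pow_sub_le_descFactorial n s
    have h3 : ((n : ℝ) - s) ≤ ((n + 1 - s : ℕ) : ℝ) := by
      rw [Nat.cast_sub (by omega)]; push_cast; linarith
    have h4 : (0 : ℝ) ≤ n - s := by
      have : (s : ℝ) ≤ n := by exact_mod_cast hsn
      linarith
    refine (pow_le_pow_left₀ h4 h3 s).trans ?_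
    exact_mod_cast h2
  have h5 := one_add_mul_le_pow (a := -((s : ℝ) / n)) (by
    have : (s : ℝ) / n ≤ 1 := by rw [div_le_one hn]; exact_mod_cast hsn
    linarith) s
  have h6 : (s : ℝ) * (s / n) ≤ 1 / 2 := by
    rw [mul_div_assoc', div_le_iff₀ hn]
    have : (2 : ℝ) * s ^ 2 ≤ n := by exact_mod_cast h
    nlinarith
  have h7 : ((n : ℝ) - s) ^ s = n ^ s * (1 + -((s : ℝ) / n)) ^ s := by
    rw [← mul_pow]; congr 1; field_simp; ring
  have h8 := mul_le_mul_of_nonneg_left h5 (by positivity : (0 : ℝ) ≤ (n : ℝ) ^ s)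
  have h9 : 0 < (n : ℝ) ^ s := by positivity
  nlinarith

lemma card_mul_le_of_disjoint {A : Finset (Fin m → Fin n)}
    (hinj : ∀ φ ∈ A, Function.Injective φ)
    (hdis : ∀ φ ∈ A, ∀ ψ ∈ A, φ ≠ ψ →
      Disjoint (Finset.image φ Finset.univ) (Finset.image ψ Finset.univ)) :
    (A.biUnion fun φ => Finset.univ.image φ).card = m * A.card := by
  rw [Finset.card_biUnion hdis, Finset.sum_congr rfl fun φ hφ =>
    Finset.card_image_of_injective _ (hinj φ hφ)]
  simp [mul_comm]

lemma IsTiling.card_le (hm : 0 < m) {F : Finset (Finset (Fin m))} {E : Finset (Finset (Fin n))}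
    {T : Finset (Fin m → Fin n)} (h : IsTiling F E T) : T.card ≤ n := by
  have h1 := card_mul_le_of_disjoint (fun φ hφ => (h.1 φ hφ).1) h.2.2
  have h2 : (T.biUnion fun φ => Finset.univ.image φ).card ≤ n := by
    simpa using Finset.card_le_univ (T.biUnion fun φ => Finset.univ.image φ)
  nlinarith

variable {N : ℕ} {ℓ : Fin N → ℕ}

/-- Union of block tilings transported along `σ`. -/
def glue (e : (Σ b, Fin (ℓ b)) ≃ Fin n) (σ : Equiv.Perm (Fin n))
    (tl : ∀ b, Finset (Fin m → Fin (ℓ b))) : Finset (Fin m → Fin n) :=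
  Finset.univ.biUnion fun b => (tl b).image fun ψ j => σ (e ⟨b, ψ j⟩)

lemma mem_glue {e : (Σ b, Fin (ℓ b)) ≃ Fin n} {σ : Equiv.Perm (Fin n)}
    {tl : ∀ b, Finset (Fin m → Fin (ℓ b))} {φ : Fin m → Fin n} :
    φ ∈ glue e σ tl ↔ ∃ b, ∃ ψ ∈ tl b, (fun j => σ (e ⟨b, ψ j⟩)) = φ := by
  simp [glue]

lemma isTiling_glue {k : ℕ} {F : Finset (Finset (Fin m))} {G : Finset (Finset (Fin n))}
    (e : (Σ b, Fin (ℓ b)) ≃ Fin n) (σ : Equiv.Perm (Fin n))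
    (tl : ∀ b, Finset (Fin m → Fin (ℓ b)))
    (h : ∀ b, IsTiling F (pullback k G fun i => σ (e ⟨b, i⟩)) (tl b)) :
    IsTiling F G (glue e σ tl) := by
  refine ⟨?_, ?_, ?_⟩
  · intro φ hφ
    obtain ⟨b, ψ, hψ, rfl⟩ := mem_glue.1 hφ
    obtain ⟨h1, h2⟩ := (h b).1 ψ hψ
    refine ⟨fun i j hij => h1 ?_, fun f hf => ?_⟩
    · simpa using e.injective (σ.injective hij)
    · have h3 := (Finset.mem_filter.1 (h2 f hf)).2
      rwa [Finset.image_image] at h3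
  · intro v
    obtain ⟨⟨b, i⟩, hi⟩ := e.surjective (σ.symm v)
    obtain ⟨ψ, hψ, hv⟩ := (h b).2.1 i
    refine ⟨_, mem_glue.2 ⟨b, ψ, hψ, rfl⟩, ?_⟩
    obtain ⟨j, -, hj⟩ := Finset.mem_image.1 hv
    exact Finset.mem_image.2 ⟨j, Finset.mem_univ _, by simp [hj, hi]⟩
  · intro φ hφ φ' hφ' hne
    obtain ⟨b, ψ, hψ, rfl⟩ := mem_glue.1 hφ
    obtain ⟨b', ψ', hψ', rfl⟩ := mem_glue.1 hφ'
    rw [Finset.disjoint_left]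
    intro v hv hv'
    obtain ⟨j, -, hj⟩ := Finset.mem_image.1 hv
    obtain ⟨j', -, hj'⟩ := Finset.mem_image.1 hv'
    have hjj : (⟨b, ψ j⟩ : Σ b, Fin (ℓ b)) = ⟨b', ψ' j'⟩ :=
      e.injective (σ.injective (hj.trans hj'.symm))
    obtain ⟨rfl, h1⟩ := Sigma.mk.inj_iff.1 hjj
    have h1 := eq_of_heq h1
    have hψψ : ψ ≠ ψ' := fun h => hne (by rw [h])
    exact Finset.disjoint_left.1 ((h b).2.2 ψ hψ ψ' hψ' hψψ)
      (Finset.mem_image_of_mem ψ (Finset.mem_univ j))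
      (h1 ▸ Finset.mem_image_of_mem ψ' (Finset.mem_univ j'))

open Classical in
lemma spread_glue {F : Finset (Finset (Fin m))} {G : Finset (Finset (Fin n))} (hn : 0 < n)
    (e : (Σ b, Fin (ℓ b)) ≃ Fin n) (tl : Equiv.Perm (Fin n) → ∀ b, Finset (Fin m → Fin (ℓ b)))
    (O : Finset (Equiv.Perm (Fin n))) (hT : ∀ σ ∈ O, IsTiling F G (glue e σ (tl σ)))
    (hO : ∀ h : Finset (Fin n × Fin n), ((O.filter fun σ => Extends σ h).card : ℝ) *
      n.descFactorial h.card ≤ 2 ^ h.card * O.card) {W : ℝ} (hW : ∑ b, (ℓ b : ℝ) ^ m ≤ W) :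
    Spread O (fun σ => glue e σ (tl σ)) (6 ^ m * W / (n : ℝ) ^ m) O.card := by
  intro A
  have hnR : (0 : ℝ) < n := Nat.cast_pos.2 hn
  have hW0 : 0 ≤ W := le_trans (Finset.sum_nonneg fun b _ => by positivity) hW
  by_cases hA : ∃ σ ∈ O, A ⊆ glue e σ (tl σ)
  swap
  · have : (O.filter fun σ => A ⊆ glue e σ (tl σ)) = ∅ := by
      rw [Finset.filter_eq_empty_iff]
      intro σ hσ h
      exact hA ⟨σ, hσ, h⟩
    rw [this]; simp only [Finset.card_empty, Nat.cast_zero]; positivity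
  obtain ⟨σ₀, hσ₀, hA₀⟩ := hA
  have hinj : ∀ φ ∈ A, Function.Injective φ := fun φ hφ => ((hT σ₀ hσ₀).1 φ (hA₀ hφ)).1
  have hdis : ∀ φ ∈ A, ∀ ψ ∈ A, φ ≠ ψ →
      Disjoint (Finset.image φ Finset.univ) (Finset.image ψ Finset.univ) :=
    fun φ hφ ψ hψ => (hT σ₀ hσ₀).2.2 φ (hA₀ hφ) ψ (hA₀ hψ)
  have hcard := card_mul_le_of_disjoint hinj hdis
  set s := m * A.card with hs
  have hsn : s ≤ n := by
    rw [← hcard]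
    simpa using Finset.card_le_univ (A.biUnion fun φ => Finset.univ.image φ)
  let pat : ({φ // φ ∈ A} → Σ b, (Fin m → Fin (ℓ b))) → Finset (Fin n × Fin n) := fun f =>
    Finset.univ.biUnion fun φ => Finset.univ.image fun j => (e ⟨(f φ).1, (f φ).2 j⟩, φ.1 j)
  have hpat : ∀ f, (pat f).card = s := by
    intro f
    refine le_antisymm ?_ ?_
    · refine (Finset.card_biUnion_le_card_mul _ _ m fun φ _ => ?_).trans ?_
      · exact Finset.card_image_le.trans (by simp)
      · simp [hs, mul_comm]
    · rw [← hcard]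
      refine le_trans (Finset.card_le_card ?_) (Finset.card_image_le (f := Prod.snd))
      intro v hv
      obtain ⟨φ, hφ, hv⟩ := Finset.mem_biUnion.1 hv
      obtain ⟨j, -, rfl⟩ := Finset.mem_image.1 hv
      refine Finset.mem_image.2 ⟨(e ⟨(f ⟨φ, hφ⟩).1, (f ⟨φ, hφ⟩).2 j⟩, φ j), ?_, rfl⟩
      exact Finset.mem_biUnion.2 ⟨⟨φ, hφ⟩, Finset.mem_univ _,
        Finset.mem_image.2 ⟨j, Finset.mem_univ _, rfl⟩⟩
  have hcov : (O.filter fun σ => A ⊆ glue e σ (tl σ)).card ≤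
      ∑ f, (O.filter fun σ => Extends σ (pat f)).card := by
    refine le_trans (Finset.card_le_card fun σ hσ => ?_) Finset.card_biUnion_le
    obtain ⟨hσO, hσA⟩ := Finset.mem_filter.1 hσ
    have h1 : ∀ φ : {φ // φ ∈ A}, ∃ x : Σ b, (Fin m → Fin (ℓ b)),
        (fun j => σ (e ⟨x.1, x.2 j⟩)) = φ.1 := fun φ => by
      obtain ⟨b, ψ, -, h⟩ := mem_glue.1 (hσA φ.2)
      exact ⟨⟨b, ψ⟩, h⟩
    choose f hf using h1
    refine Finset.mem_biUnion.2 ⟨f, Finset.mem_univ _, Finset.mem_filter.2 ⟨hσO, ?_⟩⟩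
    intro p hp
    obtain ⟨φ, -, hp⟩ := Finset.mem_biUnion.1 hp
    obtain ⟨j, -, rfl⟩ := Finset.mem_image.1 hp
    exact congrFun (hf φ) j
  have h1 : ∀ f, ((O.filter fun σ => Extends σ (pat f)).card : ℝ) ≤
      6 ^ s * O.card / (n : ℝ) ^ s := by
    intro f
    have h2 := hO (pat f)
    rw [hpat] at h2
    have h3 := pow_le_three_pow_mul_descFactorial n s hsn
    rw [le_div_iff₀ (by positivity)]
    calc ((O.filter fun σ => Extends σ (pat f)).card : ℝ) * (n : ℝ) ^ s
        ≤ (O.filter fun σ => Extends σ (pat f)).card * (3 ^ s * (n.descFactorial s : ℝ)) := by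
          gcongr
      _ = 3 ^ s * ((O.filter fun σ => Extends σ (pat f)).card * (n.descFactorial s : ℝ)) := by
          ring
      _ ≤ 3 ^ s * (2 ^ s * O.card) := by gcongr
      _ = 6 ^ s * O.card := by rw [← mul_assoc, ← mul_pow]; norm_num
  have h2 : (Fintype.card ({φ // φ ∈ A} → Σ b, (Fin m → Fin (ℓ b))) : ℝ) ≤ W ^ A.card := by
    rw [Fintype.card_fun, Fintype.card_coe, Fintype.card_sigma]
    push_cast
    refine pow_le_pow_left₀ (Finset.sum_nonneg fun b _ => by positivity) ?_ _
    refine le_trans (le_of_eq ?_) hW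
    simp
  refine (Nat.cast_le.2 hcov).trans ?_
  rw [Nat.cast_sum]
  refine (Finset.sum_le_sum fun f _ => h1 f).trans ?_
  rw [Finset.sum_const, Finset.card_univ, nsmul_eq_mul]
  refine (mul_le_mul_of_nonneg_right h2 (by positivity)).trans (le_of_eq ?_)
  rw [hs, div_pow, mul_pow, ← pow_mul, ← pow_mul]
  ring
end

section

open Classical in
/-- The tilings of a dense `k`-graph support a spread distribution. -/
lemma exists_spread_tilings {k m : ℕ} (hk : 2 ≤ k) (hm : 0 < m) {F : Finset (Finset (Fin m))}
    (hF : InFtil k m F) {d μ : ℝ} (hd0 : 0 < d) (hd1 : d ≤ 1) (hμ0 : 0 < μ) (hμ1 : μ ≤ 1) :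
    ∃ K : ℝ, 0 < K ∧ ∃ ε : ℝ, 0 < ε ∧ ∃ n₀ : ℕ, ∀ n, n₀ ≤ n → m ∣ n →
      ∀ G : Finset (Finset (Fin n)), IsHG k n G → UniformlyDense k n ε d G →
      MinDegGE G 1 (μ * (n : ℝ) ^ (k - 1)) →
      ∃ (O : Finset (Equiv.Perm (Fin n))) (T : Equiv.Perm (Fin n) → Finset (Fin m → Fin n)),
        0 < O.card ∧ Spread O T (K / (n : ℝ) ^ (m - 1)) O.card ∧ ∀ σ ∈ O, IsTiling F G (T σ) := by
  obtain ⟨L₀, hL₀, hmL, ε, hε, hblock⟩ := exists_block_size hk hm hF hd0 hd1 hμ0 hμ1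
  have hL₀R : (0 : ℝ) < L₀ := Nat.cast_pos.2 hL₀
  refine ⟨6 ^ m * (2 * L₀) ^ m, by positivity, ε, hε, 8 * L₀ ^ 2 + L₀, ?_⟩
  intro n hn hmn G hG hU hdeg
  have hnpos : 0 < n := by nlinarith
  have hnR : (0 : ℝ) < n := Nat.cast_pos.2 hnpos
  obtain ⟨N, ℓ, hsum, hℓ⟩ := exists_blocks hL₀ hmL n hmn (by nlinarith)
  let e : (Σ b, Fin (ℓ b)) ≃ Fin n := finSigmaFinEquiv.trans (finCongr hsum)
  set bad : ∀ b, Finset (Fin (ℓ b) → Fin n) := fun b =>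
    Finset.univ.filter fun w => ¬ HasPerfectTiling m (ℓ b) F (pullback k G w) with hbaddef
  have hbad : ∀ b i v, (((bad b).filter fun w => w i = v).card : ℝ) * n ≤
      (n : ℝ) ^ ℓ b * (1 / (48 * L₀)) := by
    intro b i v
    have h := hblock n G hG hU hdeg (ℓ b) (hℓ b).1 (hℓ b).2.1 (hℓ b).2.2 i v
    have h2 : (bad b).filter (fun w => w i = v) = Finset.univ.filter fun w : Fin (ℓ b) → Fin n =>
        w i = v ∧ ¬ HasPerfectTiling m (ℓ b) F (pullback k G w) := by
      rw [hbaddef, Finset.filter_filter]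
      exact Finset.filter_congr fun w _ => and_comm
    rw [h2]; exact h
  have hℓpos : ∀ b, 0 < ℓ b := fun b => hL₀.trans_le (hℓ b).1
  have hdesc : ∀ b, (n : ℝ) ^ ℓ b ≤ 2 * (n.descFactorial (ℓ b) : ℝ) := fun b =>
    pow_le_two_mul_descFactorial (by nlinarith [(hℓ b).2.1])
  set 𝓑 := blockGraphs e bad with h𝓑
  have hcard : ∀ g ∈ 𝓑, ∃ b, g.card = ℓ b := fun g hg => by
    obtain ⟨b, w, -, rfl⟩ := mem_blockGraphs.1 hg
    exact ⟨b, card_blockGraph e b w⟩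
  have hM : ∀ g ∈ 𝓑, g.card ≤ 2 * L₀ := fun g hg => by
    obtain ⟨b, hb⟩ := hcard g hg
    rw [hb]; exact (hℓ b).2.1.le
  have hpos : ∀ g ∈ 𝓑, 0 < (Fintype.card (Fin n)).descFactorial g.card := fun g hg => by
    rw [Nat.descFactorial_pos, Fintype.card_fin]
    exact (hM g hg).trans (by nlinarith)
  have hs : ∀ p, ∑ g ∈ 𝓑 with Touches g p,
      2 / ((Fintype.card (Fin n)).descFactorial g.card : ℝ) ≤ 1 / (2 * (2 * L₀ : ℕ)) := by
    intro p
    refine (sum_touching_le e bad hbad hℓpos hdesc p).trans ?_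
    push_cast
    rw [mul_one_div, div_le_div_iff₀ (by positivity) (by positivity)]
    linarith
  have hne : ∀ g ∈ 𝓑, g.Nonempty := fun g hg => by
    obtain ⟨b, hb⟩ := hcard g hg
    rw [← Finset.card_pos, hb]; exact hℓpos b
  set O := avoiders ∅ 𝓑 with hO
  have htl : ∀ σ : Equiv.Perm (Fin n), ∃ tl : ∀ b, Finset (Fin m → Fin (ℓ b)), σ ∈ O →
      ∀ b, IsTiling F (pullback k G fun i => σ (e ⟨b, i⟩)) (tl b) := by
    intro σ
    by_cases hσ : σ ∈ O
    · have h1 : ∀ b, ∃ T, IsTiling F (pullback k G fun i => σ (e ⟨b, i⟩)) T := by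
        intro b
        by_contra h2
        refine (mem_avoiders.1 hσ).2 (blockGraph e b fun i => σ (e ⟨b, i⟩)) ?_
          ((extends_blockGraph e b _ σ).2 rfl)
        refine mem_blockGraphs.2 ⟨b, _, ?_, rfl⟩
        exact Finset.mem_filter.2 ⟨Finset.mem_univ _, h2⟩
      choose tl h using h1
      exact ⟨tl, fun _ => h⟩
    · exact ⟨fun _ => ∅, fun h => absurd h hσ⟩
  choose tl htl using htl
  have hT : ∀ σ ∈ O, IsTiling F G (glue e σ (tl σ)) := fun σ hσ =>
    isTiling_glue e σ (tl σ) (htl σ hσ)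
  refine ⟨O, fun σ => glue e σ (tl σ), card_avoiders_pos (by omega) hM hpos hs hne, ?_, hT⟩
  have hW : ∑ b, (ℓ b : ℝ) ^ m ≤ n * (2 * L₀) ^ m := by
    have h1 : ∀ b ∈ (Finset.univ : Finset (Fin N)), (ℓ b : ℝ) ^ m ≤ ℓ b * (2 * L₀) ^ m := by
      intro b _
      have h2 : (1 : ℝ) ≤ ℓ b := by exact_mod_cast hℓpos b
      have h3 : (ℓ b : ℝ) ≤ 2 * L₀ := by exact_mod_cast (hℓ b).2.1.le
      calc (ℓ b : ℝ) ^ m ≤ (2 * L₀) ^ m := by gcongr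
        _ ≤ ℓ b * (2 * L₀) ^ m := le_mul_of_one_le_left (by positivity) h2
    refine (Finset.sum_le_sum h1).trans (le_of_eq ?_)
    rw [← Finset.sum_mul, ← Nat.cast_sum, hsum]
  have h := spread_glue hnpos e tl O hT (fun h => ?_) hW
  · convert h using 1
    have : (n : ℝ) ^ m = n * n ^ (m - 1) := by rw [← pow_succ']; congr 1; omega
    rw [this]
    field_simp
  · have h1 := card_avoiders_mul_le_pow (by omega) hM hpos hs h
    rw [Fintype.card_fin] at h1
    refine le_trans (le_of_eq ?_) h1
    congr 3
    ext σ
    rw [Finset.mem_filter, hO, mem_avoiders, mem_avoiders]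
    constructor
    · rintro ⟨⟨-, h2⟩, h3⟩; exact ⟨h3, h2⟩
    · rintro ⟨h3, h2⟩; exact ⟨⟨fun p hp => absurd hp (Finset.notMem_empty p), h2⟩, h3⟩
end

section
open Filter Topology

lemma eventually_natCeil_sqrt_log {P : ℕ → Prop} (h : ∀ᶠ t : ℕ in atTop, P t) :
    ∀ᶠ n : ℕ in atTop, P ⌈Real.sqrt (Real.log n)⌉₊ := by
  have h1 : Tendsto (fun n : ℕ => ⌈Real.sqrt (Real.log n)⌉₊) atTop atTop :=
    tendsto_nat_ceil_atTop.comp (Real.tendsto_sqrt_atTop.comp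
      (Real.tendsto_log_atTop.comp tendsto_natCast_atTop_atTop))
  exact h1.eventually h

/-- A spread family of sets of size at most `n` is hit once the density exceeds the spread by a
logarithmic factor. -/
lemma exists_hit_threshold {K : ℝ} (hK : 0 < K) {m : ℕ} {η : ℝ} (hη : 0 < η) :
    ∃ n₀ : ℕ, ∀ n, n₀ ≤ n → ∀ {ι Φ : Type} [Fintype Φ] [DecidableEq Φ]
      (O : Finset ι) (T : ι → Finset Φ),
      0 < O.card → Spread O T (K / (n : ℝ) ^ (m - 1)) O.card → (∀ σ ∈ O, (T σ).card ≤ n) →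
      ∀ π : ℝ, 200 * K * Real.log n / (n : ℝ) ^ (m - 1) ≤ π → π ≤ 1 →
        1 - η ≤ ev (fun _ => π) (hit O T) := by
  have e1 : ∀ᶠ t : ℕ in atTop, Real.exp (4 / t) - 1 ≤ (η / 4) ^ 2 := by
    have h1 : Tendsto (fun t : ℕ => Real.exp (4 / (t : ℝ)) - 1) atTop (𝓝 (Real.exp 0 - 1)) :=
      ((Real.continuous_exp.tendsto 0).comp (tendsto_const_div_atTop_nhds_zero_nat 4)).sub_const 1
    rw [Real.exp_zero, sub_self] at h1
    exact h1.eventually (ge_mem_nhds (by positivity))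
  have e2 : ∀ᶠ t : ℕ in atTop, 6 * ((t : ℝ) ^ 2 * (1 / 2) ^ t) ≤ η / 2 := by
    have h1 := (tendsto_pow_const_mul_const_pow_of_abs_lt_one 2
      (r := (1 / 2 : ℝ)) (by rw [abs_of_pos] <;> norm_num)).const_mul 6
    rw [mul_zero] at h1
    exact h1.eventually (ge_mem_nhds (by positivity))
  obtain ⟨n₀, hn₀⟩ := eventually_atTop.1 ((eventually_natCeil_sqrt_log
    (e1.and (e2.and (eventually_ge_atTop 2)))).and
    ((Real.tendsto_log_atTop.comp tendsto_natCast_atTop_atTop).eventually_ge_atTop 1))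
  refine ⟨n₀ + 1, fun n hn ι Φ _ _ O T hO hS hcard π hπ hπ1 => ?_⟩
  obtain ⟨⟨h1, h2, h3⟩, h4⟩ := hn₀ n (by omega)
  simp only [Function.comp] at h4
  have hnR : (0 : ℝ) < n := Nat.cast_pos.2 (by omega)
  set l := Real.log n with hl
  set t := ⌈Real.sqrt l⌉₊ with ht
  have hl0 : 0 < l := by linarith
  have htR : (2 : ℝ) ≤ t := by exact_mod_cast h3
  have hlt : l ≤ (t : ℝ) ^ 2 := by
    have := Nat.le_ceil (Real.sqrt l)
    calc l = Real.sqrt l ^ 2 := (Real.sq_sqrt hl0.le).symm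
      _ ≤ _ := by gcongr
  have htl : (t : ℝ) ^ 2 / 4 ≤ l := by
    have := Nat.ceil_lt_add_one (Real.sqrt_nonneg l)
    rw [← ht] at this
    calc (t : ℝ) ^ 2 / 4 = (t / 2 : ℝ) ^ 2 := by ring
      _ ≤ Real.sqrt l ^ 2 := by
        refine pow_le_pow_left₀ (by positivity) ?_ 2
        linarith
      _ = l := Real.sq_sqrt hl0.le
  set q := K / (n : ℝ) ^ (m - 1) with hq
  have hq0 : 0 < q := by positivity
  have hlog : (Nat.log 2 n : ℝ) + 1 ≤ 3 * l := by
    have h5 : (Nat.log 2 n : ℝ) * Real.log 2 ≤ l := by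
      rw [← Real.log_pow]
      refine Real.log_le_log (by positivity) ?_
      exact_mod_cast Nat.pow_log_le_self 2 (by omega)
    have h6 := Real.log_two_gt_d9
    have h7 : (0 : ℝ) ≤ Nat.log 2 n := Nat.cast_nonneg _
    nlinarith
  have key := le_ev_hit (q := q) (N := (O.card : ℝ)) (ρ' := q * l) (θ' := η / 4) (t₀ := t)
    hq0 (Nat.cast_pos.2 hO) (by positivity) (by positivity) h3 (by
      refine le_trans ?_ h1
      refine sub_le_sub_right ?_ 1
      have h5 : q / (q * l) = 1 / l := by field_simp
      rw [h5]
      have h6 : 1 + 1 / l ≤ Real.exp (1 / l) := by linarith [Real.add_one_le_exp (1 / l)]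
      refine (pow_le_pow_left₀ (by positivity) h6 t).trans ?_
      rw [← Real.exp_nat_mul, Real.exp_le_exp, mul_one_div, div_le_div_iff₀ hl0 (by linarith)]
      nlinarith) n O T hS hcard π (by
      refine le_trans ?_ hπ
      have h5 : 64 * q * ((Nat.log 2 n : ℝ) + 1) ≤ 64 * q * (3 * l) := by gcongr
      have h6 : 200 * K * l / (n : ℝ) ^ (m - 1) = 200 * q * l := by rw [hq]; ring
      rw [h6]
      nlinarith [mul_pos hq0 hl0]) hπ1
  refine le_trans ?_ key
  have h7 : ((Nat.log 2 n : ℝ) + 1) * (2 * (1 / 2) ^ t) ≤ η / 2 := by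
    refine le_trans ?_ h2
    calc ((Nat.log 2 n : ℝ) + 1) * (2 * (1 / 2) ^ t)
        ≤ (3 * (t : ℝ) ^ 2) * (2 * (1 / 2) ^ t) := by gcongr; linarith
      _ = _ := by ring
  have h8 : (O.card : ℝ) / O.card = 1 := div_self (Nat.cast_pos.2 hO).ne'
  rw [h8]
  linarith
end

section
variable {α β : Type*} [Fintype α] [DecidableEq α] [Fintype β] [DecidableEq β]

lemma wt_disjSum (P : α ⊕ β → ℝ) (S : Finset α) (H : Finset β) :
    wt P (S.disjSum H) = wt (fun a => P (Sum.inl a)) S * wt (fun b => P (Sum.inr b)) H := by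
  rw [wt, Fintype.prod_sum_type]
  simp [wt]

lemma ev_disjSum (P : α ⊕ β → ℝ) (f : Finset (α ⊕ β) → ℝ) :
    ev P f = ev (fun a => P (Sum.inl a)) fun S => ev (fun b => P (Sum.inr b)) fun H =>
      f (S.disjSum H) := by
  simp only [ev, Finset.mul_sum]
  rw [← Fintype.sum_prod_type']
  refine Fintype.sum_equiv Finset.sumEquiv.toEquiv _ _ fun W => ?_
  obtain ⟨⟨S, H⟩, rfl⟩ := Finset.sumEquiv.symm.surjective W
  simp [wt_disjSum, mul_assoc]

lemma sum_wtErase_sign (p : α → ℝ) (i : α) (f : Finset α → ℝ) :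
    ∑ S, wtErase p i S * (if i ∈ S then 1 else -1) * f S =
      ev p fun S => f (insert i S) - f (S.erase i) := by
  rw [ev_eq_sum p i, sum_split i]
  refine Finset.sum_congr rfl fun S hS => ?_
  have hS' : i ∉ S := by simpa using hS
  simp only [wtErase_insert, Finset.mem_insert_self, if_true, hS', if_false,
    Finset.insert_idem, Finset.erase_insert hS', Finset.erase_eq_of_notMem hS']
  ring

/-- Derivative of an expectation in terms of discrete derivatives. -/
lemma hasDerivAt_ev {P : ℝ → α → ℝ} {P' : α → ℝ} {s : ℝ}
    (h : ∀ i, HasDerivAt (fun s => P s i) (P' i) s) (f : Finset α → ℝ) :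
    HasDerivAt (fun s => ev (P s) f)
      (∑ i, P' i * ev (P s) fun S => f (insert i S) - f (S.erase i)) s := by
  have h1 : ∀ S ∈ (Finset.univ : Finset (Finset α)), HasDerivAt (fun s => wt (P s) S * f S)
      ((∑ i, (∏ j ∈ Finset.univ.erase i, if j ∈ S then P s j else 1 - P s j) •
        (if i ∈ S then P' i else -P' i)) * f S) s := by
    intro S _
    refine HasDerivAt.mul_const ?_ _
    refine HasDerivAt.fun_finsetProd fun i _ => ?_
    split_ifs with hi
    · exact h i
    · exact (h i).const_sub 1
  refine (HasDerivAt.fun_sum h1).congr_deriv ?_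
  simp only [smul_eq_mul, Finset.sum_mul]
  rw [Finset.sum_comm]
  refine Finset.sum_congr rfl fun i _ => ?_
  rw [← sum_wtErase_sign, Finset.mul_sum]
  refine Finset.sum_congr rfl fun S _ => ?_
  rw [wtErase]
  split_ifs <;> ring

/-- Weighted count of the members of a family of sets that are contained in `W`. -/
noncomputable def containedWeight {ι : Type*} (I : Finset ι) (w : ι → ℝ) (A : ι → Finset α)
    (W : Finset α) : ℝ :=
  ∑ a ∈ I, if A a ⊆ W then w a else 0

/-- Moment bound for a weighted subset count above the threshold `τ`. -/
lemma ev_pow_containedWeight_le {ι : Type*} {I : Finset ι} {w : ι → ℝ} {A : ι → Finset α}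
    {p : α → ℝ} (h0 : ∀ i, 0 ≤ p i) (h1 : ∀ i, p i ≤ 1) (hw : ∀ a, 0 ≤ w a) {r Z : ℕ}
    (hA : ∀ a ∈ I, (A a).card ≤ r) {τ l : ℝ} (hl : 0 ≤ l)
    (hin : ∀ U : Finset α, U.card ≤ Z → ∑ a ∈ I with A a ⊆ U, w a ≤ τ / 2)
    (hout : ∀ U : Finset α, U.card ≤ Z →
      ∑ a ∈ I with ¬ A a ⊆ U, w a * ∏ i ∈ A a \ U, p i ≤ l) (M : ℕ) :
    ∀ U : Finset α, U.card + r * M ≤ Z →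
      ev p (fun W => if U ⊆ W ∧ τ < containedWeight I w A W then
        containedWeight I w A W ^ M else 0) ≤ (2 * l) ^ M * ∏ i ∈ U, p i := by
  have hD : ∀ W, 0 ≤ containedWeight I w A W := fun W => Finset.sum_nonneg fun a _ => by
    split_ifs; exacts [hw a, le_rfl]
  induction M with
  | zero =>
    intro U _
    rw [pow_zero, one_mul, ← ev_ind_subset]
    refine ev_mono h0 h1 fun W => ?_
    by_cases hU : U ⊆ W <;> simp only [hU, true_and, false_and, if_true, if_false, pow_zero, le_refl]
    split_ifs <;> norm_num
  | succ M ih =>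
    intro U hU
    have hUZ : U.card ≤ Z := by omega
    have hp0 : 0 ≤ ∏ i ∈ U, p i := Finset.prod_nonneg fun i _ => h0 i
    have step : ∀ W, (if U ⊆ W ∧ τ < containedWeight I w A W then
        containedWeight I w A W ^ (M + 1) else 0) ≤
        ∑ a ∈ I with ¬ A a ⊆ U, 2 * w a * (if U ∪ A a ⊆ W ∧ τ < containedWeight I w A W then
        containedWeight I w A W ^ M else 0) := by
      intro W
      by_cases hc : U ⊆ W ∧ τ < containedWeight I w A W
      · rw [if_pos hc]
        have e1 : containedWeight I w A W ≤ ∑ a ∈ I with A a ⊆ U, w a +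
            ∑ a ∈ I with ¬ A a ⊆ U, (if A a ⊆ W then w a else 0) := by
          rw [containedWeight, ← Finset.sum_filter_add_sum_filter_not I (fun a => A a ⊆ U)]
          refine add_le_add (Finset.sum_le_sum fun a _ => ?_) le_rfl
          split_ifs; exacts [le_rfl, hw a]
        have e2 := hin U hUZ
        have e3 : containedWeight I w A W ≤
            2 * ∑ a ∈ I with ¬ A a ⊆ U, (if A a ⊆ W then w a else 0) := by linarith [hc.2]
        rw [pow_succ']
        refine (mul_le_mul_of_nonneg_right e3 (pow_nonneg (hD W) M)).trans (le_of_eq ?_)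
        rw [Finset.mul_sum, Finset.sum_mul]
        refine Finset.sum_congr rfl fun a _ => ?_
        by_cases ha : A a ⊆ W
        · rw [if_pos ha, if_pos ⟨Finset.union_subset hc.1 ha, hc.2⟩]
        · rw [if_neg ha, if_neg fun h => ha (Finset.union_subset_right h.1)]; ring
      · rw [if_neg hc]
        refine Finset.sum_nonneg fun a _ => mul_nonneg (by linarith [hw a]) ?_
        split_ifs; exacts [pow_nonneg (hD W) M, le_rfl]
    refine (ev_mono h0 h1 step).trans ?_
    rw [ev_sum]
    have e4 : ∀ a ∈ I.filter (fun a => ¬ A a ⊆ U), ev p (fun W => 2 * w a *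
        (if U ∪ A a ⊆ W ∧ τ < containedWeight I w A W then containedWeight I w A W ^ M else 0)) ≤
        2 * (2 * l) ^ M * (∏ i ∈ U, p i) * (w a * ∏ i ∈ A a \ U, p i) := by
      intro a ha
      have haI := (Finset.mem_filter.1 ha).1
      rw [ev_mul_left]
      have e5 := ih (U ∪ A a) (by
        have := Finset.card_union_le U (A a)
        have := hA a haI
        rw [mul_add, mul_one] at hU
        omega)
      have e6 : ∏ i ∈ U ∪ A a, p i = (∏ i ∈ U, p i) * ∏ i ∈ A a \ U, p i := by
        rw [← Finset.union_sdiff_self_eq_union, Finset.prod_union Finset.disjoint_sdiff]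
      rw [e6] at e5
      refine (mul_le_mul_of_nonneg_left e5 (by linarith [hw a])).trans (le_of_eq (by ring))
    refine (Finset.sum_le_sum e4).trans ?_
    rw [← Finset.mul_sum]
    refine (mul_le_mul_of_nonneg_left (hout U hUZ) (by positivity)).trans (le_of_eq (by ring))

/-- First moment of a weighted subset count above its threshold. -/
lemma ev_containedWeight_tail_le {ι : Type*} {I : Finset ι} {w : ι → ℝ} {A : ι → Finset α}
    {p : α → ℝ} (h0 : ∀ i, 0 ≤ p i) (h1 : ∀ i, p i ≤ 1) (hw : ∀ a, 0 ≤ w a) {r M : ℕ}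
    (hA : ∀ a ∈ I, (A a).card ≤ r) {τ l : ℝ} (hτ : 0 < τ) (hl : 0 ≤ l)
    (hin : ∀ U : Finset α, U.card ≤ r * (M + 1) → ∑ a ∈ I with A a ⊆ U, w a ≤ τ / 2)
    (hout : ∀ U : Finset α, U.card ≤ r * (M + 1) →
      ∑ a ∈ I with ¬ A a ⊆ U, w a * ∏ i ∈ A a \ U, p i ≤ l) :
    ev p (fun W => if τ < containedWeight I w A W then containedWeight I w A W else 0) ≤
      τ * (2 * l / τ) ^ (M + 1) := by
  have key := ev_pow_containedWeight_le h0 h1 hw hA hl hin hout (M + 1) ∅ (by simp)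
  simp only [Finset.empty_subset, true_and, Finset.prod_empty, mul_one] at key
  have h2 : ∀ W, (if τ < containedWeight I w A W then containedWeight I w A W else 0) ≤
      (τ ^ M)⁻¹ * (if τ < containedWeight I w A W then containedWeight I w A W ^ (M + 1) else 0) := by
    intro W
    split_ifs with h
    · rw [pow_succ, ← mul_assoc]
      refine le_mul_of_one_le_left (hτ.trans h).le ?_
      rw [← inv_pow, ← mul_pow]
      refine one_le_pow₀ ?_
      rw [inv_mul_eq_div, one_le_div hτ]
      exact h.le
    · simp
  refine (ev_mono h0 h1 h2).trans ?_
  rw [ev_mul_left]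
  refine (mul_le_mul_of_nonneg_left key (by positivity)).trans (le_of_eq ?_)
  rw [div_pow, pow_succ τ M]
  field_simp
end

section
variable {α Φ : Type*} [Fintype α] [DecidableEq α] [Fintype Φ] [DecidableEq Φ]

lemma ev_union_sub_le {P : α → ℝ} (h0 : ∀ i, 0 ≤ P i) (h1 : ∀ i, P i ≤ 1) {f : Finset α → ℝ}
    (hf : Monotone f) {c i : α} {A : Finset α} {q : ℝ} (hq : 0 < q) (hq1 : q ≤ 1)
    (hqA : ∀ a ∈ A, q ≤ P a) {j : ℕ} (hj : A.card ≤ j) (hc : P c ≤ 1 / 2) :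
    ev P (fun W => f (W.erase c ∪ insert i A) - f (W.erase c ∪ A)) ≤
      2 * (q⁻¹ ^ j * ev P fun W => if A ⊆ W then f (insert i W) - f (W.erase i) else 0) := by
  set k : Finset α → ℝ := fun W => f (insert i (W ∪ A)) - f ((W ∪ A).erase i) with hk
  have hk0 : ∀ W, 0 ≤ k W := fun W => sub_nonneg.2 <|
    hf ((Finset.erase_subset _ _).trans (Finset.subset_insert _ _))
  have e1 : ev P (fun W => f (W.erase c ∪ insert i A) - f (W.erase c ∪ A)) ≤
      ev P fun W => k (W.erase c) := by
    refine ev_mono h0 h1 fun W => ?_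
    rw [hk, Finset.union_insert]
    exact sub_le_sub_left (hf (Finset.erase_subset _ _)) _
  have e2 : ev P (fun W => k (W.erase c)) ≤ 2 * ev P k := by
    have := ev_split P c k
    have n1 : 0 ≤ ev P fun W => k (insert c W) := ev_nonneg h0 h1 fun W => hk0 _
    have n2 : 0 ≤ ev P fun W => k (W.erase c) := ev_nonneg h0 h1 fun W => hk0 _
    nlinarith [mul_nonneg (h0 c) n1]
  have e3 : ev P k ≤ q⁻¹ ^ j * ev P fun W => if A ⊆ W then f (insert i W) - f (W.erase i) else 0 := by
    rw [ev_subset P A (fun W => f (insert i W) - f (W.erase i)), ← mul_assoc]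
    refine le_mul_of_one_le_left (ev_nonneg h0 h1 hk0) ?_
    rw [inv_pow, inv_mul_eq_div, one_le_div (pow_pos hq j)]
    calc q ^ j ≤ q ^ A.card := pow_le_pow_of_le_one hq.le hq1 hj
      _ ≤ _ := by
        rw [← Finset.prod_const]
        exact Finset.prod_le_prod (fun _ _ => hq.le) hqA
  linarith

/-- The marginals along the interpolation between planted copies and random edges. -/
noncomputable def interp (Φ : Type*) (G : Finset α) (p π s : ℝ) : α ⊕ Φ → ℝ :=
  Sum.elim (fun e => if e ∈ G then p / 2 * (1 + s) else 0) fun _ => π * (1 - s)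

/-- The first `j` edges of the copy `φ`. -/
def initialEdges (E : Φ → ℕ → α) (φ : Φ) (j : ℕ) : Finset (α ⊕ Φ) :=
  (Finset.range j).image fun i => Sum.inl (E φ i)

/-- Weighted number of copies containing `e` whose edges before `e` all lie in `W`. -/
noncomputable def linkWeight (𝒞 : Finset Φ) (E : Φ → ℕ → α) (r : ℕ) (p π : ℝ) (e : α) :
    Finset (α ⊕ Φ) → ℝ :=
  containedWeight ((𝒞 ×ˢ Finset.range r).filter fun a => E a.1 a.2 = e)
    (fun a => π * (p / 2)⁻¹ ^ a.2) fun a => initialEdges E a.1 a.2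

variable {G : Finset α} {𝒞 : Finset Φ} {E : Φ → ℕ → α} {r : ℕ} {p π : ℝ} {f : Finset (α ⊕ Φ) → ℝ}

lemma interp_nonneg (hp : 0 ≤ p) (hπ : 0 ≤ π) {s : ℝ} (hs0 : 0 ≤ s) (hs1 : s ≤ 1)
    (i : α ⊕ Φ) : 0 ≤ interp Φ G p π s i := by
  rcases i with e | φ
  · simp only [interp, Sum.elim_inl]
    split_ifs
    · positivity
    · exact le_rfl
  · simp only [interp, Sum.elim_inr]
    exact mul_nonneg hπ (by linarith)

lemma interp_le_one (hp : 0 ≤ p) (hp1 : p ≤ 1) (hπ : 0 ≤ π) (hπ1 : π ≤ 1) {s : ℝ} (hs0 : 0 ≤ s)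
    (hs1 : s ≤ 1) (i : α ⊕ Φ) : interp Φ G p π s i ≤ 1 := by
  rcases i with e | φ
  · simp only [interp, Sum.elim_inl]
    split_ifs
    · nlinarith
    · exact zero_le_one
  · simp only [interp, Sum.elim_inr]
    nlinarith

lemma ev_planted_sub_le (hf : Monotone f) (hE : ∀ φ ∈ 𝒞, ∀ j < r, E φ j ∈ G)
    (hin : ∀ φ ∈ 𝒞, ∀ W, f (insert (Sum.inr φ) W) =
      f (W.erase (Sum.inr φ) ∪ initialEdges E φ r))
    (hp : 0 < p) (hp1 : p ≤ 1) (hπ : 0 ≤ π) (hπ1 : π ≤ 1 / 2) {s : ℝ} (hs0 : 0 ≤ s) (hs1 : s ≤ 1)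
    {φ : Φ} (hφ : φ ∈ 𝒞) :
    ev (interp Φ G p π s) (fun W => f (insert (Sum.inr φ) W) - f (W.erase (Sum.inr φ))) ≤
      ∑ j ∈ Finset.range r, 2 * ((p / 2)⁻¹ ^ j * ev (interp Φ G p π s) fun W =>
        if initialEdges E φ j ⊆ W then
          f (insert (Sum.inl (E φ j)) W) - f (W.erase (Sum.inl (E φ j))) else 0) := by
  have h0 := interp_nonneg (Φ := Φ) (G := G) hp.le hπ hs0 hs1
  have h1 := interp_le_one (Φ := Φ) (G := G) hp.le hp1 hπ (by linarith) hs0 hs1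
  have e1 : (fun W => f (insert (Sum.inr φ) W) - f (W.erase (Sum.inr φ))) = fun W =>
      ∑ j ∈ Finset.range r, (f (W.erase (Sum.inr φ) ∪ insert (Sum.inl (E φ j)) (initialEdges E φ j))
        - f (W.erase (Sum.inr φ) ∪ initialEdges E φ j)) := by
    ext W
    have e2 : ∀ j, insert (Sum.inl (E φ j)) (initialEdges E φ j) = initialEdges E φ (j + 1) := by
      intro j
      rw [initialEdges, initialEdges, Finset.range_add_one, Finset.image_insert]
    simp only [e2]
    rw [Finset.sum_range_sub (fun j => f (W.erase (Sum.inr φ) ∪ initialEdges E φ j)), hin φ hφ]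
    simp [initialEdges]
  rw [e1, ev_sum]
  refine Finset.sum_le_sum fun j hj => ?_
  have hj' := Finset.mem_range.1 hj
  refine ev_union_sub_le h0 h1 hf (by positivity) (by linarith) (fun a ha => ?_)
    (Finset.card_image_le.trans (Finset.card_range j).le) ?_
  · obtain ⟨i, hi, rfl⟩ := Finset.mem_image.1 ha
    have := hE φ hφ i ((Finset.mem_range.1 hi).trans hj')
    simp only [interp, Sum.elim_inl, this, if_true]
    nlinarith
  · simp only [interp, Sum.elim_inr]
    nlinarith

lemma sum_planted_le (hf : Monotone f) (hE : ∀ φ ∈ 𝒞, ∀ j < r, E φ j ∈ G)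
    (hin : ∀ φ ∈ 𝒞, ∀ W, f (insert (Sum.inr φ) W) =
      f (W.erase (Sum.inr φ) ∪ initialEdges E φ r))
    (hout : ∀ φ ∉ 𝒞, ∀ W, f (insert (Sum.inr φ) W) = f (W.erase (Sum.inr φ)))
    (hp : 0 < p) (hp1 : p ≤ 1) (hπ : 0 ≤ π) (hπ1 : π ≤ 1 / 2) {s : ℝ} (hs0 : 0 ≤ s) (hs1 : s ≤ 1) :
    ∑ φ, π * ev (interp Φ G p π s)
        (fun W => f (insert (Sum.inr φ) W) - f (W.erase (Sum.inr φ))) ≤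
      ∑ e ∈ G, ev (interp Φ G p π s) fun W => 2 * (linkWeight 𝒞 E r p π e W *
          (f (insert (Sum.inl e) W) - f (W.erase (Sum.inl e)))) := by
  have e0 : ∑ φ, π * ev (interp Φ G p π s)
        (fun W => f (insert (Sum.inr φ) W) - f (W.erase (Sum.inr φ))) =
      ∑ φ ∈ 𝒞, π * ev (interp Φ G p π s)
        (fun W => f (insert (Sum.inr φ) W) - f (W.erase (Sum.inr φ))) := by
    refine (Finset.sum_subset (Finset.subset_univ _) fun φ _ hφ => ?_).symm
    simp only [hout φ hφ, sub_self, ev_const, mul_zero]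
  rw [e0]
  refine (Finset.sum_le_sum fun φ hφ => mul_le_mul_of_nonneg_left
    (ev_planted_sub_le hf hE hin hp hp1 hπ hπ1 hs0 hs1 hφ) hπ).trans (le_of_eq ?_)
  simp only [Finset.mul_sum]
  rw [← Finset.sum_product', ← Finset.sum_fiberwise_of_maps_to (t := G)
    (g := fun a : Φ × ℕ => E a.1 a.2) (fun a ha => hE a.1 (Finset.mem_product.1 ha).1 a.2
      (Finset.mem_range.1 (Finset.mem_product.1 ha).2))]
  refine Finset.sum_congr rfl fun e _ => ?_
  simp only [linkWeight, containedWeight, Finset.sum_mul, Finset.mul_sum]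
  rw [ev_sum]
  refine Finset.sum_congr rfl fun a ha => ?_
  rw [(Finset.mem_filter.1 ha).2, ← ev_mul_left, ← ev_mul_left, ← ev_mul_left]
  congr 1
  ext W
  split_ifs <;> ring

/-- Planted copies may be replaced by random edges at small cost. -/
lemma ev_interp_le (hf : Monotone f) (hf0 : ∀ W, 0 ≤ f W) (hf1 : ∀ W, f W ≤ 1)
    (hE : ∀ φ ∈ 𝒞, ∀ j < r, E φ j ∈ G)
    (hin : ∀ φ ∈ 𝒞, ∀ W, f (insert (Sum.inr φ) W) =
      f (W.erase (Sum.inr φ) ∪ initialEdges E φ r))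
    (hout : ∀ φ ∉ 𝒞, ∀ W, f (insert (Sum.inr φ) W) = f (W.erase (Sum.inr φ)))
    (hp : 0 < p) (hp1 : p ≤ 1) (hπ : 0 ≤ π) (hπ1 : π ≤ 1 / 2) {η : ℝ}
    (hη : ∀ s, 0 ≤ s → s ≤ 1 → ∀ e ∈ G, ev (interp Φ G p π s) (fun W =>
      if p / 4 < linkWeight 𝒞 E r p π e W then linkWeight 𝒞 E r p π e W else 0) ≤ η) :
    ev (interp Φ G p π 0) f - 2 * G.card * η ≤ ev (interp Φ G p π 1) f := by
  have hd : ∀ s, HasDerivAt (fun s => ev (interp Φ G p π s) f) (∑ i : α ⊕ Φ,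
      Sum.elim (fun e => if e ∈ G then p / 2 else 0) (fun _ => -π) i *
      ev (interp Φ G p π s) fun S => f (insert i S) - f (S.erase i)) s := by
    intro s
    refine hasDerivAt_ev (fun i => ?_) f
    rcases i with e | φ
    · simp only [interp, Sum.elim_inl]
      split_ifs
      · simpa using ((hasDerivAt_id s).const_add 1).const_mul (p / 2)
      · exact hasDerivAt_const _ _
    · simp only [interp, Sum.elim_inr]
      simpa using ((hasDerivAt_id s).const_sub 1).const_mul π
  obtain ⟨s, hs, hs'⟩ := exists_hasDerivAt_eq_slope (fun s => ev (interp Φ G p π s) f) _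
    zero_lt_one (fun s _ => (hd s).continuousAt.continuousWithinAt) (fun s _ => hd s)
  have hs0 := hs.1.le
  have hs1 := hs.2.le
  have h0 := interp_nonneg (Φ := Φ) (G := G) hp.le hπ hs0 hs1
  have h1 := interp_le_one (Φ := Φ) (G := G) hp.le hp1 hπ (by linarith) hs0 hs1
  have h2 := sum_planted_le hf hE hin hout hp hp1 hπ hπ1 hs0 hs1
  rw [Fintype.sum_sum_type] at hs'
  simp only [Sum.elim_inl, Sum.elim_inr, ite_mul, zero_mul, neg_mul, Finset.sum_neg_distrib,
    Finset.sum_ite_mem, Finset.univ_inter, sub_zero, div_one] at hs'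
  have hL : ∀ e W, 0 ≤ linkWeight 𝒞 E r p π e W := fun e W => Finset.sum_nonneg fun a _ => by
    dsimp only
    split_ifs
    · positivity
    · exact le_rfl
  have h3 : ∑ e ∈ G, ev (interp Φ G p π s) (fun W => 2 * (linkWeight 𝒞 E r p π e W *
      (f (insert (Sum.inl e) W) - f (W.erase (Sum.inl e))))) ≤ ∑ e ∈ G, (p / 2 *
      ev (interp Φ G p π s) (fun W => f (insert (Sum.inl e) W) - f (W.erase (Sum.inl e))) +
        2 * η) := by
    refine Finset.sum_le_sum fun e he => ?_
    refine le_trans ?_ (add_le_add le_rfl (mul_le_mul_of_nonneg_left (hη s hs0 hs1 e he)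
      zero_le_two))
    rw [← ev_mul_left, ← ev_mul_left, ← ev_add]
    refine ev_mono h0 h1 fun W => ?_
    have a1 : 0 ≤ f (insert (Sum.inl e) W) - f (W.erase (Sum.inl e)) := sub_nonneg.2 <|
      hf ((Finset.erase_subset _ _).trans (Finset.subset_insert _ _))
    have a2 : f (insert (Sum.inl e) W) - f (W.erase (Sum.inl e)) ≤ 1 := by
      linarith [hf1 (insert (Sum.inl e) W), hf0 (W.erase (Sum.inl e))]
    have a3 := hL e W
    split_ifs with hc
    · nlinarith [mul_le_of_le_one_right a3 a2, mul_nonneg hp.le a1]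
    · push Not at hc
      nlinarith [mul_le_mul_of_nonneg_right hc a1]
  rw [Finset.sum_add_distrib, ← Finset.mul_sum, Finset.sum_const, nsmul_eq_mul] at h3
  rw [← Finset.mul_sum] at hs'
  linarith
end

section
variable {m n r k : ℕ}

lemma card_mapsTo_le (V : Finset (Fin m)) (Z : Finset (Fin n)) {z : ℕ} (hz : Z.card ≤ z)
    (hz1 : 1 ≤ z) :
    (Finset.univ.filter fun φ : Fin m → Fin n => V.image φ ⊆ Z).card ≤
      z ^ m * n ^ (m - V.card) := by
  have h1 : (Finset.univ.filter fun φ : Fin m → Fin n => V.image φ ⊆ Z) ⊆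
      Fintype.piFinset fun i => if i ∈ V then Z else Finset.univ := by
    intro φ hφ
    rw [Fintype.mem_piFinset]
    intro i
    split_ifs with hi
    · exact (Finset.mem_filter.1 hφ).2 (Finset.mem_image_of_mem φ hi)
    · exact Finset.mem_univ _
  refine (Finset.card_le_card h1).trans ?_
  rw [Fintype.card_piFinset]
  have h2 : ∀ i : Fin m, (if i ∈ V then Z else Finset.univ).card =
      if i ∈ V then Z.card else n := by
    intro i; split_ifs <;> simp
  simp only [h2]
  rw [Finset.prod_ite, Finset.prod_const, Finset.prod_const]
  have h3 : (Finset.univ.filter fun i => i ∈ V).card = V.card := by simp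
  have h4 : (Finset.univ.filter fun i => i ∉ V).card = m - V.card := by
    rw [Finset.filter_not, Finset.card_sdiff_of_subset (Finset.filter_subset _ _), h3]; simp
  rw [h3, h4]
  refine Nat.mul_le_mul_right _ ((Nat.pow_le_pow_left hz _).trans
    (Nat.pow_le_pow_right hz1 ((Finset.card_le_univ V).trans (by simp))))

/-- The image of the `j`-th listed edge under `φ`. -/
def edgeImage (fe : ℕ → Finset (Fin m)) (φ : Fin m → Fin n) (j : ℕ) : Finset (Fin n) :=
  (fe j).image φ

variable {fe : ℕ → Finset (Fin m)} {𝒞 : Finset (Fin m → Fin n)} {e : Finset (Fin n)}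
  {G : Finset (Finset (Fin n))} {p c : ℝ}

/-- The indices `i < j` whose edge image under `φ` lies in `U`. -/
def revealed (fe : ℕ → Finset (Fin m)) (U : Finset (Finset (Fin n) ⊕ (Fin m → Fin n)))
    (a : (Fin m → Fin n) × ℕ) : Finset ℕ :=
  (Finset.range a.2).filter fun i => Sum.inl (edgeImage fe a.1 i) ∈ U

lemma card_revealed_fiber_le (hfe : ∀ i < r, (fe i).card ≤ k) (he : e.card ≤ k)
    (U : Finset (Finset (Fin n) ⊕ (Fin m → Fin n))) {z : ℕ} (hz : k * (U.card + 1) ≤ z)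
    (hz1 : 1 ≤ z) {I : Finset ((Fin m → Fin n) × ℕ)}
    (hI : I ⊆ (𝒞 ×ˢ Finset.range r).filter fun a => edgeImage fe a.1 a.2 = e) (b : ℕ × Finset ℕ) :
    (I.filter fun a => (a.2, revealed fe U a) = b).card ≤
      z ^ m * n ^ (m - ((insert b.1 b.2).biUnion fe).card) := by
  set Z : Finset (Fin n) := e ∪ (U.toLeft.filter fun g => g.card ≤ k).biUnion id with hZ
  have hZc : Z.card ≤ z := by
    refine (Finset.card_union_le _ _).trans ?_
    have h1 : ((U.toLeft.filter fun g => g.card ≤ k).biUnion id).card ≤ U.card * k := by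
      refine (Finset.card_biUnion_le_card_mul _ _ k fun g hg => (Finset.mem_filter.1 hg).2).trans ?_
      exact Nat.mul_le_mul_right _ ((Finset.card_filter_le _ _).trans Finset.card_toLeft_le)
    nlinarith
  refine le_trans ?_ (card_mapsTo_le ((insert b.1 b.2).biUnion fe) Z hZc hz1)
  refine Finset.card_le_card_of_injOn Prod.fst (fun a ha => ?_) ?_
  · obtain ⟨haI, hab⟩ := Finset.mem_filter.1 ha
    obtain ⟨haP, hae⟩ := Finset.mem_filter.1 (hI haI)
    have har := Finset.mem_range.1 (Finset.mem_product.1 haP).2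
    refine Finset.mem_coe.2 (Finset.mem_filter.2 ⟨Finset.mem_univ _, fun x hx => ?_⟩)
    obtain ⟨v, hv, rfl⟩ := Finset.mem_image.1 hx
    obtain ⟨i, hi, hvi⟩ := Finset.mem_biUnion.1 hv
    subst hab
    rcases Finset.mem_insert.1 hi with rfl | hi
    · refine Finset.mem_union_left _ ?_
      rw [← hae]
      exact Finset.mem_image_of_mem _ hvi
    · obtain ⟨hij, hiU⟩ := Finset.mem_filter.1 hi
      refine Finset.mem_union_right _ (Finset.mem_biUnion.2 ⟨edgeImage fe a.1 i,
        Finset.mem_filter.2 ⟨Finset.mem_toLeft.2 hiU, ?_⟩, Finset.mem_image_of_mem _ hvi⟩)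
      exact Finset.card_image_le.trans (hfe i ((Finset.mem_range.1 hij).trans har))
  · rintro ⟨φ, j⟩ ha ⟨ψ, j'⟩ ha' (rfl : φ = ψ)
    have h1 := (Finset.mem_filter.1 (Finset.mem_coe.1 ha)).2
    have h2 := (Finset.mem_filter.1 (Finset.mem_coe.1 ha')).2
    have : j = j' := (congrArg Prod.fst h1).trans (congrArg Prod.fst h2).symm
    rw [this]

lemma link_term_le (hinj : ∀ i < r, ∀ j < r, fe i = fe j → i = j)
    (h𝒞 : ∀ φ ∈ 𝒞, Function.Injective φ) (hp : 0 < p) (hc : 0 ≤ c)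
    {P : Finset (Fin n) ⊕ (Fin m → Fin n) → ℝ} (hP0 : ∀ i, 0 ≤ P i)
    (hP : ∀ g, P (Sum.inl g) ≤ p) (U : Finset (Finset (Fin n) ⊕ (Fin m → Fin n)))
    {a : (Fin m → Fin n) × ℕ} (ha : a ∈ 𝒞 ×ˢ Finset.range r) :
    c * p ^ r * (p / 2)⁻¹ ^ a.2 * ∏ i ∈ initialEdges (edgeImage fe) a.1 a.2 \ U, P i ≤
      2 ^ r * c * p * p ^ (r - 1 - (revealed fe U a).card) := by
  obtain ⟨φ, j⟩ := a
  obtain ⟨hφ, hj⟩ := Finset.mem_product.1 ha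
  replace hj : j < r := Finset.mem_range.1 hj
  dsimp only at hφ ⊢
  set B := revealed fe U (φ, j) with hB
  have hBj : B.card ≤ j := (Finset.card_filter_le _ _).trans (Finset.card_range j).le
  have hBs : B ⊆ Finset.range j := Finset.filter_subset _ _
  have h1 : (initialEdges (edgeImage fe) φ j \ U : Finset (Finset (Fin n) ⊕ (Fin m → Fin n))) =
      (Finset.range j \ B).image fun i => Sum.inl (edgeImage fe φ i) := by
    ext x
    simp only [initialEdges, Finset.mem_sdiff, Finset.mem_image, hB, revealed, Finset.mem_filter]
    constructor
    · rintro ⟨⟨i, hi, rfl⟩, hx⟩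
      exact ⟨i, ⟨hi, fun h => hx h.2⟩, rfl⟩
    · rintro ⟨i, ⟨hi, hi'⟩, rfl⟩
      exact ⟨⟨i, hi, rfl⟩, fun h => hi' ⟨hi, h⟩⟩
  have h2 : (initialEdges (edgeImage fe) φ j \ U :
      Finset (Finset (Fin n) ⊕ (Fin m → Fin n))).card = j - B.card := by
    rw [h1, Finset.card_image_of_injOn, Finset.card_sdiff_of_subset hBs, Finset.card_range]
    intro i hi i' hi' h
    have hir := (Finset.mem_range.1 (Finset.mem_sdiff.1 (Finset.mem_coe.1 hi)).1).trans hj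
    have hir' := (Finset.mem_range.1 (Finset.mem_sdiff.1 (Finset.mem_coe.1 hi')).1).trans hj
    exact hinj i hir i' hir' (Finset.image_injective (h𝒞 φ hφ) (Sum.inl_injective h))
  have h3 : ∏ i ∈ initialEdges (edgeImage fe) φ j \ U, P i ≤ p ^ (j - B.card) := by
    rw [← h2, ← Finset.prod_const]
    refine Finset.prod_le_prod (fun i _ => hP0 i) fun i hi => ?_
    rw [h1] at hi
    obtain ⟨l, _, rfl⟩ := Finset.mem_image.1 hi
    exact hP _
  calc _ ≤ c * p ^ r * (p / 2)⁻¹ ^ j * p ^ (j - B.card) :=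
        mul_le_mul_of_nonneg_left h3 (by positivity)
    _ = 2 ^ j * (c * p * p ^ (r - 1 - B.card)) := by
        have e1 : p ^ r * p ^ (j - B.card) = p * p ^ (r - 1 - B.card) * p ^ j := by
          rw [← pow_add, ← pow_succ', ← pow_add]
          congr 1
          omega
        have e2 : (p / 2)⁻¹ ^ j * p ^ j = 2 ^ j := by
          rw [← mul_pow]
          congr 1
          field_simp
        linear_combination c * (p / 2)⁻¹ ^ j * e1 + c * p * p ^ (r - 1 - B.card) * e2
    _ ≤ 2 ^ r * (c * p * p ^ (r - 1 - B.card)) :=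
        mul_le_mul_of_nonneg_right (pow_le_pow_right₀ one_le_two hj.le) (by positivity)
    _ = _ := by ring

lemma sum_link_le (hinj : ∀ i < r, ∀ j < r, fe i = fe j → i = j)
    (hfe : ∀ i < r, (fe i).card ≤ k) (he : e.card ≤ k)
    (h𝒞 : ∀ φ ∈ 𝒞, Function.Injective φ) (hp : 0 < p) (hc : 0 ≤ c)
    {P : Finset (Fin n) ⊕ (Fin m → Fin n) → ℝ} (hP0 : ∀ i, 0 ≤ P i)
    (hP : ∀ g, P (Sum.inl g) ≤ p) (U : Finset (Finset (Fin n) ⊕ (Fin m → Fin n)))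
    {z : ℕ} (hz : k * (U.card + 1) ≤ z) (hz1 : 1 ≤ z) {I : Finset ((Fin m → Fin n) × ℕ)}
    (hI : I ⊆ (𝒞 ×ˢ Finset.range r).filter fun a => edgeImage fe a.1 a.2 = e)
    {x : ℝ} (hx0 : 0 ≤ x) (hx : ∀ a ∈ I, p ^ (r - 1 - (revealed fe U a).card) *
      (n : ℝ) ^ (m - ((insert a.2 (revealed fe U a)).biUnion fe).card) ≤ x) :
    ∑ a ∈ I, c * p ^ r * (p / 2)⁻¹ ^ a.2 *
      ∏ i ∈ initialEdges (edgeImage fe) a.1 a.2 \ U, P i ≤ r * 4 ^ r * z ^ m * c * p * x := by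
  have hmaps : ∀ a ∈ I, (a.2, revealed fe U a) ∈ Finset.range r ×ˢ (Finset.range r).powerset := by
    intro a ha
    have har := (Finset.mem_product.1 (Finset.mem_filter.1 (hI ha)).1).2
    refine Finset.mem_product.2 ⟨har, Finset.mem_powerset.2 ((Finset.filter_subset _ _).trans ?_)⟩
    exact Finset.range_subset_range.2 (Finset.mem_range.1 har).le
  rw [← Finset.sum_fiberwise_of_maps_to hmaps]
  have hfib : ∀ b ∈ Finset.range r ×ˢ (Finset.range r).powerset,
      ∑ a ∈ I with (a.2, revealed fe U a) = b, c * p ^ r * (p / 2)⁻¹ ^ a.2 *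
        ∏ i ∈ initialEdges (edgeImage fe) a.1 a.2 \ U, P i ≤ 2 ^ r * z ^ m * c * p * x := by
    intro b _
    rcases (I.filter fun a => (a.2, revealed fe U a) = b).eq_empty_or_nonempty with h | ⟨a₀, h₀⟩
    · rw [h, Finset.sum_empty]; positivity
    obtain ⟨ha₀, hb⟩ := Finset.mem_filter.1 h₀
    have h1 := hx a₀ ha₀
    have h2 := card_revealed_fiber_le hfe he U hz hz1 hI b
    refine (Finset.sum_le_card_nsmul _ _ (2 ^ r * c * p * p ^ (r - 1 - b.2.card))
      fun a ha => ?_).trans ?_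
    · obtain ⟨haI, hab⟩ := Finset.mem_filter.1 ha
      rw [← hab]
      exact link_term_le hinj h𝒞 hp hc hP0 hP U (Finset.mem_filter.1 (hI haI)).1
    · rw [nsmul_eq_mul]
      have h3 : (((I.filter fun a => (a.2, revealed fe U a) = b).card : ℕ) : ℝ) ≤
          z ^ m * n ^ (m - ((insert b.1 b.2).biUnion fe).card) := by exact_mod_cast h2
      refine (mul_le_mul_of_nonneg_right h3 (by positivity)).trans ?_
      rw [← hb] at *
      dsimp only
      calc _ = 2 ^ r * z ^ m * c * p * (p ^ (r - 1 - (revealed fe U a₀).card) *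
            (n : ℝ) ^ (m - ((insert a₀.2 (revealed fe U a₀)).biUnion fe).card)) := by ring
        _ ≤ _ := mul_le_mul_of_nonneg_left h1 (by positivity)
  refine (Finset.sum_le_card_nsmul _ _ _ hfib).trans (le_of_eq ?_)
  rw [Finset.card_product, Finset.card_powerset, Finset.card_range, nsmul_eq_mul]
  push_cast
  rw [show (4 : ℝ) = 2 * 2 by norm_num, mul_pow]
  ring
end

section
variable {m n r k : ℕ} {fe : ℕ → Finset (Fin m)} {𝒞 : Finset (Fin m → Fin n)}
  {e : Finset (Fin n)} {G : Finset (Finset (Fin n))} {p c : ℝ}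

lemma ev_linkWeight_tail_le (hinj : ∀ i < r, ∀ j < r, fe i = fe j → i = j)
    (hfe : ∀ i < r, (fe i).card ≤ k) (he : e.card ≤ k)
    (hfull : (Finset.range r).biUnion fe = Finset.univ)
    (h𝒞 : ∀ φ ∈ 𝒞, Function.Injective φ) (hp : 0 < p) (hp1 : p ≤ 1) (hc : 0 ≤ c) (hc1 : c ≤ 1)
    {M z : ℕ} (hz : k * (r * (M + 1) + 1) ≤ z) (hz1 : 1 ≤ z)
    (hcz : 8 * (r * 4 ^ r * z ^ m * c) ≤ 1) {x : ℝ} (hx0 : 0 ≤ x) (hx1 : x ≤ 1)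
    (hx : ∀ J ⊆ Finset.range r, J.Nonempty → J ≠ Finset.range r →
      p ^ (r - J.card) * (n : ℝ) ^ (m - (J.biUnion fe).card) ≤ x)
    {s : ℝ} (hs0 : 0 ≤ s) (hs1 : s ≤ 1) :
    ev (interp (Fin m → Fin n) G p (c * p ^ r) s) (fun W =>
      if p / 4 < linkWeight 𝒞 (edgeImage fe) r p (c * p ^ r) e W then
        linkWeight 𝒞 (edgeImage fe) r p (c * p ^ r) e W else 0) ≤ p / 4 * x ^ (M + 1) := by
  have hπ0 : 0 ≤ c * p ^ r := by positivity
  have hπ1 : c * p ^ r ≤ 1 := mul_le_one₀ hc1 (by positivity) (pow_le_one₀ hp.le hp1)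
  have h0 := interp_nonneg (Φ := Fin m → Fin n) (G := G) hp.le hπ0 hs0 hs1
  have h1 := interp_le_one (Φ := Fin m → Fin n) (G := G) hp.le hp1 hπ0 hπ1 hs0 hs1
  have hP : ∀ g, interp (Fin m → Fin n) G p (c * p ^ r) s (Sum.inl g) ≤ p := by
    intro g
    simp only [interp, Sum.elim_inl]
    split_ifs
    · nlinarith
    · exact hp.le
  have hcoef : r * 4 ^ r * z ^ m * c * p ≤ p / 8 := by
    have := mul_le_mul_of_nonneg_right hcz hp.le
    linarith
  set I := (𝒞 ×ˢ Finset.range r).filter fun a => edgeImage fe a.1 a.2 = e with hI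
  have hJ : ∀ a ∈ I, ∀ U : Finset (Finset (Fin n) ⊕ (Fin m → Fin n)),
      insert a.2 (revealed fe U a) ⊆ Finset.range r ∧
      (insert a.2 (revealed fe U a)).card = (revealed fe U a).card + 1 := by
    intro a ha U
    have har := (Finset.mem_product.1 (Finset.mem_filter.1 ha).1).2
    refine ⟨Finset.insert_subset har ((Finset.filter_subset _ _).trans
      (Finset.range_subset_range.2 (Finset.mem_range.1 har).le)), ?_⟩
    refine Finset.card_insert_of_notMem fun h => ?_
    simp [revealed] at h
  have hne : ∀ a ∈ I, ∀ U : Finset (Finset (Fin n) ⊕ (Fin m → Fin n)),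
      insert a.2 (revealed fe U a) ≠ Finset.range r →
      p ^ (r - 1 - (revealed fe U a).card) *
        (n : ℝ) ^ (m - ((insert a.2 (revealed fe U a)).biUnion fe).card) ≤ x := by
    intro a ha U hU
    have := hx _ (hJ a ha U).1 (Finset.insert_nonempty _ _) hU
    rw [(hJ a ha U).2, add_comm, Nat.sub_add_eq] at this
    exact this
  have key : p / 4 * (2 * (p / 8 * x) / (p / 4)) ^ (M + 1) = p / 4 * x ^ (M + 1) := by
    congr 2
    rw [div_eq_iff (by positivity)]
    ring
  rw [← key]
  have hcard : ∀ U : Finset (Finset (Fin n) ⊕ (Fin m → Fin n)), U.card ≤ r * (M + 1) →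
      k * (U.card + 1) ≤ z := fun U hU => le_trans (Nat.mul_le_mul_left _ (by omega)) hz
  refine ev_containedWeight_tail_le (r := r) h0 h1 (fun a => by positivity) (fun a ha => ?_)
    (by positivity) (by positivity) (fun U hU => ?_) (fun U hU => ?_)
  · have har := (Finset.mem_product.1 (Finset.mem_filter.1 ha).1).2
    exact Finset.card_image_le.trans ((Finset.card_range _).le.trans (Finset.mem_range.1 har).le)
  · have h2 := sum_link_le (P := interp (Fin m → Fin n) G p (c * p ^ r) s) hinj hfe he h𝒞 hp
      hc h0 hP U (hcard U hU) hz1 (I := I.filter fun a => initialEdges (edgeImage fe) a.1 a.2 ⊆ U)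
      (Finset.filter_subset _ _) zero_le_one (fun a ha => ?_)
    · refine le_trans (le_of_eq (Finset.sum_congr rfl fun a ha => ?_)) (h2.trans (by linarith))
      rw [Finset.sdiff_eq_empty_iff_subset.2 (Finset.mem_filter.1 ha).2, Finset.prod_empty, mul_one]
    · have haI := (Finset.mem_filter.1 ha).1
      by_cases hU : insert a.2 (revealed fe U a) = Finset.range r
      · have h3 := (hJ a haI U).2
        rw [hU, Finset.card_range] at h3
        rw [hU, hfull, Finset.card_univ, Fintype.card_fin, Nat.sub_self, pow_zero, mul_one]
        exact pow_le_one₀ hp.le hp1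
      · exact (hne a haI U hU).trans hx1
  · have h2 := sum_link_le (P := interp (Fin m → Fin n) G p (c * p ^ r) s) hinj hfe he h𝒞 hp
      hc h0 hP U (hcard U hU) hz1 (I := I.filter fun a => ¬ initialEdges (edgeImage fe) a.1 a.2 ⊆ U)
      (Finset.filter_subset _ _) hx0 (fun a ha => ?_)
    · exact h2.trans (mul_le_mul_of_nonneg_right hcoef hx0)
    · obtain ⟨haI, hna⟩ := Finset.mem_filter.1 ha
      refine hne a haI U fun hU => hna fun y hy => ?_
      obtain ⟨i, hi, rfl⟩ := Finset.mem_image.1 hy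
      have har := Finset.mem_range.1 (Finset.mem_product.1 (Finset.mem_filter.1 haI).1).2
      have hi' := Finset.mem_range.1 hi
      have : i ∈ insert a.2 (revealed fe U a) := hU ▸ Finset.mem_range.2 (hi'.trans har)
      rcases Finset.mem_insert.1 this with h | h
      · omega
      · exact (Finset.mem_filter.1 h).2

lemma exists_pos_forall_le {ι : Type*} {s : Finset ι} {g : ι → ℝ} (h : ∀ i ∈ s, 0 < g i) :
    ∃ δ, 0 < δ ∧ ∀ i ∈ s, δ ≤ g i := by
  rcases s.eq_empty_or_nonempty with rfl | hs
  · exact ⟨1, one_pos, by simp⟩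
  · obtain ⟨i, hi, h'⟩ := s.exists_min_image g hs
    exact ⟨g i, h i hi, h'⟩

/-- Strict balance gives polynomially few copies extending a proper part of `F`. -/
lemma exists_extension_exponent (hk : 2 ≤ k) {F : Finset (Finset (Fin m))} (hm : 2 ≤ m)
    (hbal : StrictlyOneBalanced m F) (hinj : ∀ i < r, ∀ j < r, fe i = fe j → i = j)
    (hfe : ∀ i < r, (fe i).card = k) (hF : (Finset.range r).image fe = F) :
    ∃ δ : ℝ, 0 < δ ∧ ∀ C L : ℝ, 1 ≤ C → 1 ≤ L → ∀ n : ℕ, 1 ≤ n → ∀ p : ℝ,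
      p = C * L ^ (1 / (r : ℝ)) * (n : ℝ) ^ (-((m : ℝ) - 1) / r) →
      ∀ J ⊆ Finset.range r, J.Nonempty → J ≠ Finset.range r →
      p ^ (r - J.card) * (n : ℝ) ^ (m - (J.biUnion fe).card) ≤ C ^ r * L * (n : ℝ) ^ (-δ) := by
  have hJ : ∀ J ∈ (Finset.range r).powerset.filter fun J => J.Nonempty ∧ J ≠ Finset.range r,
      0 < ((J.biUnion fe).card - 1 : ℝ) - J.card * ((m : ℝ) - 1) / r := by
    intro J hJ
    simp only [Finset.mem_filter, Finset.mem_powerset] at hJ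
    obtain ⟨hJr, hJn, hJne⟩ := hJ
    have hJc : ∀ K ⊆ Finset.range r, (K.image fe).card = K.card := fun K hK =>
      Finset.card_image_of_injOn fun i hi j hj h =>
        hinj i (Finset.mem_range.1 (hK hi)) j (Finset.mem_range.1 (hK hj)) h
    have hlt : J.card < r := by
      have := Finset.card_lt_card (Finset.ssubset_iff_subset_ne.2 ⟨hJr, hJne⟩)
      rwa [Finset.card_range] at this
    have hrF : F.card = r := by rw [← hF, hJc _ subset_rfl, Finset.card_range]
    have h1 := hbal (J.biUnion fe) (J.image fe) (hF ▸ Finset.image_subset_image hJr)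
      (fun e he => by
        obtain ⟨i, hi, rfl⟩ := Finset.mem_image.1 he
        exact Finset.subset_biUnion_of_mem fe hi) (hJn.image fe) (fun h => by
        have := congrArg Finset.card h.2
        rw [hJc J hJr, hrF] at this
        omega)
    rw [hJc J hJr, oneDensity, hrF] at h1
    obtain ⟨i, hi⟩ := hJn
    have h2 : k ≤ (J.biUnion fe).card := by
      rw [← hfe i (Finset.mem_range.1 (hJr hi))]
      exact Finset.card_le_card (Finset.subset_biUnion_of_mem fe hi)
    have h3 : (2 : ℝ) ≤ (J.biUnion fe).card := by exact_mod_cast hk.trans h2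
    have h4 : (2 : ℝ) ≤ m := by exact_mod_cast hm
    have h5 : (0 : ℝ) < r := by exact_mod_cast (Nat.zero_le _).trans_lt hlt
    rw [div_lt_div_iff₀ (by linarith) (by linarith)] at h1
    rw [sub_pos, div_lt_iff₀ h5]
    linarith
  obtain ⟨δ, hδ, hδJ⟩ := exists_pos_forall_le hJ
  refine ⟨δ, hδ, fun C L hC hL n hn p hp J hJr hJn hJne => ?_⟩
  have hd := hδJ J (Finset.mem_filter.2 ⟨Finset.mem_powerset.2 hJr, hJn, hJne⟩)
  have hJle : J.card ≤ r := by simpa using Finset.card_le_card hJr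
  have hr : 0 < r := by
    obtain ⟨i, hi⟩ := hJn
    have := Finset.mem_range.1 (hJr hi)
    omega
  have hr' : (0 : ℝ) < r := by exact_mod_cast hr
  have hn' : (1 : ℝ) ≤ n := by exact_mod_cast hn
  have hn0 : (0 : ℝ) < n := by linarith
  have hv : (J.biUnion fe).card ≤ m := (Finset.card_le_univ _).trans (by simp)
  have e1 : p ^ (r - J.card) = C ^ (r - J.card) * L ^ (1 / (r : ℝ) * ((r - J.card : ℕ) : ℝ)) *
      (n : ℝ) ^ (-((m : ℝ) - 1) / r * ((r - J.card : ℕ) : ℝ)) := by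
    rw [hp, mul_pow, mul_pow, ← Real.rpow_mul_natCast (by linarith),
      ← Real.rpow_mul_natCast hn0.le]
  have e2 : L ^ (1 / (r : ℝ) * ((r - J.card : ℕ) : ℝ)) ≤ L := by
    conv_rhs => rw [← Real.rpow_one L]
    refine Real.rpow_le_rpow_of_exponent_le hL ?_
    rw [one_div, inv_mul_le_one₀ hr']
    exact_mod_cast Nat.sub_le _ _
  have e3 : C ^ (r - J.card) ≤ C ^ r := pow_le_pow_right₀ hC (Nat.sub_le _ _)
  have e4 : (n : ℝ) ^ (-((m : ℝ) - 1) / r * ((r - J.card : ℕ) : ℝ)) *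
      (n : ℝ) ^ (m - (J.biUnion fe).card) ≤ (n : ℝ) ^ (-δ) := by
    rw [← Real.rpow_natCast, ← Real.rpow_add hn0]
    refine Real.rpow_le_rpow_of_exponent_le hn' ?_
    rw [Nat.cast_sub hJle, Nat.cast_sub hv]
    have : -((m : ℝ) - 1) / r * (r - J.card) = -((m : ℝ) - 1) + J.card * ((m : ℝ) - 1) / r := by
      field_simp
      ring
    rw [this]
    linarith
  rw [e1, mul_assoc]
  refine mul_le_mul (mul_le_mul e3 e2 (by positivity) (by positivity)) e4 (by positivity)
    (by positivity)
end

section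
variable {m n r k : ℕ}

lemma ev_zero {α : Type*} [Fintype α] [DecidableEq α] (f : Finset α → ℝ) :
    ev (fun _ => 0) f = f ∅ := by
  rw [ev, Finset.sum_eq_single ∅]
  · simp [wt]
  · intro S _ hS
    obtain ⟨i, hi⟩ := Finset.nonempty_iff_ne_empty.2 hS
    rw [wt, Finset.prod_eq_zero (Finset.mem_univ i) (by simp [hi]), zero_mul]
  · simp

open Classical in
lemma sparsProb_eq_ev {α : Type*} [Fintype α] [DecidableEq α] (G : Finset α) (p : ℝ)
    (Q : Finset α → Prop) :
    sparsProb G p Q = ev (fun e => if e ∈ G then p else 0) fun S => if Q S then 1 else 0 := by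
  rw [sparsProb, ev]
  have h : ∀ S ∉ G.powerset, wt (fun e => if e ∈ G then p else 0) S * (if Q S then 1 else 0) = 0 := by
    intro S hS
    rw [Finset.mem_powerset, Finset.not_subset] at hS
    obtain ⟨i, hi, hiG⟩ := hS
    rw [wt, Finset.prod_eq_zero (Finset.mem_univ i) (by simp [hi, hiG]), zero_mul]
  rw [← Finset.sum_subset (Finset.subset_univ _) fun S _ => h S]
  refine Finset.sum_congr rfl fun S hS => ?_
  have hSG := Finset.mem_powerset.1 hS
  have h1 : wt (fun e => if e ∈ G then p else 0) S = p ^ S.card * (1 - p) ^ (G.card - S.card) := by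
    rw [wt, Finset.prod_ite, ← Finset.card_sdiff_of_subset hSG]
    congr 1
    · rw [Finset.filter_mem_eq_inter, Finset.univ_inter,
        Finset.prod_congr rfl fun i hi => if_pos (hSG hi), Finset.prod_const]
    · rw [← Finset.prod_const]
      refine (Finset.prod_subset_one_on_sdiff (fun i hi => ?_) (fun i hi => ?_) fun i hi => ?_).symm
      · simpa using (Finset.mem_sdiff.1 hi).2
      · simp only [Finset.mem_sdiff, Finset.mem_filter, Finset.mem_univ, true_and] at hi
        have : i ∉ G := fun h => hi.2 ⟨h, hi.1⟩
        simp [this]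
      · simp [(Finset.mem_sdiff.1 hi).1]
  rw [h1]
  split_ifs <;> simp

open Classical in
/-- Indicator of having a perfect `F`-tiling. -/
noncomputable def tilingInd (F : Finset (Finset (Fin m))) (E : Finset (Finset (Fin n))) : ℝ :=
  if HasPerfectTiling m n F E then 1 else 0

lemma tilingInd_nonneg (F : Finset (Finset (Fin m))) (E : Finset (Finset (Fin n))) :
    0 ≤ tilingInd F E := by
  unfold tilingInd; split_ifs <;> norm_num

lemma tilingInd_le_one (F : Finset (Finset (Fin m))) (E : Finset (Finset (Fin n))) :
    tilingInd F E ≤ 1 := by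
  unfold tilingInd; split_ifs <;> norm_num

lemma tilingInd_mono (F : Finset (Finset (Fin m))) :
    Monotone (tilingInd F : Finset (Finset (Fin n)) → ℝ) := by
  intro E E' h
  unfold tilingInd
  split_ifs with h1 h2
  · exact le_rfl
  · obtain ⟨T, hT, hT'⟩ := h1
    exact absurd ⟨T, fun φ hφ => ⟨(hT φ hφ).1, fun e he => h ((hT φ hφ).2 e he)⟩, hT'⟩ h2
  · exact zero_le_one
  · exact le_rfl

/-- The random edges together with the edges of the planted copies in `𝒞`. -/
def plant (F : Finset (Finset (Fin m))) (𝒞 : Finset (Fin m → Fin n))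
    (W : Finset (Finset (Fin n) ⊕ (Fin m → Fin n))) : Finset (Finset (Fin n)) :=
  W.toLeft ∪ (W.toRight ∩ 𝒞).biUnion fun φ => F.image fun f => f.image φ

lemma mem_plant {F : Finset (Finset (Fin m))} {𝒞 : Finset (Fin m → Fin n)}
    {W : Finset (Finset (Fin n) ⊕ (Fin m → Fin n))} {x : Finset (Fin n)} :
    x ∈ plant F 𝒞 W ↔ Sum.inl x ∈ W ∨
      ∃ φ, (Sum.inr φ ∈ W ∧ φ ∈ 𝒞) ∧ ∃ f ∈ F, f.image φ = x := by
  simp [plant]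

lemma plant_mono (F : Finset (Finset (Fin m))) (𝒞 : Finset (Fin m → Fin n)) :
    Monotone (plant F 𝒞) := by
  intro W W' h x hx
  rw [mem_plant] at hx ⊢
  rcases hx with hx | ⟨φ, ⟨h1, h2⟩, h3⟩
  · exact Or.inl (h hx)
  · exact Or.inr ⟨φ, ⟨h h1, h2⟩, h3⟩

/-- The copies of `F` in `G`. -/
def copies (F : Finset (Finset (Fin m))) (G : Finset (Finset (Fin n))) :
    Finset (Fin m → Fin n) :=
  Finset.univ.filter fun φ => Function.Injective φ ∧ ∀ e ∈ F, e.image φ ∈ G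

lemma plant_insert_of_notMem {F : Finset (Finset (Fin m))} {𝒞 : Finset (Fin m → Fin n)}
    {φ : Fin m → Fin n} (hφ : φ ∉ 𝒞) (W : Finset (Finset (Fin n) ⊕ (Fin m → Fin n))) :
    plant F 𝒞 (insert (Sum.inr φ) W) = plant F 𝒞 (W.erase (Sum.inr φ)) := by
  refine (plant_mono F 𝒞 ((Finset.erase_subset _ _).trans
    (Finset.subset_insert _ _))).antisymm' fun x hx => ?_
  rw [mem_plant] at hx ⊢
  rcases hx with hx | ⟨ψ, ⟨h1, h2⟩, h3⟩
  · exact Or.inl (by simpa using hx)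
  · have : ψ ≠ φ := fun h => hφ (h ▸ h2)
    exact Or.inr ⟨ψ, ⟨by simpa [this] using h1, h2⟩, h3⟩

lemma plant_insert_of_mem {F : Finset (Finset (Fin m))} {fe : ℕ → Finset (Fin m)}
    (hF : (Finset.range r).image fe = F) {𝒞 : Finset (Fin m → Fin n)}
    {φ : Fin m → Fin n} (hφ : φ ∈ 𝒞) (W : Finset (Finset (Fin n) ⊕ (Fin m → Fin n))) :
    plant F 𝒞 (insert (Sum.inr φ) W) =
      plant F 𝒞 (W.erase (Sum.inr φ) ∪ initialEdges (edgeImage fe) φ r) := by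
  subst hF
  have e1 : ∀ x : Finset (Fin n), (Sum.inl x : Finset (Fin n) ⊕ (Fin m → Fin n)) ∈
      initialEdges (edgeImage fe) φ r ↔ ∃ i < r, (fe i).image φ = x := by
    intro x; simp [initialEdges, edgeImage]
  have e2 : ∀ ψ : Fin m → Fin n, (Sum.inr ψ : Finset (Fin n) ⊕ (Fin m → Fin n)) ∉
      initialEdges (edgeImage fe) φ r := by
    intro ψ; simp [initialEdges]
  ext x
  simp only [mem_plant, Finset.mem_union, e1, e2, or_false, Finset.mem_insert, Finset.mem_erase,
    Finset.mem_image, Finset.mem_range, exists_exists_and_eq_and, reduceCtorEq, false_or, ne_eq,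
    not_false_eq_true, true_and, Sum.inr.injEq]
  constructor
  · rintro (h | ⟨ψ, ⟨rfl | h1, h2⟩, h3⟩)
    · exact Or.inl (Or.inl h)
    · exact Or.inl (Or.inr h3)
    · by_cases hψ : ψ = φ
      · subst hψ; exact Or.inl (Or.inr h3)
      · exact Or.inr ⟨ψ, ⟨⟨hψ, h1⟩, h2⟩, h3⟩
  · rintro ((h | h) | ⟨ψ, ⟨⟨_, h1⟩, h2⟩, h3⟩)
    · exact Or.inl h
    · exact Or.inr ⟨φ, ⟨Or.inl rfl, hφ⟩, h⟩
    · exact Or.inr ⟨ψ, ⟨Or.inr h1, h2⟩, h3⟩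

lemma hit_le_tilingInd {ι : Type*} {O : Finset ι} {T : ι → Finset (Fin m → Fin n)}
    {F : Finset (Finset (Fin m))} {G : Finset (Finset (Fin n))}
    (hT : ∀ σ ∈ O, IsTiling F G (T σ)) (S : Finset (Finset (Fin n)))
    (H : Finset (Fin m → Fin n)) :
    hit O T H ≤ tilingInd F (plant F (copies F G) (S.disjSum H)) := by
  rw [hit, tilingInd]
  split_ifs with h1 h2
  · exact le_rfl
  · obtain ⟨σ, hσ, hH⟩ := h1
    obtain ⟨a1, a2⟩ := hT σ hσ
    refine absurd ⟨T σ, fun φ hφ => ⟨(a1 φ hφ).1, fun e he => ?_⟩, a2⟩ h2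
    rw [mem_plant]
    refine Or.inr ⟨φ, ⟨by simpa using hH hφ, Finset.mem_filter.2 ⟨Finset.mem_univ _, a1 φ hφ⟩⟩,
      e, he, rfl⟩
  · exact zero_le_one
  · exact le_rfl

/-- Random edges perform almost as well as random copies. -/
lemma ev_hit_le_sparsProb {ι : Type*} {O : Finset ι} {T : ι → Finset (Fin m → Fin n)}
    {F : Finset (Finset (Fin m))} {G : Finset (Finset (Fin n))}
    (hT : ∀ σ ∈ O, IsTiling F G (T σ)) {fe : ℕ → Finset (Fin m)}
    (hF : (Finset.range r).image fe = F) (hinj : ∀ i < r, ∀ j < r, fe i = fe j → i = j)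
    (hfe : ∀ i < r, (fe i).card ≤ k) (hG : ∀ e ∈ G, e.card ≤ k)
    (hfull : (Finset.range r).biUnion fe = Finset.univ) {p c : ℝ}
    (hp : 0 < p) (hp1 : p ≤ 1) (hc : 0 ≤ c) (hc1 : c ≤ 1 / 2)
    {M z : ℕ} (hz : k * (r * (M + 1) + 1) ≤ z) (hz1 : 1 ≤ z)
    (hcz : 8 * (r * 4 ^ r * z ^ m * c) ≤ 1) {x : ℝ} (hx0 : 0 ≤ x) (hx1 : x ≤ 1)
    (hx : ∀ J ⊆ Finset.range r, J.Nonempty → J ≠ Finset.range r →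
      p ^ (r - J.card) * (n : ℝ) ^ (m - (J.biUnion fe).card) ≤ x) :
    ev (fun _ => c * p ^ r) (hit O T) - G.card * x ^ (M + 1) ≤
      sparsProb G p fun E => HasPerfectTiling m n F E := by
  have hπ0 : 0 ≤ c * p ^ r := by positivity
  have hπ1 : c * p ^ r ≤ 1 / 2 := by
    have := pow_le_one₀ (n := r) hp.le hp1
    nlinarith [pow_nonneg hp.le r]
  have h1 := ev_interp_le (Φ := Fin m → Fin n) (G := G) (𝒞 := copies F G) (E := edgeImage fe)
    (r := r) (p := p) (π := c * p ^ r) (f := fun W => tilingInd F (plant F (copies F G) W))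
    (fun W W' h => tilingInd_mono F (plant_mono F _ h)) (fun W => tilingInd_nonneg F _)
    (fun W => tilingInd_le_one F _)
    (fun φ hφ j hj => (Finset.mem_filter.1 hφ).2.2 _ (hF ▸ Finset.mem_image_of_mem fe
      (Finset.mem_range.2 hj)))
    (fun φ hφ W => by rw [plant_insert_of_mem hF hφ])
    (fun φ hφ W => by rw [plant_insert_of_notMem hφ]) hp hp1 hπ0 hπ1
    (fun s hs0 hs1 e he => ev_linkWeight_tail_le hinj hfe (hG e he) hfull
      (fun φ hφ => (Finset.mem_filter.1 hφ).2.1) hp hp1 hc (by linarith) hz hz1 hcz hx0 hx1 hx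
      hs0 hs1)
  have e1 : ev (interp (Fin m → Fin n) G p (c * p ^ r) 1)
      (fun W => tilingInd F (plant F (copies F G) W)) =
      sparsProb G p fun E => HasPerfectTiling m n F E := by
    rw [ev_disjSum, sparsProb_eq_ev]
    have e2 : (fun φ : Fin m → Fin n => interp (Fin m → Fin n) G p (c * p ^ r) 1 (Sum.inr φ)) =
        fun _ => 0 := by
      ext φ; simp [interp]
    have e3 : (fun e => interp (Fin m → Fin n) G p (c * p ^ r) 1 (Sum.inl e)) =
        fun e => if e ∈ G then p else 0 := by
      ext e
      simp only [interp, Sum.elim_inl]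
      split_ifs <;> ring
    rw [e2, e3]
    simp only [ev_zero]
    congr 1
    ext S
    rw [tilingInd]
    have e4 : plant F (copies F G) (S.disjSum ∅) = S := by
      ext y; simp [mem_plant]
    rw [e4]
  have e5 : ev (fun _ => c * p ^ r) (hit O T) ≤ ev (interp (Fin m → Fin n) G p (c * p ^ r) 0)
      (fun W => tilingInd F (plant F (copies F G) W)) := by
    have i0 := interp_nonneg (Φ := Fin m → Fin n) (G := G) hp.le hπ0 le_rfl zero_le_one
    have i1 := interp_le_one (Φ := Fin m → Fin n) (G := G) hp.le hp1 hπ0 (by linarith) le_rfl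
      zero_le_one
    rw [ev_disjSum, ← ev_const (fun a => interp (Fin m → Fin n) G p (c * p ^ r) 0 (Sum.inl a))
      (ev (fun _ => c * p ^ r) (hit O T))]
    refine ev_mono (fun _ => i0 _) (fun _ => i1 _) fun S => ?_
    have e6 : (fun φ : Fin m → Fin n => interp (Fin m → Fin n) G p (c * p ^ r) 0 (Sum.inr φ)) =
        fun _ => c * p ^ r := by
      ext φ; simp [interp]
    rw [e6]
    exact ev_mono (fun _ => hπ0) (fun _ => by linarith) fun H => hit_le_tilingInd hT S H
  rw [e1] at h1
  have e7 : 2 * G.card * (p / 4 * x ^ (M + 1)) ≤ G.card * x ^ (M + 1) := by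
    have : 0 ≤ G.card * x ^ (M + 1) := by positivity
    nlinarith
  linarith

lemma sparsProb_mono {F : Finset (Finset (Fin m))} {G : Finset (Finset (Fin n))} {p p' : ℝ}
    (hp : 0 ≤ p) (hpp : p ≤ p') (hp1 : p' ≤ 1) :
    sparsProb G p (fun E => HasPerfectTiling m n F E) ≤
      sparsProb G p' fun E => HasPerfectTiling m n F E := by
  rw [sparsProb_eq_ev, sparsProb_eq_ev]
  refine ev_le_ev (fun e => ?_) (fun e => ?_) (fun e => ?_) (tilingInd_mono F)
  · split_ifs; exacts [hp, le_rfl]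
  · split_ifs; exacts [hpp, le_rfl]
  · split_ifs; exacts [hp1, zero_le_one]
end

section
open Filter Topology
variable {m n r k : ℕ}

lemma hasPerfectTiling_empty (hn : 0 < n) (hmn : m ∣ n) (E : Finset (Finset (Fin n))) :
    HasPerfectTiling m n ∅ E := by
  obtain ⟨q, rfl⟩ := hmn
  refine ⟨Finset.univ.image fun (i : Fin q) (j : Fin m) => finProdFinEquiv (j, i), ?_, ?_, ?_⟩
  · intro φ hφ
    obtain ⟨i, _, rfl⟩ := Finset.mem_image.1 hφ
    exact ⟨fun j j' h => (Prod.ext_iff.1 (finProdFinEquiv.injective h)).1, by simp⟩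
  · intro v
    obtain ⟨⟨j, i⟩, rfl⟩ := finProdFinEquiv.surjective v
    exact ⟨_, Finset.mem_image_of_mem _ (Finset.mem_univ i),
      Finset.mem_image_of_mem (fun j => finProdFinEquiv (j, i)) (Finset.mem_univ j)⟩
  · intro φ hφ ψ hψ hne
    obtain ⟨i, _, rfl⟩ := Finset.mem_image.1 hφ
    obtain ⟨i', _, rfl⟩ := Finset.mem_image.1 hψ
    rw [Finset.disjoint_left]
    intro v hv hv'
    obtain ⟨j, _, rfl⟩ := Finset.mem_image.1 hv
    obtain ⟨j', _, h⟩ := Finset.mem_image.1 hv'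
    refine hne ?_
    have h' : i' = i := congrArg Prod.snd (finProdFinEquiv.injective h)
    rw [h']

lemma exists_enumeration {β : Type*} [DecidableEq β] [Inhabited β] (F : Finset β) :
    ∃ fe : ℕ → β, (∀ i < F.card, ∀ j < F.card, fe i = fe j → i = j) ∧
      (Finset.range F.card).image fe = F := by
  refine ⟨fun i => if h : i < F.card then (F.equivFin.symm ⟨i, h⟩ : β) else default, ?_, ?_⟩
  · intro i hi j hj h
    dsimp only at h
    rw [dif_pos hi, dif_pos hj] at h
    simpa using F.equivFin.symm.injective (Subtype.ext h)
  · ext x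
    rw [Finset.mem_image]
    constructor
    · rintro ⟨i, hi, rfl⟩
      rw [dif_pos (Finset.mem_range.1 hi)]
      exact (F.equivFin.symm _).2
    · intro hx
      refine ⟨F.equivFin ⟨x, hx⟩, Finset.mem_range.2 (F.equivFin ⟨x, hx⟩).2, ?_⟩
      rw [dif_pos (F.equivFin ⟨x, hx⟩).2]
      simp

lemma StrictlyOneBalanced.biUnion_eq_univ {F : Finset (Finset (Fin m))}
    (hbal : StrictlyOneBalanced m F) (hk : 2 ≤ k) (hF : IsHG k m F) (hne : F.Nonempty) :
    F.biUnion id = Finset.univ := by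
  by_contra h
  have h1 := hbal (F.biUnion id) F subset_rfl
    (fun e he => Finset.subset_biUnion_of_mem id he) hne fun h' => h h'.1
  obtain ⟨e, he⟩ := hne
  have h2 : 2 ≤ (F.biUnion id).card :=
    (hk.trans (hF e he).ge).trans (Finset.card_le_card (Finset.subset_biUnion_of_mem id he))
  have h3 : (F.biUnion id).card ≤ m := (Finset.card_le_univ _).trans (by simp)
  have h2' : (2 : ℝ) ≤ (F.biUnion id).card := by exact_mod_cast h2
  have h3' : ((F.biUnion id).card : ℝ) ≤ m := by exact_mod_cast h3
  rw [oneDensity] at h1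
  exact absurd h1 (not_lt.2 (div_le_div_of_nonneg_left (by positivity) (by linarith) (by linarith)))

lemma UniformlyDense.mono {ε d d' : ℝ} {G : Finset (Finset (Fin n))}
    (h : UniformlyDense k n ε d G) (hd : d' ≤ d) : UniformlyDense k n ε d' G := fun X =>
  le_trans (sub_le_sub_right (mul_le_mul_of_nonneg_right hd (by positivity)) _) (h X)

lemma card_edges_le {G : Finset (Finset (Fin n))} (hG : IsHG k n G) : G.card ≤ n ^ k := by
  have h1 : G ⊆ Finset.powersetCard k Finset.univ := fun e he =>
    Finset.mem_powersetCard.2 ⟨Finset.subset_univ _, hG e he⟩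
  refine (Finset.card_le_card h1).trans ?_
  rw [Finset.card_powersetCard, Finset.card_univ, Fintype.card_fin]
  exact Nat.choose_le_pow n k

lemma eventually_log_le {A δ ε : ℝ} (hδ : 0 < δ) (hε : 0 < ε) :
    ∃ n₀ : ℕ, ∀ n : ℕ, n₀ ≤ n → 1 ≤ n ∧ 1 ≤ Real.log n ∧
      A * Real.log n * (n : ℝ) ^ (-δ) ≤ (n : ℝ) ^ (-(δ / 2)) ∧ 1 / (n : ℝ) ≤ ε := by
  have t1 : ∀ᶠ x : ℝ in atTop, 1 ≤ Real.log x := Real.tendsto_log_atTop.eventually_ge_atTop 1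
  have t2 : ∀ᶠ x : ℝ in atTop, ‖Real.log x‖ ≤ (1 + |A|)⁻¹ * ‖x ^ (δ / 2)‖ :=
    (isLittleO_log_rpow_atTop (half_pos hδ)).bound (by positivity)
  have t3 : ∀ᶠ x : ℝ in atTop, max 1 (1 / ε) ≤ x := eventually_ge_atTop _
  have t := tendsto_natCast_atTop_atTop (R := ℝ) |>.eventually (t1.and (t2.and t3))
  obtain ⟨n₀, hn₀⟩ := eventually_atTop.1 t
  refine ⟨n₀, fun n hn => ?_⟩
  obtain ⟨h1, h2, h3⟩ := hn₀ n hn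
  have hn1 : (1 : ℝ) ≤ n := (le_max_left _ _).trans h3
  have hn0 : (0 : ℝ) < n := by linarith
  refine ⟨by exact_mod_cast hn1, h1, ?_, ?_⟩
  · rw [Real.norm_of_nonneg (by linarith), Real.norm_of_nonneg (by positivity)] at h2
    have e1 : (n : ℝ) ^ (-(δ / 2)) = (n : ℝ) ^ (δ / 2) * (n : ℝ) ^ (-δ) := by
      rw [← Real.rpow_add hn0]
      congr 1
      ring
    rw [e1]
    refine mul_le_mul_of_nonneg_right ?_ (by positivity)
    have hA : 0 < 1 + |A| := by positivity
    rw [inv_mul_eq_div, le_div_iff₀ hA] at h2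
    nlinarith [le_abs_self A]
  · rw [div_le_iff₀ hn0]
    have := (le_max_right _ _).trans h3
    rwa [div_le_iff₀ hε, mul_comm] at this

lemma perfect_tilings_of_nonempty (hk : 2 ≤ k) {d μ : ℝ} (hd : 0 < d) (hμ : 0 < μ)
    {F : Finset (Finset (Fin m))} (hF : IsHG k m F) (hne : F.Nonempty)
    (hbal : StrictlyOneBalanced m F) (hFtil : InFtil k m F) :
    ∃ C ε : ℝ, 0 < C ∧ 0 < ε ∧
      ∀ ε' : ℝ, 0 < ε' → ∃ n₀ : ℕ, ∀ n, n₀ ≤ n →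
        ∀ G : Finset (Finset (Fin n)), IsHG k n G →
          UniformlyDense k n ε d G →
          MinDegGE G 1 (μ * (n : ℝ) ^ (k - 1)) →
          ∀ p : ℝ, p ≤ 1 →
            C * (Real.log n) ^ ((1 : ℝ) / (F.card : ℝ))
              * (n : ℝ) ^ (-(1 / oneDensity m F)) ≤ p →
            m ∣ n →
            1 - ε' ≤ sparsProb G p (fun E => HasPerfectTiling m n F E) := by
  have hm : 2 ≤ m := by
    obtain ⟨e, he⟩ := hne
    have : e.card ≤ m := (Finset.card_le_univ _).trans (by simp)
    rw [hF e he] at this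
    omega
  obtain ⟨K, hK, ε, hε, n₁, hsp⟩ := exists_spread_tilings hk (by omega : 0 < m) hFtil
    (lt_min hd one_pos) (min_le_right _ _) (lt_min hμ one_pos) (min_le_right _ _)
  obtain ⟨fe, hinj, hfeF⟩ := exists_enumeration F
  have hr : 0 < F.card := hne.card_pos
  have hoD : -(1 / oneDensity m F) = -((m : ℝ) - 1) / F.card := by
    rw [oneDensity, one_div_div, neg_div]
  rw [hoD]
  have hfull : (Finset.range F.card).biUnion fe = Finset.univ := by
    rw [← hbal.biUnion_eq_univ hk hF hne, ← hfeF, Finset.image_biUnion, hfeF]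
    rfl
  generalize hrF : F.card = r at *
  have hfe : ∀ i < r, (fe i).card = k := fun i hi =>
    hF _ (hfeF ▸ Finset.mem_image_of_mem fe (Finset.mem_range.2 hi))
  obtain ⟨δ, hδ, hext⟩ := exists_extension_exponent hk hm hbal hinj hfe hfeF
  obtain ⟨M, hM⟩ := exists_nat_ge (2 * (k + 1) / δ)
  set z : ℕ := k * (r * (M + 1) + 1) with hz
  have hz1 : 1 ≤ z := by
    rw [hz]
    exact Nat.one_le_iff_ne_zero.2 (Nat.mul_ne_zero (by omega) (by omega))
  set D : ℝ := 8 * (r * 4 ^ r * z ^ m) with hD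
  have hr1 : (1 : ℝ) ≤ r := by exact_mod_cast hr
  have hD8 : 8 ≤ D := by
    have h1 : (1 : ℝ) ≤ 4 ^ r := one_le_pow₀ (by norm_num)
    have h2 : (1 : ℝ) ≤ (z : ℝ) ^ m := one_le_pow₀ (by exact_mod_cast hz1)
    have h3 := one_le_mul_of_one_le_of_one_le (one_le_mul_of_one_le_of_one_le hr1 h1) h2
    linarith
  set c : ℝ := D⁻¹ with hc
  have hc0 : 0 < c := by positivity
  have hDc : D * c = 1 := mul_inv_cancel₀ (by positivity)
  have hc1 : c ≤ 1 / 2 := by nlinarith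
  set C : ℝ := 1 + 200 * K / c with hC
  have hC1 : 1 ≤ C := by
    have : 0 ≤ 200 * K / c := by positivity
    linarith
  have hCc : 200 * K ≤ c * C ^ r := by
    have h1 : C ≤ C ^ r := le_self_pow₀ hC1 hr.ne'
    have h2 : c * C = c + 200 * K := by rw [hC]; field_simp
    nlinarith
  refine ⟨C, ε, by linarith, hε, fun ε' hε' => ?_⟩
  obtain ⟨n₂, hhit⟩ := exists_hit_threshold (m := m) hK (half_pos hε')
  obtain ⟨n₃, hlog⟩ := eventually_log_le (A := C ^ r) hδ (half_pos hε')
  refine ⟨max n₁ (max n₂ n₃), fun n hn G hG hdense hdeg p' hp'1 hpp' hmn => ?_⟩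
  simp only [max_le_iff] at hn
  obtain ⟨hn1, hL1, hx, hn'⟩ := hlog n hn.2.2
  obtain ⟨O, T, hO, hspread, hT⟩ := hsp n hn.1 hmn G hG (hdense.mono (min_le_left _ _))
    (fun S hS => le_trans (mul_le_mul_of_nonneg_right (min_le_left _ _) (by positivity)) (hdeg S hS))
  set p : ℝ := C * Real.log n ^ (1 / (r : ℝ)) * (n : ℝ) ^ (-((m : ℝ) - 1) / r) with hp
  have hn0 : (0 : ℝ) < n := by exact_mod_cast hn1
  have hnR : (1 : ℝ) ≤ n := by exact_mod_cast hn1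
  have hp0 : 0 < p := by
    have : 0 < Real.log n := by linarith
    positivity
  have hp1 : p ≤ 1 := hpp'.trans hp'1
  have hpr : p ^ r = C ^ r * (Real.log n / (n : ℝ) ^ (m - 1)) := by
    rw [hp, mul_pow, mul_pow, ← Real.rpow_mul_natCast (by linarith),
      ← Real.rpow_mul_natCast hn0.le, one_div_mul_cancel (by positivity), Real.rpow_one,
      div_mul_cancel₀ _ (by positivity), Real.rpow_neg hn0.le, mul_assoc, div_eq_mul_inv,
      ← Real.rpow_natCast (n : ℝ) (m - 1), Nat.cast_sub (by omega), Nat.cast_one]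
  have hx1 : (n : ℝ) ^ (-(δ / 2)) ≤ 1 :=
    Real.rpow_le_one_of_one_le_of_nonpos hnR (by linarith)
  have h1 := ev_hit_le_sparsProb hT hfeF hinj (fun i hi => (hfe i hi).le) (fun e he => (hG e he).le)
    hfull hp0 hp1 hc0.le hc1 (M := M) (z := z) le_rfl hz1
    (by rw [← hDc, hD]; exact le_of_eq (by ring)) (x := (n : ℝ) ^ (-(δ / 2))) (by positivity) hx1
    (fun J hJ hJn hJne => (hext C (Real.log n) hC1 hL1 n hn1 p hp J hJ hJn hJne).trans hx)
  have h2 := hhit n hn.2.1 O T hO hspread (fun σ hσ => (hT σ hσ).card_le (by omega)) (c * p ^ r)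
    (by
      rw [hpr, mul_div_assoc, ← mul_assoc]
      exact mul_le_mul_of_nonneg_right hCc (by positivity))
    (by
      have := pow_le_one₀ (n := r) hp0.le hp1
      nlinarith)
  have h3 : (G.card : ℝ) * ((n : ℝ) ^ (-(δ / 2))) ^ (M + 1) ≤ ε' / 2 := by
    refine le_trans ?_ hn'
    have h4 : (G.card : ℝ) ≤ (n : ℝ) ^ (k : ℝ) := by
      rw [Real.rpow_natCast]; exact_mod_cast card_edges_le hG
    rw [← Real.rpow_mul_natCast hn0.le]
    refine (mul_le_mul_of_nonneg_right h4 (by positivity)).trans ?_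
    rw [← Real.rpow_add hn0, one_div, ← Real.rpow_neg_one]
    refine Real.rpow_le_rpow_of_exponent_le hnR ?_
    rw [div_le_iff₀ hδ] at hM
    push_cast
    nlinarith
  have h5 := sparsProb_mono (F := F) (G := G) hp0.le hpp' hp'1
  linarith
end

/-- **Perfect tilings — uniform density.** -/
theorem perfect_tilings_uniformly_dense
    (k : ℕ) (hk : 2 ≤ k) (d μ : ℝ) (hd : 0 < d) (hμ : 0 < μ)
    (m : ℕ) (F : Finset (Finset (Fin m))) (hF : IsHG k m F)
    (hbal : StrictlyOneBalanced m F) (hFtil : InFtil k m F) :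
    ∃ C ε : ℝ, 0 < C ∧ 0 < ε ∧
      ∀ ε' : ℝ, 0 < ε' → ∃ n₀ : ℕ, ∀ n, n₀ ≤ n →
        ∀ G : Finset (Finset (Fin n)), IsHG k n G →
          UniformlyDense k n ε d G →
          MinDegGE G 1 (μ * (n : ℝ) ^ (k - 1)) →
          ∀ p : ℝ, 0 ≤ p → p ≤ 1 →
            C * (Real.log n) ^ ((1 : ℝ) / (F.card : ℝ))
              * (n : ℝ) ^ (-(1 / oneDensity m F)) ≤ p →
            m ∣ n →
            1 - ε' ≤ sparsProb G p (fun E => HasPerfectTiling m n F E) := by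
  rcases F.eq_empty_or_nonempty with rfl | hne
  · refine ⟨1, 1, one_pos, one_pos, fun ε' hε' => ⟨1, fun n hn G _ _ _ p _ _ _ hmn => ?_⟩⟩
    rw [sparsProb_eq_ev]
    simp only [hasPerfectTiling_empty hn hmn, if_true, ev_const]
    linarith
  · obtain ⟨C, ε, hC, hε, h⟩ := perfect_tilings_of_nonempty hk hd hμ hF hne hbal hFtil
    refine ⟨C, ε, hC, hε, fun ε' hε' => ?_⟩
    obtain ⟨n₀, hn₀⟩ := h ε' hε'
    exact ⟨n₀, fun n hn G hG hd hdeg p _ hp1 hp hmn => hn₀ n hn G hG hd hdeg p hp1 hp hmn⟩
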